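/- arXiv:0903.0198 — 8 statements merged into one kernel-verified Lean document; each statement's English description precedes it below -/
import Mathlib

section
/- For every 0 < γ < 1 and 0 < δ < 1 there exist N = N(γ,δ) and T = T(γ,δ) such that: if G is a finite simple graph on n ≥ N vertices whose triangle density d_{K_3}(G) equals γ, then there is some integer t with 2 ≤ t ≤ T for which the K_{t,t,t}-density of G satisfies d_{K_{t,t,t}}(G) ≥ γ^{(1+δ)t²}. -/
open SimpleGraph Finset

/-- The number of graph homomorphisms from `H` to `G`. -/
noncomputable def homCount {α β : Type*} (H : SimpleGraph α) (G : SimpleGraph β) : ℕ :=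
  Nat.card (H →g G)

/-- The `H`-density of `G`: the number of homomorphisms from `H` to `G`
divided by `|V(G)|^|V(H)|`. -/
noncomputable def homDensity {α β : Type*} [Fintype α] [Fintype β]
    (H : SimpleGraph α) (G : SimpleGraph β) : ℝ :=
  (homCount H G : ℝ) / (Fintype.card β : ℝ) ^ (Fintype.card α)

/-- The triangle `K₃`. -/
def triangleGraph : SimpleGraph (Fin 3) := ⊤

/-- The complete tripartite graph `K_{a,b,c}`, the `(a,b,c)`-blowup of the triangle. -/
def Kabc (a b c : ℕ) : SimpleGraph (Σ i : Fin 3, Fin (![a, b, c] i)) :=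
  completeMultipartiteGraph (fun i => Fin (![a, b, c] i))


lemma pm_aux {ι : Type*} (s : Finset ι) (f : ι → ℝ) (hf : ∀ i ∈ s, 0 ≤ f i) (c : ℝ) (hc : 0 ≤ c)
    (h : c * #s ≤ ∑ i ∈ s, f i) (n : ℕ) : c ^ n * #s ≤ ∑ i ∈ s, f i ^ n := by
  rcases s.eq_empty_or_nonempty with rfl | hs
  · simp
  have hs' : (0:ℝ) < #s := by exact_mod_cast hs.card_pos
  rcases n with _ | n
  · simp
  have h1 := pow_sum_div_card_le_sum_pow (s := s) (f := f) (fun i hi => hf i hi) n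
  refine le_trans ?_ h1
  rw [le_div_iff₀ (by positivity)]
  calc c ^ (n+1) * #s * (#s:ℝ)^n = (c * #s)^(n+1) := by ring
    _ ≤ _ := pow_le_pow_left₀ (by positivity) h _

lemma kss_aux {α β ι : Type*} [Fintype α] [Fintype β] [Fintype ι] [DecidableEq ι]
    (r : α → β → ℝ) (hr : ∀ x y, 0 ≤ r x y) (d : ℝ) (hd : 0 ≤ d)
    (h : d * (Fintype.card α * Fintype.card β) ≤ ∑ x, ∑ y, r x y) :
    d ^ (Fintype.card ι ^ 2) * ((Fintype.card α : ℝ) * Fintype.card β) ^ Fintype.card ι ≤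
      ∑ x : ι → α, ∑ y : ι → β, ∏ i, ∏ j, r (x i) (y j) := by
  set s := Fintype.card ι with hs
  have h1 : (d * Fintype.card α) ^ s * #(univ : Finset β) ≤ ∑ y : β, (∑ x, r x y) ^ s := by
    apply pm_aux
    · intro i _; exact sum_nonneg fun x _ => hr x i
    · positivity
    · rw [sum_comm] at h
      simp only [card_univ]; linarith
  have h2 : ∑ y : β, (∑ x, r x y) ^ s = ∑ x : ι → α, ∑ y, ∏ i, r (x i) y := by
    rw [sum_comm]
    refine sum_congr rfl fun y _ => ?_
    have := Finset.prod_univ_sum (fun _ : ι => (univ : Finset α)) (fun _ x => r x y)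
    simp only [prod_const, card_univ, Fintype.piFinset_univ] at this
    rw [← hs] at this
    exact this
  have h3 : (d ^ s * Fintype.card β) ^ s * #(univ : Finset (ι → α)) ≤
      ∑ x : ι → α, (∑ y, ∏ i, r (x i) y) ^ s := by
    apply pm_aux
    · intro x _; exact sum_nonneg fun y _ => prod_nonneg fun i _ => hr _ _
    · positivity
    · rw [← h2]
      refine le_trans (le_of_eq ?_) h1
      simp only [card_univ, Fintype.card_fun]
      push_cast
      ring
  have h4 : ∑ x : ι → α, (∑ y, ∏ i, r (x i) y) ^ s =
      ∑ x : ι → α, ∑ y : ι → β, ∏ i, ∏ j, r (x i) (y j) := by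
    refine sum_congr rfl fun x _ => ?_
    have := Finset.prod_univ_sum (fun _ : ι => (univ : Finset β)) (fun _ y => ∏ i, r (x i) y)
    simp only [prod_const, card_univ, Fintype.piFinset_univ] at this
    rw [← hs] at this
    rw [this]
    refine sum_congr rfl fun y _ => ?_
    rw [prod_comm]
  rw [← h4]
  refine le_trans (le_of_eq ?_) h3
  simp only [card_univ, Fintype.card_fun]
  push_cast
  rw [← hs]
  ring

/-- Existence of a permutation sending `inl` into a given set. -/
lemma perm_aux {t m : ℕ} (I : Finset (Fin t ⊕ Fin m)) (hI : #I = t) :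
    ∃ e : Equiv.Perm (Fin t ⊕ Fin m), ∀ i, e (Sum.inl i) ∈ I := by
  classical
  have hc : Fintype.card {x : Fin t ⊕ Fin m // x ∈ Set.range Sum.inl} = Fintype.card {x // x ∈ I} := by
    rw [Fintype.card_coe, hI]
    have : Fintype.card (Set.range (Sum.inl : Fin t → Fin t ⊕ Fin m)) = t := by
      rw [Set.card_range_of_injective Sum.inl_injective]; simp
    convert this
  let e := Fintype.equivOfCardEq hc
  exact ⟨e.extendSubtype, fun i => e.extendSubtype_mem _ ⟨i, rfl⟩⟩

lemma sum_perm_aux {α : Type*} [Fintype α] {t m : ℕ} (e : Equiv.Perm (Fin t ⊕ Fin m))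
    (f : (Fin t → α) → ℝ) :
    ∑ x : Fin t ⊕ Fin m → α, f (fun i => x (e (Sum.inl i))) =
      (Fintype.card α : ℝ) ^ m * ∑ x : Fin t → α, f x := by
  have h1 := Equiv.sum_comp (Equiv.arrowCongr e (Equiv.refl α))
    (fun x : Fin t ⊕ Fin m → α => f (fun i => x (e (Sum.inl i))))
  rw [← h1]
  have h2 := Equiv.sum_comp (Equiv.sumArrowEquivProdArrow (Fin t) (Fin m) α)
    (fun p => f p.1)
  simp only [Equiv.arrowCongr_apply, Function.comp, Equiv.symm_apply_apply, Equiv.refl_apply]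
  have h3 : ∑ p : (Fin t → α) × (Fin m → α), f p.1 = (Fintype.card α : ℝ) ^ m * ∑ x : Fin t → α, f x := by
    rw [Fintype.sum_prod_type]
    simp [mul_sum]
  rw [← h3, ← h2]
  rfl

lemma choose_aux (t m : ℕ) (y : ℝ) (hy : 0 < y) :
    ((t + m).choose t : ℝ) * y ^ m ≤ (1 + y) ^ (t + m) := by
  rw [add_pow]
  have := single_le_sum (f := fun k => (1:ℝ) ^ k * y ^ (t + m - k) * ((t+m).choose k : ℝ))
    (s := range (t + m + 1)) (fun i _ => by positivity) (a := t) (by simp)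
  simp only [one_pow, one_mul, Nat.add_sub_cancel_left] at this ⊢
  linarith

lemma markov_aux {α : Type*} [Fintype α] (f : α → ℝ) (hf : ∀ x, 0 ≤ f x) (c : ℝ) :
    (∑ x, (if f x ≤ c then (0:ℝ) else 1)) * c ≤ ∑ x, f x := by
  rw [sum_mul]
  refine sum_le_sum fun x _ => ?_
  split_ifs with h
  · simpa using hf x
  · push Not at h; linarith

open Classical in
lemma near_core {α β κ : Type*} [Fintype α] [Fintype β] [Fintype κ]
    (hα : 0 < Fintype.card α) (hβ : 0 < Fintype.card β) (hκ : 0 < Fintype.card κ)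
    (t m : ℕ) (hm : 1 ≤ m) (P : α → β → Prop) (Q : β → κ → Prop) (S : α → κ → Prop)
    (ν : ℝ) (hν0 : 0 < ν) (hν1 : 3 * ν ≤ 1) (hν : 3 * ν * (t + m) ≤ m)
    (hP : ∑ x, ∑ y, (if P x y then (0:ℝ) else 1) ≤ ν ^ 2 * (Fintype.card α * Fintype.card β))
    (hQ : ∑ x, ∑ y, (if Q x y then (0:ℝ) else 1) ≤ ν ^ 2 * (Fintype.card β * Fintype.card κ))
    (hS : ∑ x, ∑ y, (if S x y then (0:ℝ) else 1) ≤ ν ^ 2 * (Fintype.card α * Fintype.card κ)) :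
    (1 - 3 * ν) ^ ((t + m) ^ 2) *
      ((Fintype.card α : ℝ) * Fintype.card β * Fintype.card κ) ^ t ≤
      (3 * ((t + m).choose t : ℝ) ^ 2) ^ t *
      ∑ x : Fin t → α, ∑ y : Fin t → β, ∑ z : Fin t → κ,
        (if (∀ i j, P (x i) (y j)) ∧ (∀ j k, Q (y j) (z k)) ∧ (∀ i k, S (x i) (z k))
          then (1:ℝ) else 0) := by
  have hα' : (0:ℝ) < Fintype.card α := by exact_mod_cast hα
  have hβ' : (0:ℝ) < Fintype.card β := by exact_mod_cast hβ
  have hκ' : (0:ℝ) < Fintype.card κ := by exact_mod_cast hκ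
  have hm' : (1:ℝ) ≤ m := by exact_mod_cast hm
  set b : ℝ := ((t + m).choose t : ℝ) with hb
  have hbpos : 0 < b := by
    rw [hb]; exact_mod_cast Nat.choose_pos (by omega)
  set fA : α → ℝ := fun x => ∑ z, (if S x z then (0:ℝ) else 1) with hfA
  set fB : β → ℝ := fun x => ∑ z, (if Q x z then (0:ℝ) else 1) with hfB
  have hfA0 : ∀ x, 0 ≤ fA x := fun x => sum_nonneg fun z _ => by split_ifs <;> norm_num
  have hfB0 : ∀ x, 0 ≤ fB x := fun x => sum_nonneg fun z _ => by split_ifs <;> norm_num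
  have mA : (∑ x, (if fA x ≤ ν * Fintype.card κ then (0:ℝ) else 1)) ≤ ν * Fintype.card α := by
    have := markov_aux fA hfA0 (ν * Fintype.card κ)
    have h2 := this.trans hS
    have h3 : 0 < ν * Fintype.card κ := by positivity
    refine le_of_mul_le_mul_right (h2.trans (le_of_eq ?_)) h3
    ring
  have mB : (∑ x, (if fB x ≤ ν * Fintype.card κ then (0:ℝ) else 1)) ≤ ν * Fintype.card β := by
    have := markov_aux fB hfB0 (ν * Fintype.card κ)
    have h2 := this.trans hQ
    have h3 : 0 < ν * Fintype.card κ := by positivity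
    refine le_of_mul_le_mul_right (h2.trans (le_of_eq ?_)) h3
    ring
  set p : α → β → ℝ := fun x y =>
    if P x y ∧ fA x ≤ ν * Fintype.card κ ∧ fB y ≤ ν * Fintype.card κ then 1 else 0 with hp
  have hp0 : ∀ x y, 0 ≤ p x y := fun x y => by simp only [hp]; split_ifs <;> norm_num
  have hpsum : (1 - 3 * ν) * (Fintype.card α * Fintype.card β) ≤ ∑ x, ∑ y, p x y := by
    have h1 : ∑ x : α, ∑ y : β, (1 - (if P x y then (0:ℝ) else 1)
        - (if fA x ≤ ν * Fintype.card κ then (0:ℝ) else 1)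
        - (if fB y ≤ ν * Fintype.card κ then (0:ℝ) else 1)) ≤ ∑ x, ∑ y, p x y := by
      refine sum_le_sum fun x _ => sum_le_sum fun y _ => ?_
      simp only [hp]
      by_cases h1 : P x y <;> by_cases h2 : fA x ≤ ν * Fintype.card κ <;>
        by_cases h3 : fB y ≤ ν * Fintype.card κ <;> simp [h1, h2, h3]
    refine le_trans ?_ h1
    simp only [sum_sub_distrib, sum_const, card_univ, nsmul_eq_mul, mul_one, ← mul_sum]
    have e1 := mul_le_mul_of_nonneg_right mA hβ'.le
    have e2 := mul_le_mul_of_nonneg_left mB hα'.le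
    have e3 : ν ^ 2 * (Fintype.card α * Fintype.card β : ℝ) ≤ ν * (Fintype.card α * Fintype.card β) := by
      apply mul_le_mul_of_nonneg_right _ (by positivity)
      nlinarith
    nlinarith
  have hk := kss_aux (ι := Fin t ⊕ Fin m) p hp0 (1 - 3 * ν) (by linarith) hpsum
  simp only [Fintype.card_sum, Fintype.card_fin] at hk
  have hperm : ∀ I : Finset (Fin t ⊕ Fin m), ∃ e : Equiv.Perm (Fin t ⊕ Fin m),
      #I = t → ∀ i, e (Sum.inl i) ∈ I := by
    intro I
    by_cases hI : #I = t
    · obtain ⟨e, he⟩ := perm_aux I hI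
      exact ⟨e, fun _ => he⟩
    · exact ⟨1, fun h => absurd h hI⟩
  choose e he using hperm
  set ind : (Fin t → α) → (Fin t → β) → (Fin t → κ) → ℝ := fun x y z =>
    (if (∀ i j, P (x i) (y j)) ∧ (∀ j k, Q (y j) (z k)) ∧ (∀ i k, S (x i) (z k))
          then (1:ℝ) else 0) with hind
  have hind0 : ∀ x y z, 0 ≤ ind x y z := fun x y z => by simp only [hind]; split_ifs <;> norm_num
  set PS := powersetCard t (univ : Finset (Fin t ⊕ Fin m)) with hPS
  have hPSc : (#PS : ℝ) = b := by simp [hPS, hb]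
  have key : ∀ (x : Fin t ⊕ Fin m → α) (y : Fin t ⊕ Fin m → β),
      (∏ i, ∏ j, p (x i) (y j)) * ((Fintype.card κ / (3 * b ^ 2)) ^ t * b ^ 2) ≤
      ∑ IJ ∈ PS ×ˢ PS, ∑ z, ind (fun i => x (e IJ.1 (Sum.inl i))) (fun i => y (e IJ.2 (Sum.inl i))) z := by
    intro x y
    by_cases hall : ∀ i j, p (x i) (y j) = 1
    swap
    · push Not at hall
      obtain ⟨i, j, hij⟩ := hall
      have : p (x i) (y j) = 0 := by
        simp only [hp] at hij ⊢
        split_ifs at hij ⊢ with h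
        · exact absurd rfl hij
        · rfl
      rw [prod_eq_zero (mem_univ i) (prod_eq_zero (mem_univ j) this), zero_mul]
      exact sum_nonneg fun _ _ => sum_nonneg fun _ _ => hind0 _ _ _
    have hall' : ∀ i j, P (x i) (y j) ∧ fA (x i) ≤ ν * Fintype.card κ ∧ fB (y j) ≤ ν * Fintype.card κ := by
      intro i j
      have := hall i j
      simp only [hp] at this
      by_contra hcon
      simp [hcon] at this
    simp only [hall, prod_const_one, one_mul]
    set N : Finset (Fin t ⊕ Fin m) × Finset (Fin t ⊕ Fin m) → ℝ := fun IJ =>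
      ∑ z : κ, (if (∀ i, S (x (e IJ.1 (Sum.inl i))) z) ∧ (∀ i, Q (y (e IJ.2 (Sum.inl i))) z)
        then (1:ℝ) else 0) with hN
    have hN0 : ∀ IJ, 0 ≤ N IJ := fun IJ => sum_nonneg fun z _ => by split_ifs <;> norm_num
    have hNt : ∀ IJ ∈ PS ×ˢ PS, N IJ ^ t = ∑ z, ind (fun i => x (e IJ.1 (Sum.inl i))) (fun i => y (e IJ.2 (Sum.inl i))) z := by
      intro IJ _
      simp only [hN]
      rw [Fintype.sum_pow]
      refine sum_congr rfl fun z _ => ?_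
      simp only [hind]
      rw [prod_ite_zero]
      simp only [prod_const_one, mem_univ, true_imp_iff]
      congr 1
      apply propext
      constructor
      · intro h
        exact ⟨fun i j => (hall' _ _).1, fun j k => (h k).2 j, fun i k => (h k).1 i⟩
      · intro h k
        exact ⟨fun i => h.2.2 i k, fun j => h.2.1 j k⟩
    rw [← sum_congr rfl hNt]
    have hcard : (#(PS ×ˢ PS) : ℝ) = b ^ 2 := by
      rw [card_product]; push_cast; rw [hPSc]; ring
    rw [← hcard]
    apply pm_aux _ _ (fun i _ => hN0 i) _ (by positivity)
    rw [hcard]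
    have : (Fintype.card κ / (3 * b ^ 2) : ℝ) * b ^ 2 = Fintype.card κ / 3 := by
      field_simp
    rw [this]
    -- lower bound on the sum of N
    set gA : κ → ℝ := fun z => ∑ i, (if S (x i) z then (0:ℝ) else 1) with hgA
    set gB : κ → ℝ := fun z => ∑ i, (if Q (y i) z then (0:ℝ) else 1) with hgB
    have hgA0 : ∀ x, 0 ≤ gA x := fun x => sum_nonneg fun z _ => by split_ifs <;> norm_num
    have hgB0 : ∀ x, 0 ≤ gB x := fun x => sum_nonneg fun z _ => by split_ifs <;> norm_num
    have hne : Nonempty (Fin t ⊕ Fin m) := ⟨Sum.inr ⟨0, hm⟩⟩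
    have sA : ∑ z, gA z ≤ m * Fintype.card κ / 3 := by
      simp only [hgA]
      rw [sum_comm]
      calc _ ≤ ∑ i : Fin t ⊕ Fin m, ν * (Fintype.card κ : ℝ) :=
            sum_le_sum fun i _ => (hall' i hne.some).2.1
        _ = (ν * (t + m)) * Fintype.card κ := by
            simp; ring
        _ ≤ _ := by nlinarith
    have sB : ∑ z, gB z ≤ m * Fintype.card κ / 3 := by
      simp only [hgB]
      rw [sum_comm]
      calc _ ≤ ∑ i : Fin t ⊕ Fin m, ν * (Fintype.card κ : ℝ) :=
            sum_le_sum fun i _ => (hall' hne.some i).2.2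
        _ = (ν * (t + m)) * Fintype.card κ := by
            simp; ring
        _ ≤ _ := by nlinarith
    have tA : ∑ z, (if gA z ≤ m then (0:ℝ) else 1) ≤ Fintype.card κ / 3 := by
      have := (markov_aux gA hgA0 m).trans sA
      refine le_of_mul_le_mul_right (this.trans (le_of_eq ?_)) (by linarith : (0:ℝ) < m)
      ring
    have tB : ∑ z, (if gB z ≤ m then (0:ℝ) else 1) ≤ Fintype.card κ / 3 := by
      have := (markov_aux gB hgB0 m).trans sB
      refine le_of_mul_le_mul_right (this.trans (le_of_eq ?_)) (by linarith : (0:ℝ) < m)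
      ring
    have hex : ∀ R : Fin t ⊕ Fin m → Prop, ∑ i, (if R i then (0:ℝ) else 1) ≤ m →
        ∃ I ∈ PS, ∀ i ∈ I, R i := by
      intro R hR
      have h1 : (∑ i, (if R i then (0:ℝ) else 1)) = #(univ.filter fun i => ¬ R i) := by
        rw [card_filter]; push_cast
        refine sum_congr rfl fun i _ => ?_
        by_cases h : R i <;> simp [h]
      rw [h1] at hR
      have h2 : #(univ.filter fun i => ¬ R i) ≤ m := by exact_mod_cast hR
      have h3 : #(univ.filter fun i => R i) + #(univ.filter fun i => ¬ R i) = t + m := by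
        have := card_filter_add_card_filter_not (s := (univ : Finset (Fin t ⊕ Fin m))) R
        simp only [card_univ, Fintype.card_sum, Fintype.card_fin] at this
        convert this
      have h4 : t ≤ #(univ.filter fun i => R i) := by omega
      obtain ⟨I, hI, hIc⟩ := exists_subset_card_eq h4
      refine ⟨I, by simp [hPS, hIc], fun i hi => ?_⟩
      simpa using hI hi
    have hpt : ∀ z : κ, (1:ℝ) - (if gA z ≤ m then (0:ℝ) else 1) - (if gB z ≤ m then (0:ℝ) else 1) ≤
        ∑ IJ ∈ PS ×ˢ PS, (if (∀ i, S (x (e IJ.1 (Sum.inl i))) z) ∧ (∀ i, Q (y (e IJ.2 (Sum.inl i))) z)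
        then (1:ℝ) else 0) := by
      intro z
      have hnn : (0:ℝ) ≤ ∑ IJ ∈ PS ×ˢ PS, (if (∀ i, S (x (e IJ.1 (Sum.inl i))) z) ∧ (∀ i, Q (y (e IJ.2 (Sum.inl i))) z)
        then (1:ℝ) else 0) := sum_nonneg fun z _ => by split_ifs <;> norm_num
      by_cases h1 : gA z ≤ m
      · by_cases h2 : gB z ≤ m
        · obtain ⟨I, hI, hI'⟩ := hex (fun i => S (x i) z) h1
          obtain ⟨J, hJ, hJ'⟩ := hex (fun i => Q (y i) z) h2
          have := single_le_sum (f := fun IJ : Finset (Fin t ⊕ Fin m) × Finset (Fin t ⊕ Fin m) =>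
            (if (∀ i, S (x (e IJ.1 (Sum.inl i))) z) ∧ (∀ i, Q (y (e IJ.2 (Sum.inl i))) z)
              then (1:ℝ) else 0)) (s := PS ×ˢ PS) (fun z _ => by split_ifs <;> norm_num)
              (a := (I, J)) (mem_product.2 ⟨hI, hJ⟩)
          refine le_trans ?_ this
          have c1 := (mem_powersetCard.1 hI).2
          have c2 := (mem_powersetCard.1 hJ).2
          have d1 : ∀ i, S (x (e I (Sum.inl i))) z := fun i => hI' _ (he I c1 i)
          have d2 : ∀ i, Q (y (e J (Sum.inl i))) z := fun i => hJ' _ (he J c2 i)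
          simp [h1, h2, d1, d2]
        · simp only [h1, h2, if_true, if_false]; linarith
      · rw [if_neg h1]
        have : (0:ℝ) ≤ (if gB z ≤ m then (0:ℝ) else 1) := by split_ifs <;> norm_num
        linarith
    simp only [hN]
    rw [sum_comm]
    refine le_trans ?_ (sum_le_sum fun z _ => hpt z)
    simp only [sum_sub_distrib, sum_const, card_univ, nsmul_eq_mul, mul_one]
    linarith
  set X := ∑ x : Fin t → α, ∑ y : Fin t → β, ∑ z : Fin t → κ, ind x y z with hX
  have hsum : (∑ x : Fin t ⊕ Fin m → α, ∑ y : Fin t ⊕ Fin m → β, ∏ i, ∏ j, p (x i) (y j)) *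
      ((Fintype.card κ / (3 * b ^ 2)) ^ t * b ^ 2) ≤
      b ^ 2 * ((Fintype.card α : ℝ) ^ m * (Fintype.card β : ℝ) ^ m * X) := by
    rw [sum_mul]
    simp only [sum_mul]
    refine (sum_le_sum fun x _ => sum_le_sum fun y _ => key x y).trans (le_of_eq ?_)
    have : ∀ IJ : Finset (Fin t ⊕ Fin m) × Finset (Fin t ⊕ Fin m),
        ∑ x : Fin t ⊕ Fin m → α, ∑ y : Fin t ⊕ Fin m → β,
          ∑ z, ind (fun i => x (e IJ.1 (Sum.inl i))) (fun i => y (e IJ.2 (Sum.inl i))) z =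
        (Fintype.card α : ℝ) ^ m * (Fintype.card β : ℝ) ^ m * X := by
      intro IJ
      have h1 : ∀ x' : Fin t → α, ∑ y : Fin t ⊕ Fin m → β,
          ∑ z, ind x' (fun i => y (e IJ.2 (Sum.inl i))) z =
          (Fintype.card β : ℝ) ^ m * ∑ y, ∑ z, ind x' y z := fun x' =>
        sum_perm_aux (e IJ.2) (fun y' => ∑ z, ind x' y' z)
      simp only [h1]
      rw [sum_perm_aux (e IJ.1) (fun x' => (Fintype.card β : ℝ) ^ m * ∑ y, ∑ z, ind x' y z)]
      rw [← mul_sum, mul_assoc]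
    rw [sum_congr rfl (fun x _ => sum_comm), sum_comm, sum_congr rfl (fun IJ _ => this IJ)]
    rw [sum_const, card_product, nsmul_eq_mul]
    push_cast
    rw [hPSc]; ring
  have hfin := (mul_le_mul_of_nonneg_right hk (by positivity :
    0 ≤ ((Fintype.card κ / (3 * b ^ 2) : ℝ)) ^ t * b ^ 2)).trans hsum
  have hpos : 0 < b ^ 2 * ((Fintype.card α : ℝ) ^ m * (Fintype.card β : ℝ) ^ m) := by positivity
  refine le_of_mul_le_mul_left ?_ hpos
  have h3 : (0:ℝ) < (3 * b ^ 2) ^ t := by positivity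
  have := mul_le_mul_of_nonneg_left hfin h3.le
  calc _ = (3 * b ^ 2) ^ t * ((1 - 3 * ν) ^ (t + m) ^ 2 * (Fintype.card α * Fintype.card β : ℝ) ^ (t + m) *
        ((Fintype.card κ / (3 * b ^ 2) : ℝ) ^ t * b ^ 2)) := by
        rw [div_pow, pow_add (Fintype.card α * Fintype.card β : ℝ) t m]
        simp only [mul_pow _ _ t, mul_pow _ _ m]
        field_simp
    _ ≤ _ := this
    _ = _ := by ring


lemma near_lem (l : ℝ) (hl0 : 0 < l) (hl1 : l < 1) : ∃ η : ℝ, 0 < η ∧ ∀ t0 : ℕ, ∃ t, t0 ≤ t ∧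
    ∀ (α β κ : Type) [Fintype α] [Fintype β] [Fintype κ] [Nonempty α] [Nonempty β] [Nonempty κ]
    (P : α → β → Prop) (Q : β → κ → Prop) (S : α → κ → Prop)
    [∀ x y, Decidable (P x y)] [∀ x y, Decidable (Q x y)] [∀ x y, Decidable (S x y)],
    ∑ x, ∑ y, (if P x y then (0:ℝ) else 1) ≤ η * (Fintype.card α * Fintype.card β) →
    ∑ x, ∑ y, (if Q x y then (0:ℝ) else 1) ≤ η * (Fintype.card β * Fintype.card κ) →
    ∑ x, ∑ y, (if S x y then (0:ℝ) else 1) ≤ η * (Fintype.card α * Fintype.card κ) →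
    l ^ (t ^ 2) * ((Fintype.card α : ℝ) * Fintype.card β * Fintype.card κ) ^ t ≤
      ∑ x : Fin t → α, ∑ y : Fin t → β, ∑ z : Fin t → κ,
        (if (∀ i j, P (x i) (y j)) ∧ (∀ j k, Q (y j) (z k)) ∧ (∀ i k, S (x i) (z k))
          then (1:ℝ) else 0) := by
  classical
  set μ : ℝ := 1 - (1 - l) / 11 with hμ
  have hμ0 : 0 < μ := by rw [hμ]; linarith
  have hμ1 : μ < 1 := by rw [hμ]; linarith
  have hμl : l ≤ μ ^ 11 := by
    have := one_add_mul_le_pow (a := -((1 - l) / 11)) (by linarith) 11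
    have h2 : μ = 1 + -((1 - l) / 11) := by rw [hμ]; ring
    rw [h2]; refine le_trans (le_of_eq ?_) this; push_cast; ring
  set y : ℝ := 1 / μ - 1 with hy
  have hy0 : 0 < y := by
    have : 1 < 1 / μ := by rw [lt_div_iff₀ hμ0]; linarith
    linarith
  obtain ⟨q0, hq0⟩ := exists_pow_lt_of_lt_one hy0 hμ1
  obtain ⟨t1, ht1⟩ := exists_pow_lt_of_lt_one (by norm_num : (0:ℝ) < 1 / 3) hμ1
  set q := q0 + 1 with hq
  have hqy : μ ^ q ≤ y := le_trans (pow_le_pow_of_le_one hμ0.le hμ1.le (by omega)) hq0.le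
  set ν : ℝ := min ((1 - μ) / 3) (1 / (3 * (q + 1))) with hν
  have hν0 : 0 < ν := lt_min (by linarith) (by positivity)
  have hν1 : 3 * ν ≤ 1 - μ := by
    have := min_le_left ((1 - μ) / 3) (1 / (3 * ((q:ℝ) + 1)))
    rw [← hν] at this; linarith
  have hν2 : 3 * ν * (q + 1) ≤ 1 := by
    have := min_le_right ((1 - μ) / 3) (1 / (3 * ((q:ℝ) + 1)))
    rw [← hν, le_div_iff₀ (by positivity)] at this; linarith
  refine ⟨ν ^ 2, by positivity, fun t0 => ?_⟩
  set m := max t0 t1 + 1 with hm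
  have hmt : m ≤ q * m := Nat.le_mul_of_pos_left _ (by omega)
  refine ⟨q * m, by omega, ?_⟩
  intro α β κ _ _ _ _ _ _ P Q S _ _ _ hP hQ hS
  set t := q * m with ht
  have hcore := near_core Fintype.card_pos Fintype.card_pos Fintype.card_pos t m (by omega) P Q S ν
    hν0 (by linarith) (by
      rw [ht]; push_cast
      have hm0 : (0:ℝ) ≤ m := by positivity
      nlinarith) (by convert hP) (by convert hQ) (by convert hS)
  set b : ℝ := ((t + m).choose t : ℝ) with hb
  have hb0 : 0 ≤ b := by positivity
  have hb1 : b * μ ^ (3 * t) ≤ 1 := by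
    have h1 := choose_aux t m y hy0
    have h2 : 1 + y = μ⁻¹ := by rw [hy]; ring
    rw [h2, inv_pow] at h1
    have h3 : μ ^ t ≤ y ^ m := by
      rw [ht, pow_mul]; exact pow_le_pow_left₀ (by positivity) hqy _
    have h4 : b * y ^ m * μ ^ (t + m) ≤ 1 := by
      have := mul_le_mul_of_nonneg_right h1 (by positivity : 0 ≤ μ ^ (t + m))
      rwa [inv_mul_cancel₀ (by positivity)] at this
    refine le_trans ?_ h4
    have h5 : μ ^ (3 * t) = μ ^ t * μ ^ (2 * t) := by rw [← pow_add]; congr 1; ring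
    have h6 : μ ^ (2 * t) ≤ μ ^ (t + m) := pow_le_pow_of_le_one hμ0.le hμ1.le (by omega)
    rw [h5, ← mul_assoc]
    gcongr
  have hb2 : 3 * b ^ 2 * μ ^ (7 * t) ≤ 1 := by
    have h1 : μ ^ t ≤ 1 / 3 := le_trans (pow_le_pow_of_le_one hμ0.le hμ1.le (by omega)) ht1.le
    have h2 : μ ^ (7 * t) = μ ^ (3 * t) * μ ^ (3 * t) * μ ^ t := by
      rw [← pow_add, ← pow_add]; congr 1; ring
    have h3 : 0 ≤ b * μ ^ (3 * t) := by positivity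
    have h4 : (b * μ ^ (3 * t)) * (b * μ ^ (3 * t)) ≤ 1 := by nlinarith
    have h5 : 0 ≤ μ ^ t := by positivity
    rw [h2]
    calc 3 * b ^ 2 * (μ ^ (3 * t) * μ ^ (3 * t) * μ ^ t)
        = 3 * ((b * μ ^ (3 * t)) * (b * μ ^ (3 * t))) * μ ^ t := by ring
      _ ≤ 3 * 1 * (1/3) := by gcongr
      _ = 1 := by norm_num
  have hb3 : (3 * b ^ 2) ^ t * μ ^ (7 * t ^ 2) ≤ 1 := by
    have := pow_le_one₀ (n := t) (by positivity) hb2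
    rw [mul_pow, ← pow_mul] at this
    have e7 : 7 * t ^ 2 = 7 * t * t := by ring
    rw [e7]; exact this
  have hd : μ ^ (4 * t ^ 2) ≤ (1 - 3 * ν) ^ ((t + m) ^ 2) := by
    calc μ ^ (4 * t ^ 2) ≤ μ ^ ((t + m) ^ 2) :=
          pow_le_pow_of_le_one hμ0.le hμ1.le (by nlinarith)
      _ ≤ _ := pow_le_pow_left₀ hμ0.le (by linarith) _
  set Y : ℝ := ((Fintype.card α : ℝ) * Fintype.card β * Fintype.card κ) ^ t with hY
  have hY0 : 0 ≤ Y := by positivity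
  have hX0 : (0:ℝ) ≤ ∑ x : Fin t → α, ∑ y : Fin t → β, ∑ z : Fin t → κ,
        (if (∀ i j, P (x i) (y j)) ∧ (∀ j k, Q (y j) (z k)) ∧ (∀ i k, S (x i) (z k))
          then (1:ℝ) else 0) :=
    sum_nonneg fun _ _ => sum_nonneg fun _ _ => sum_nonneg fun _ _ => by split_ifs <;> norm_num
  have hcore' : (1 - 3 * ν) ^ ((t + m) ^ 2) * Y ≤ (3 * b ^ 2) ^ t *
      ∑ x : Fin t → α, ∑ y : Fin t → β, ∑ z : Fin t → κ,
        (if (∀ i j, P (x i) (y j)) ∧ (∀ j k, Q (y j) (z k)) ∧ (∀ i k, S (x i) (z k))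
          then (1:ℝ) else 0) := by convert hcore
  set X := ∑ x : Fin t → α, ∑ y : Fin t → β, ∑ z : Fin t → κ,
        (if (∀ i j, P (x i) (y j)) ∧ (∀ j k, Q (y j) (z k)) ∧ (∀ i k, S (x i) (z k))
          then (1:ℝ) else 0) with hX
  calc l ^ (t ^ 2) * Y ≤ (μ ^ 11) ^ (t ^ 2) * Y := by gcongr
    _ = μ ^ (7 * t ^ 2) * (μ ^ (4 * t ^ 2) * Y) := by
        rw [← pow_mul, ← mul_assoc, ← pow_add]; congr 2; ring
    _ ≤ μ ^ (7 * t ^ 2) * ((1 - 3 * ν) ^ ((t + m) ^ 2) * Y) := by gcongr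
    _ ≤ μ ^ (7 * t ^ 2) * ((3 * b ^ 2) ^ t * X) := by gcongr
    _ = ((3 * b ^ 2) ^ t * μ ^ (7 * t ^ 2)) * X := by ring
    _ ≤ 1 * X := by gcongr
    _ = X := one_mul X


noncomputable section
variable {V : Type} [Fintype V]

/-- averaging kernel of a colouring -/
def pk (c : V → ℕ) (x x' : V) : ℝ :=
  if c x = c x' then 1 / (#(univ.filter fun v => c v = c x) : ℝ) else 0

/-- cell averages of `W` -/
def av (c : V → ℕ) (W : V → V → ℝ) (x y : V) : ℝ :=
  ∑ x', ∑ y', pk c x x' * pk c y y' * W x' y'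

/-- measurability with respect to the colouring -/
def Meas (c : V → ℕ) (f : V → V → ℝ) : Prop :=
  ∀ x x1 y y1, c x = c x1 → c y = c y1 → f x y = f x1 y1

/-- energy -/
def en (c : V → ℕ) (W : V → V → ℝ) : ℝ := ∑ x, ∑ y, av c W x y ^ 2

/-- cut regularity -/
def CutReg (ε : ℝ) (D : V → V → ℝ) : Prop :=
  ∀ a b : V → ℝ, (∀ x, 0 ≤ a x ∧ a x ≤ 1) → (∀ x, 0 ≤ b x ∧ b x ≤ 1) →
    |∑ x, ∑ y, a x * b y * D x y| ≤ ε * (Fintype.card V : ℝ) ^ 2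

/-- refinement -/
def Refines (c c' : V → ℕ) : Prop := ∀ x y, c' x = c' y → c x = c y

lemma pk_nonneg (c : V → ℕ) (x x' : V) : 0 ≤ pk c x x' := by
  unfold pk; split_ifs <;> positivity

lemma pk_symm (c : V → ℕ) (x x' : V) : pk c x x' = pk c x' x := by
  unfold pk
  by_cases h : c x = c x'
  · simp [h]
  · rw [if_neg h, if_neg (fun h' => h h'.symm)]

lemma pk_congr (c : V → ℕ) {x x1 : V} (x' : V) (h : c x = c x1) : pk c x x' = pk c x1 x' := by
  unfold pk; rw [h]

lemma pk_sum (c : V → ℕ) (x : V) : ∑ x', pk c x x' = 1 := by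
  unfold pk
  rw [← sum_filter, sum_const, nsmul_eq_mul]
  have h1 : (univ.filter fun v => c x = c v) = (univ.filter fun v => c v = c x) := by
    ext v; simp [eq_comm]
  rw [h1]
  have : 0 < #(univ.filter fun v => c v = c x) := card_pos.2 ⟨x, by simp⟩
  have : (0:ℝ) < #(univ.filter fun v => c v = c x) := by exact_mod_cast this
  field_simp

lemma av_nonneg (c : V → ℕ) (W : V → V → ℝ) (hW : ∀ x y, 0 ≤ W x y) (x y : V) : 0 ≤ av c W x y :=
  sum_nonneg fun _ _ => sum_nonneg fun _ _ =>
    mul_nonneg (mul_nonneg (pk_nonneg _ _ _) (pk_nonneg _ _ _)) (hW _ _)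

lemma av_le_one (c : V → ℕ) (W : V → V → ℝ) (hW : ∀ x y, W x y ≤ 1) (x y : V) : av c W x y ≤ 1 := by
  calc av c W x y ≤ ∑ x', ∑ y', pk c x x' * pk c y y' * 1 := by
        refine sum_le_sum fun _ _ => sum_le_sum fun _ _ => ?_
        exact mul_le_mul_of_nonneg_left (hW _ _) (mul_nonneg (pk_nonneg _ _ _) (pk_nonneg _ _ _))
    _ = 1 := by
        simp only [mul_one, ← mul_sum, pk_sum]

lemma av_meas (c : V → ℕ) (W : V → V → ℝ) : Meas c (av c W) := by
  intro x x1 y y1 hx hy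
  unfold av
  refine sum_congr rfl fun x' _ => sum_congr rfl fun y' _ => ?_
  rw [pk_congr c x' hx, pk_congr c y' hy]

lemma av_inner (c : V → ℕ) (W f : V → V → ℝ) (hf : Meas c f) :
    ∑ x, ∑ y, av c W x y * f x y = ∑ x, ∑ y, W x y * f x y := by
  have h1 : ∀ x y x' y', pk c x x' * pk c y y' * W x' y' * f x y =
      pk c x' x * pk c y' y * (W x' y' * f x' y') := by
    intro x y x' y'
    rw [pk_symm c x x', pk_symm c y y']
    by_cases hx : c x' = c x
    · by_cases hy : c y' = c y
      · rw [hf x x' y y' hx.symm hy.symm]; ring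
      · have : pk c y' y = 0 := by unfold pk; rw [if_neg hy]
        rw [this]; ring
    · have : pk c x' x = 0 := by unfold pk; rw [if_neg hx]
      rw [this]; ring
  unfold av
  simp only [sum_mul, h1]
  calc ∑ x, ∑ y, ∑ x', ∑ y', pk c x' x * pk c y' y * (W x' y' * f x' y')
      = ∑ p : V × V, ∑ q : V × V, pk c q.1 p.1 * pk c q.2 p.2 * (W q.1 q.2 * f q.1 q.2) := by
        simp only [Fintype.sum_prod_type]
    _ = ∑ q : V × V, ∑ p : V × V, pk c q.1 p.1 * pk c q.2 p.2 * (W q.1 q.2 * f q.1 q.2) := sum_comm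
    _ = ∑ q : V × V, W q.1 q.2 * f q.1 q.2 := by
        refine sum_congr rfl fun q _ => ?_
        rw [← sum_mul, Fintype.sum_prod_type]
        simp only [← mul_sum, pk_sum, mul_one, one_mul]
    _ = _ := by simp only [Fintype.sum_prod_type]

lemma en_nonneg (c : V → ℕ) (W : V → V → ℝ) : 0 ≤ en c W :=
  sum_nonneg fun _ _ => sum_nonneg fun _ _ => sq_nonneg _

lemma en_le (c : V → ℕ) (W : V → V → ℝ) (h0 : ∀ x y, 0 ≤ W x y) (h1 : ∀ x y, W x y ≤ 1) :
    en c W ≤ (Fintype.card V : ℝ) ^ 2 := by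
  calc en c W ≤ ∑ _x : V, ∑ _y : V, (1:ℝ) := by
        refine sum_le_sum fun x _ => sum_le_sum fun y _ => ?_
        exact pow_le_one₀ (av_nonneg c W h0 x y) (av_le_one c W h1 x y)
    _ = _ := by simp [sq]

lemma pythag (c c' : V → ℕ) (W : V → V → ℝ) (h : Refines c c') :
    ∑ x, ∑ y, (av c' W x y - av c W x y) ^ 2 = en c' W - en c W := by
  have hm : Meas c' (av c W) := fun x x1 y y1 hx hy => av_meas c W _ _ _ _ (h _ _ hx) (h _ _ hy)
  have h1 := av_inner c' W (av c W) hm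
  have h2 := av_inner c W (av c W) (av_meas c W)
  rw [← h2] at h1
  have h3 : ∑ x, ∑ y, (av c' W x y - av c W x y) ^ 2 =
      en c' W + en c W - 2 * ∑ x, ∑ y, av c' W x y * av c W x y := by
    unfold en
    simp only [mul_sum, ← sum_add_distrib, ← sum_sub_distrib]
    refine sum_congr rfl fun x _ => sum_congr rfl fun y _ => by ring
  have h4 : ∑ x, ∑ y, av c W x y * av c W x y = en c W := by
    unfold en; simp only [sq]
  rw [h3, h1, h4]; ring

lemma lin_ext (L a : V → ℝ) (ha : ∀ x, 0 ≤ a x ∧ a x ≤ 1) :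
    ∃ S : V → Bool, ∑ x, a x * L x ≤ ∑ x, ((S x).toNat : ℝ) * L x := by
  classical
  refine ⟨fun x => decide (0 ≤ L x), sum_le_sum fun x _ => ?_⟩
  by_cases h : 0 ≤ L x
  · simp [h]; nlinarith [(ha x).2]
  · simp [h]; nlinarith [(ha x).1]

lemma bilin_ext (D : V → V → ℝ) (a b : V → ℝ) (ha : ∀ x, 0 ≤ a x ∧ a x ≤ 1)
    (hb : ∀ x, 0 ≤ b x ∧ b x ≤ 1) :
    ∃ S T : V → Bool, ∑ x, ∑ y, a x * b y * D x y ≤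
      ∑ x, ∑ y, ((S x).toNat : ℝ) * ((T y).toNat : ℝ) * D x y := by
  obtain ⟨S, hS⟩ := lin_ext (fun x => ∑ y, b y * D x y) a ha
  obtain ⟨T, hT⟩ := lin_ext (fun y => ∑ x, ((S x).toNat : ℝ) * D x y) b hb
  refine ⟨S, T, ?_⟩
  calc ∑ x, ∑ y, a x * b y * D x y = ∑ x, a x * ∑ y, b y * D x y := by
        simp only [mul_sum, mul_assoc]
    _ ≤ _ := hS
    _ = ∑ y, b y * ∑ x, ((S x).toNat : ℝ) * D x y := by
        simp only [mul_sum]; rw [sum_comm]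
        refine sum_congr rfl fun x _ => sum_congr rfl fun y _ => by ring
    _ ≤ _ := hT
    _ = _ := by
        simp only [mul_sum]; rw [sum_comm]
        refine sum_congr rfl fun x _ => sum_congr rfl fun y _ => by ring

lemma sq_inner_le (f g : V → V → ℝ) :
    (∑ x, ∑ y, f x y * g x y) ^ 2 ≤ (∑ x, ∑ y, f x y ^ 2) * ∑ x, ∑ y, g x y ^ 2 := by
  have := sum_mul_sq_le_sq_mul_sq (univ : Finset (V × V)) (fun p => f p.1 p.2) (fun p => g p.1 p.2)
  simpa only [Fintype.sum_prod_type] using this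

lemma fk_step [Nonempty V] (ε : ℝ) (hε : 0 < ε) (k : ℕ) (W : V → V → ℝ) (c : V → ℕ) (hc : ∀ v, c v < k)
    (h : ¬ CutReg ε (fun x y => W x y - av c W x y)) :
    ∃ c' : V → ℕ, (∀ v, c' v < 4 * k) ∧ Refines c c' ∧
      en c W + ε ^ 2 * (Fintype.card V : ℝ) ^ 2 ≤ en c' W := by
  unfold CutReg at h
  push Not at h
  obtain ⟨a, b, ha, hb, hab⟩ := h
  have hn : (0:ℝ) < Fintype.card V := by exact_mod_cast Fintype.card_pos
  have hST : ∃ S T : V → Bool, ε * (Fintype.card V : ℝ) ^ 2 <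
      |∑ x, ∑ y, ((S x).toNat : ℝ) * ((T y).toNat : ℝ) * (W x y - av c W x y)| := by
    rcases lt_abs.1 hab with h1 | h1
    · obtain ⟨S, T, hST⟩ := bilin_ext (fun x y => W x y - av c W x y) a b ha hb
      exact ⟨S, T, lt_of_lt_of_le (lt_of_lt_of_le h1 hST) (le_abs_self _)⟩
    · obtain ⟨S, T, hST⟩ := bilin_ext (fun x y => -(W x y - av c W x y)) a b ha hb
      refine ⟨S, T, lt_of_lt_of_le ?_ (neg_le_abs _)⟩
      simp only [mul_neg, sum_neg_distrib] at hST
      linarith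
  obtain ⟨S, T, hST⟩ := hST
  have hb2 : ∀ b : Bool, b.toNat < 2 := fun b => by cases b <;> simp
  set c' : V → ℕ := fun v => 4 * c v + 2 * (S v).toNat + (T v).toNat with hc'
  have key : ∀ x y, c' x = c' y → c x = c y ∧ (S x).toNat = (S y).toNat ∧ (T x).toNat = (T y).toNat := by
    intro x y hxy
    simp only [hc'] at hxy
    have := hb2 (S x); have := hb2 (S y); have := hb2 (T x); have := hb2 (T y)
    omega
  have href : Refines c c' := fun x y hxy => (key x y hxy).1
  refine ⟨c', ?_, href, ?_⟩
  · intro v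
    have := hc v; have := hb2 (S v); have := hb2 (T v)
    simp only [hc']; omega
  set f : V → V → ℝ := fun x y => ((S x).toNat : ℝ) * ((T y).toNat : ℝ) with hf
  have hfm : Meas c' f := by
    intro x x1 y y1 hx hy
    simp only [hf]; rw [(key _ _ hx).2.1, (key _ _ hy).2.2]
  have e1 := av_inner c' W f hfm
  have e2 : ∑ x, ∑ y, ((S x).toNat : ℝ) * ((T y).toNat : ℝ) * (W x y - av c W x y) =
      ∑ x, ∑ y, f x y * (av c' W x y - av c W x y) := by
    have : ∀ A : V → V → ℝ, ∑ x, ∑ y, f x y * (A x y - av c W x y) =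
      ∑ x, ∑ y, A x y * f x y - ∑ x, ∑ y, av c W x y * f x y := by
      intro A
      simp only [← sum_sub_distrib]
      refine sum_congr rfl fun x _ => sum_congr rfl fun y _ => by ring
    rw [this, ← e1, ← this]
  rw [e2] at hST
  have e3 := sq_inner_le f (fun x y => av c' W x y - av c W x y)
  rw [pythag c c' W href] at e3
  have e4 : ∑ x, ∑ y, f x y ^ 2 ≤ (Fintype.card V : ℝ) ^ 2 := by
    calc _ ≤ ∑ _x : V, ∑ _y : V, (1:ℝ) := by
          refine sum_le_sum fun x _ => sum_le_sum fun y _ => ?_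
          simp only [hf]
          cases S x <;> cases T y <;> simp
      _ = _ := by simp [sq]
  have e5 : (0:ℝ) ≤ en c' W - en c W := by
    rw [← pythag c c' W href]; exact sum_nonneg fun _ _ => sum_nonneg fun _ _ => sq_nonneg _
  have e6 : (ε * (Fintype.card V : ℝ) ^ 2) ^ 2 ≤ (Fintype.card V : ℝ) ^ 2 * (en c' W - en c W) := by
    refine le_trans ?_ (e3.trans (mul_le_mul_of_nonneg_right e4 e5))
    rw [← sq_abs (∑ x, ∑ y, f x y * (av c' W x y - av c W x y))]
    exact pow_le_pow_left₀ (by positivity) hST.le 2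
  have e7 : (Fintype.card V : ℝ) ^ 2 * (ε ^ 2 * (Fintype.card V : ℝ) ^ 2) ≤
      (Fintype.card V : ℝ) ^ 2 * (en c' W - en c W) := by
    refine le_trans (le_of_eq ?_) e6; ring
  have := le_of_mul_le_mul_left e7 (by positivity)
  linarith

lemma refines_trans {V : Type} {c c' c'' : V → ℕ} (h : Refines c c') (h' : Refines c' c'') : Refines c c'' :=
  fun x y hxy => h x y (h' x y hxy)

lemma fk_aux (ε : ℝ) (hε : 0 < ε) (j : ℕ) : ∀ k : ℕ, ∃ k' : ℕ, ∀ (V : Type) [Fintype V] [Nonempty V]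
    (W : V → V → ℝ) (_ : ∀ x y, 0 ≤ W x y) (_ : ∀ x y, W x y ≤ 1) (c : V → ℕ) (_ : ∀ v, c v < k)
    (_ : (1 - j * ε ^ 2) * (Fintype.card V : ℝ) ^ 2 < en c W),
    ∃ c' : V → ℕ, (∀ v, c' v < k') ∧ Refines c c' ∧ CutReg ε (fun x y => W x y - av c' W x y) := by
  induction j with
  | zero =>
    intro k
    refine ⟨0, ?_⟩
    intro V _ _ W h0 h1 c hc he
    have := en_le c W h0 h1
    simp at he; linarith
  | succ j ih =>
    intro k
    obtain ⟨k', hk'⟩ := ih (4 * k)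
    refine ⟨max k k', ?_⟩
    intro V _ _ W h0 h1 c hc he
    by_cases h : CutReg ε (fun x y => W x y - av c W x y)
    · exact ⟨c, fun v => lt_of_lt_of_le (hc v) (le_max_left _ _), fun _ _ h => h, h⟩
    · obtain ⟨c1, hc1, hr1, he1⟩ := fk_step ε hε k W c hc h
      obtain ⟨c2, hc2, hr2, hreg⟩ := hk' V W h0 h1 c1 hc1 (by push_cast at he; linarith)
      exact ⟨c2, fun v => lt_of_lt_of_le (hc2 v) (le_max_right _ _), refines_trans hr1 hr2, hreg⟩

lemma fk (ε : ℝ) (hε : 0 < ε) (k : ℕ) : ∃ k' : ℕ, ∀ (V : Type) [Fintype V] [Nonempty V]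
    (W : V → V → ℝ) (_ : ∀ x y, 0 ≤ W x y) (_ : ∀ x y, W x y ≤ 1) (c : V → ℕ) (_ : ∀ v, c v < k),
    ∃ c' : V → ℕ, (∀ v, c' v < k') ∧ Refines c c' ∧ CutReg ε (fun x y => W x y - av c' W x y) := by
  obtain ⟨j, hj⟩ := exists_nat_gt (1 / ε ^ 2)
  obtain ⟨k', hk'⟩ := fk_aux ε hε j k
  refine ⟨k', ?_⟩
  intro V _ _ W h0 h1 c hc
  refine hk' V W h0 h1 c hc (lt_of_lt_of_le ?_ (en_nonneg c W))
  have hn : (0:ℝ) < Fintype.card V := by exact_mod_cast Fintype.card_pos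
  rw [div_lt_iff₀ (by positivity)] at hj
  exact mul_neg_of_neg_of_pos (by linarith) (by positivity)

/-! counting -/
lemma upd_sum {I : Type*} [Fintype I] [DecidableEq I] (i : I) (F : (I → V) → ℝ) :
    ∑ φ : I → V, ∑ x, F (Function.update φ i x) = Fintype.card V * ∑ φ, F φ := by
  have hinv : Function.Involutive (fun p : (I → V) × V => (Function.update p.1 i p.2, p.1 i)) := by
    intro p; simp
  have := Equiv.sum_comp hinv.toPerm (fun p : (I → V) × V => F p.1)
  simp only [Function.Involutive.coe_toPerm, Fintype.sum_prod_type] at this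
  rw [this]; simp [mul_sum]

lemma upd_sum2 {I : Type*} [Fintype I] [DecidableEq I] (i j : I) (F : (I → V) → ℝ) :
    ∑ φ : I → V, ∑ x, ∑ y, F (Function.update (Function.update φ i x) j y) =
      (Fintype.card V : ℝ) ^ 2 * ∑ φ, F φ := by
  rw [upd_sum i (fun ψ => ∑ y, F (Function.update ψ j y)), upd_sum]; ring

lemma count_single [Nonempty V] {I E : Type*} [Fintype I] [DecidableEq I] (s t : E → I)
    (M : E → V → V → ℝ) (hM : ∀ e x y, 0 ≤ M e x y ∧ M e x y ≤ 1) (D : V → V → ℝ) (δ : ℝ)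
    (hD : CutReg δ D) (i j : I) (hij : i ≠ j) (R : Finset E)
    (hR : ∀ f ∈ R, ¬ ((i = s f ∨ i = t f) ∧ (j = s f ∨ j = t f))) :
    |∑ φ : I → V, D (φ i) (φ j) * ∏ f ∈ R, M f (φ (s f)) (φ (t f))| ≤
      δ * (Fintype.card V : ℝ) ^ Fintype.card I := by
  classical
  have hn : (0:ℝ) < Fintype.card V := by exact_mod_cast Fintype.card_pos
  set F : (I → V) → ℝ := fun φ => D (φ i) (φ j) * ∏ f ∈ R, M f (φ (s f)) (φ (t f)) with hF
  have h2 := upd_sum2 i j F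
  have hb : ∀ φ : I → V, |∑ x, ∑ y, F (Function.update (Function.update φ i x) j y)| ≤
      δ * (Fintype.card V : ℝ) ^ 2 := by
    intro φ
    have := hD
      (fun x => ∏ f ∈ R with (i = s f ∨ i = t f), M f (Function.update φ i x (s f)) (Function.update φ i x (t f)))
      (fun y => ∏ f ∈ R with ¬ (i = s f ∨ i = t f), M f (Function.update φ j y (s f)) (Function.update φ j y (t f)))
      (fun x => ⟨prod_nonneg fun f _ => (hM _ _ _).1, prod_le_one (fun f _ => (hM _ _ _).1) fun f _ => (hM _ _ _).2⟩)
      (fun x => ⟨prod_nonneg fun f _ => (hM _ _ _).1, prod_le_one (fun f _ => (hM _ _ _).1) fun f _ => (hM _ _ _).2⟩)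
    refine le_trans (le_of_eq (congrArg abs ?_)) this
    refine sum_congr rfl fun x _ => sum_congr rfl fun y _ => ?_
    simp only [hF]
    rw [← prod_filter_mul_prod_filter_not R (fun f => i = s f ∨ i = t f)]
    rw [Function.update_self, Function.update_of_ne hij, Function.update_self, mul_comm]
    congr 1
    congr 1
    · refine prod_congr rfl fun f hf => ?_
      have hf' := mem_filter.1 hf
      have := hR f hf'.1
      have h1 : s f ≠ j := fun h => this ⟨hf'.2, Or.inl h.symm⟩
      have h2 : t f ≠ j := fun h => this ⟨hf'.2, Or.inr h.symm⟩
      rw [Function.update_of_ne h1, Function.update_of_ne h2]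
    · refine prod_congr rfl fun f hf => ?_
      have hf' := mem_filter.1 hf
      have h1 : s f ≠ i := fun h => hf'.2 (Or.inl h.symm)
      have h2 : t f ≠ i := fun h => hf'.2 (Or.inr h.symm)
      rw [Function.update_comm hij, Function.update_of_ne h1, Function.update_of_ne h2]
  have h3 : |(Fintype.card V : ℝ) ^ 2 * ∑ φ, F φ| ≤
      (Fintype.card V : ℝ) ^ 2 * (δ * (Fintype.card V : ℝ) ^ Fintype.card I) := by
    rw [← h2]
    refine (abs_sum_le_sum_abs _ _).trans ((sum_le_sum fun φ _ => hb φ).trans (le_of_eq ?_))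
    simp; ring
  rw [abs_mul, abs_of_nonneg (by positivity : (0:ℝ) ≤ (Fintype.card V : ℝ) ^ 2)] at h3
  exact le_of_mul_le_mul_left h3 (by positivity)

lemma count_lem [Nonempty V] {I E : Type*} [Fintype I] [DecidableEq I] [Fintype E] [DecidableEq E]
    (s t : E → I) (hst : ∀ e, s e ≠ t e)
    (hE : ∀ e f, f ≠ e → ¬ ((s e = s f ∨ s e = t f) ∧ (t e = s f ∨ t e = t f)))
    (W U : V → V → ℝ) (hW : ∀ x y, 0 ≤ W x y ∧ W x y ≤ 1) (hU : ∀ x y, 0 ≤ U x y ∧ U x y ≤ 1)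
    (δ : ℝ) (hD : CutReg δ (fun x y => W x y - U x y)) :
    |∑ φ : I → V, ∏ e, W (φ (s e)) (φ (t e)) - ∑ φ : I → V, ∏ e, U (φ (s e)) (φ (t e))| ≤
      Fintype.card E * δ * (Fintype.card V : ℝ) ^ Fintype.card I := by
  have main : ∀ S : Finset E,
      |∑ φ : I → V, ∏ e, (if e ∈ S then W else U) (φ (s e)) (φ (t e)) -
        ∑ φ : I → V, ∏ e, U (φ (s e)) (φ (t e))| ≤
      #S * δ * (Fintype.card V : ℝ) ^ Fintype.card I := by
    intro S
    induction S using Finset.induction_on with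
    | empty => simp
    | insert e0 S he ih =>
      have h1 := count_single s t (fun e => if e ∈ S then W else U)
        (fun e x y => by split_ifs; exacts [hW x y, hU x y]) _ δ hD (s e0) (t e0) (hst e0)
        (univ.erase e0) (fun f hf => hE e0 f (mem_erase.1 hf).1)
      have h2 : ∑ φ : I → V, ∏ e, (if e ∈ insert e0 S then W else U) (φ (s e)) (φ (t e)) =
          ∑ φ : I → V, (W (φ (s e0)) (φ (t e0)) - U (φ (s e0)) (φ (t e0))) *
            ∏ f ∈ univ.erase e0, (if f ∈ S then W else U) (φ (s f)) (φ (t f)) +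
          ∑ φ : I → V, ∏ e, (if e ∈ S then W else U) (φ (s e)) (φ (t e)) := by
        rw [← sum_add_distrib]
        refine sum_congr rfl fun φ _ => ?_
        rw [← mul_prod_erase univ _ (mem_univ e0)]
        rw [← mul_prod_erase univ (fun e => (if e ∈ S then W else U) (φ (s e)) (φ (t e))) (mem_univ e0)]
        rw [if_pos (mem_insert_self _ _), if_neg he]
        have : ∏ x ∈ univ.erase e0, (if x ∈ insert e0 S then W else U) (φ (s x)) (φ (t x)) =
            ∏ x ∈ univ.erase e0, (if x ∈ S then W else U) (φ (s x)) (φ (t x)) := by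
          refine prod_congr rfl fun f hf => ?_
          have := (mem_erase.1 hf).1
          simp [this]
        rw [this]; ring
      rw [h2, add_sub_assoc]
      refine (abs_add_le _ _).trans ((add_le_add h1 ih).trans (le_of_eq ?_))
      rw [card_insert_of_notMem he]; push_cast; ring
  have := main univ
  simpa using this

end


/-- edge sources of `K_{t,t,t}` -/
def sE (t : ℕ) (e : Fin 3 × Fin t × Fin t) : Fin 3 × Fin t := (![0, 1, 0] e.1, e.2.1)

/-- edge targets of `K_{t,t,t}` -/
def tE (t : ℕ) (e : Fin 3 × Fin t × Fin t) : Fin 3 × Fin t := (![1, 2, 2] e.1, e.2.2)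

/-- weighted homomorphism sums of `K_{t,t,t}` -/
noncomputable def HS {V : Type} [Fintype V] (t : ℕ) (M : V → V → ℝ) : ℝ :=
  ∑ φ : Fin 3 × Fin t → V, ∏ e, M (φ (sE t e)) (φ (tE t e))

lemma sE_ne (t : ℕ) (e : Fin 3 × Fin t × Fin t) : sE t e ≠ tE t e := by
  obtain ⟨p, i, j⟩ := e
  fin_cases p <;> simp [sE, tE]

lemma sE_inj (t : ℕ) (e f : Fin 3 × Fin t × Fin t) (h : f ≠ e) :
    ¬ ((sE t e = sE t f ∨ sE t e = tE t f) ∧ (tE t e = sE t f ∨ tE t e = tE t f)) := by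
  obtain ⟨p, i, j⟩ := e
  obtain ⟨p', i', j'⟩ := f
  fin_cases p <;> fin_cases p' <;> simp [sE, tE] at h ⊢ <;> grind

lemma HS_count {V : Type} [Fintype V] [Nonempty V] (t : ℕ)
    (W U : V → V → ℝ) (hW : ∀ x y, 0 ≤ W x y ∧ W x y ≤ 1) (hU : ∀ x y, 0 ≤ U x y ∧ U x y ≤ 1)
    (δ : ℝ) (hD : CutReg δ (fun x y => W x y - U x y)) :
    |HS t W - HS t U| ≤ 3 * t ^ 2 * δ * (Fintype.card V : ℝ) ^ (3 * t) := by
  have := count_lem (sE t) (tE t) (sE_ne t) (sE_inj t) W U hW hU δ hD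
  simp only [Fintype.card_prod, Fintype.card_fin] at this
  refine le_trans this (le_of_eq ?_)
  push_cast; ring

/-- splitting a map into three tuples -/
def tripEquiv (V : Type) (t : ℕ) :
    (Fin 3 × Fin t → V) ≃ (Fin t → V) × (Fin t → V) × (Fin t → V) where
  toFun φ := (fun i => φ (0, i), fun i => φ (1, i), fun i => φ (2, i))
  invFun p := fun q => ![p.1, p.2.1, p.2.2] q.1 q.2
  left_inv φ := by
    ext ⟨p, i⟩
    fin_cases p <;> rfl
  right_inv p := by
    rfl

lemma HS_eq {V : Type} [Fintype V] (t : ℕ) (M : V → V → ℝ) :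
    HS t M = ∑ x : Fin t → V, ∑ y : Fin t → V, ∑ z : Fin t → V,
      ((∏ i, ∏ j, M (x i) (y j)) * (∏ j, ∏ k, M (y j) (z k)) * (∏ i, ∏ k, M (x i) (z k))) := by
  have := Equiv.sum_comp (tripEquiv V t) (fun p : (Fin t → V) × (Fin t → V) × (Fin t → V) =>
      ((∏ i, ∏ j, M (p.1 i) (p.2.1 j)) * (∏ j, ∏ k, M (p.2.1 j) (p.2.2 k)) *
        (∏ i, ∏ k, M (p.1 i) (p.2.2 k))))
  simp only [Fintype.sum_prod_type] at this
  rw [← this]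
  unfold HS
  refine sum_congr rfl fun φ _ => ?_
  simp only [Fintype.prod_prod_type, Fin.prod_univ_three, sE, tE]
  rfl

lemma HS_one {V : Type} [Fintype V] (M : V → V → ℝ) :
    HS 1 M = ∑ x, ∑ y, ∑ z, M x y * M y z * M x z := by
  have h : ∀ f : V → ℝ, ∑ x : Fin 1 → V, f (x 0) = ∑ x, f x := fun f =>
    Equiv.sum_comp (Equiv.funUnique (Fin 1) V) f
  rw [HS_eq]
  simp only [Fin.prod_univ_one, Fin.isValue]
  rw [← h (fun x => ∑ y, ∑ z, M x y * M y z * M x z)]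
  refine sum_congr rfl fun x _ => ?_
  rw [← h (fun y => ∑ z, M (x 0) y * M y z * M (x 0) z)]
  refine sum_congr rfl fun y _ => ?_
  rw [← h (fun z => M (x 0) (y 0) * M (y 0) z * M (x 0) z)]

lemma pick {V : Type} [Fintype V] [Nonempty V] (U e : V → V → ℝ) (s : V → ℝ)
    (hU : ∀ x y, 0 ≤ U x y ∧ U x y ≤ 1) (he : ∀ x y, 0 ≤ e x y) (hs : ∀ x, 0 ≤ s x)
    (A η η' σ τ : ℝ) (hA : 0 ≤ A) (hη' : 0 < η')
    (hes : ∑ x, ∑ y, e x y ≤ η * (Fintype.card V : ℝ) ^ 2)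
    (hss : ∑ x, s x ≤ σ * Fintype.card V) (hlt : A + 3 * (η / η') + 3 * σ < τ)
    (hτ : τ * (Fintype.card V : ℝ) ^ 3 ≤ HS 1 U) :
    ∃ x y z, A ≤ U x y * U y z * U x z ∧ e x y ≤ η' ∧ e y z ≤ η' ∧ e x z ≤ η' ∧
      s x < 1 ∧ s y < 1 ∧ s z < 1 := by
  have hn : (0:ℝ) < Fintype.card V := by exact_mod_cast Fintype.card_pos
  by_contra hcon
  push Not at hcon
  have hpt : ∀ x y z, U x y * U y z * U x z ≤
      A + (e x y + e y z + e x z) / η' + (s x + s y + s z) := by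
    intro x y z
    have h1 : U x y * U y z * U x z ≤ 1 := by
      have := mul_le_one₀ (hU x y).2 (hU y z).1 (hU y z).2
      exact mul_le_one₀ this (hU x z).1 (hU x z).2
    have e1 := he x y
    have e2 := he y z
    have e3 := he x z
    have s1 := hs x
    have s2 := hs y
    have s3 := hs z
    have q0 : 0 ≤ (e x y + e y z + e x z) / η' := by positivity
    by_cases hAle : A ≤ U x y * U y z * U x z
    swap
    · push Not at hAle; linarith
    by_cases hbig : η' < e x y + e y z + e x z
    · have : 1 ≤ (e x y + e y z + e x z) / η' := by rw [le_div_iff₀ hη']; linarith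
      linarith
    push Not at hbig
    have h2 := hcon x y z hAle (by linarith) (by linarith) (by linarith)
    by_cases a1 : s x < 1
    · by_cases a2 : s y < 1
      · have := h2 a1 a2; linarith
      · push Not at a2; linarith
    · push Not at a1; linarith
  rw [HS_one] at hτ
  have hsum : ∑ x, ∑ y, ∑ z, U x y * U y z * U x z ≤
      ∑ x : V, ∑ y : V, ∑ z : V, (A + (e x y + e y z + e x z) / η' + (s x + s y + s z)) :=
    sum_le_sum fun x _ => sum_le_sum fun y _ => sum_le_sum fun z _ => hpt x y z
  have hcomp : ∑ x : V, ∑ y : V, ∑ z : V, (A + (e x y + e y z + e x z) / η' + (s x + s y + s z)) =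
      A * (Fintype.card V : ℝ) ^ 3 + 3 * ((∑ x, ∑ y, e x y) / η') * Fintype.card V +
        3 * (∑ x, s x) * (Fintype.card V : ℝ) ^ 2 := by
    simp only [add_div, sum_add_distrib, ← sum_div, sum_const, card_univ, nsmul_eq_mul, ← mul_sum]
    ring
  rw [hcomp] at hsum
  have h3 : 3 * ((∑ x, ∑ y, e x y) / η') * Fintype.card V ≤
      3 * (η / η') * (Fintype.card V : ℝ) ^ 3 := by
    have : (∑ x, ∑ y, e x y) / η' ≤ η * (Fintype.card V : ℝ) ^ 2 / η' := by gcongr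
    calc _ ≤ 3 * (η * (Fintype.card V : ℝ) ^ 2 / η') * Fintype.card V := by gcongr
      _ = _ := by ring
  have h4 : 3 * (∑ x, s x) * (Fintype.card V : ℝ) ^ 2 ≤ 3 * σ * (Fintype.card V : ℝ) ^ 3 := by
    calc _ ≤ 3 * (σ * Fintype.card V) * (Fintype.card V : ℝ) ^ 2 := by gcongr
      _ = _ := by ring
  have h5 : (A + 3 * (η / η') + 3 * σ) * (Fintype.card V : ℝ) ^ 3 < τ * (Fintype.card V : ℝ) ^ 3 :=
    mul_lt_mul_of_pos_right hlt (by positivity)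
  nlinarith

lemma av_cell {V : Type} [Fintype V] (c : V → ℕ) (f : V → V → ℝ) (x0 y0 : V) :
    ∑ x : {v // c v = c x0}, ∑ y : {v // c v = c y0}, f x y =
      av c f x0 y0 * (Fintype.card {v // c v = c x0} * Fintype.card {v // c v = c y0}) := by
  have hc : ∀ x0 : V, (#(univ.filter fun v => c v = c x0) : ℝ) = Fintype.card {v // c v = c x0} := by
    intro x0; rw [Fintype.card_subtype]
  have hs : ∀ (x0 : V) (g : V → ℝ), ∑ x : {v // c v = c x0}, g x =
      (∑ x, pk c x0 x * g x) * Fintype.card {v // c v = c x0} := by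
    intro x0 g
    have hpos : (0:ℝ) < Fintype.card {v // c v = c x0} := by
      have : Nonempty {v // c v = c x0} := ⟨⟨x0, rfl⟩⟩
      exact_mod_cast Fintype.card_pos
    have h1 : ∑ x : {v // c v = c x0}, g x = ∑ x with c x = c x0, g x := by
      rw [← sum_subtype_eq_sum_filter]
      simp
    rw [h1, sum_filter, sum_mul]
    refine sum_congr rfl fun x _ => ?_
    unfold pk
    rw [hc]
    by_cases h : c x = c x0
    · rw [if_pos h, if_pos h.symm]; field_simp
    · rw [if_neg h, if_neg (fun h' => h h'.symm)]; ring
  have h2 : ∀ x : V, ∑ y : {v // c v = c y0}, f x y =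
      (∑ y, pk c y0 y * f x y) * Fintype.card {v // c v = c y0} := fun x => hs y0 (fun y => f x y)
  simp only [h2]
  rw [hs x0 (fun x => (∑ y, pk c y0 y * f x y) * Fintype.card {v // c v = c y0})]
  unfold av
  have h3 : ∀ x, pk c x0 x * ((∑ y, pk c y0 y * f x y) * (Fintype.card {v // c v = c y0} : ℝ)) =
      (∑ y, pk c x0 x * pk c y0 y * f x y) * Fintype.card {v // c v = c y0} := by
    intro x
    rw [sum_mul, sum_mul, mul_sum]
    refine sum_congr rfl fun y _ => by ring
  simp only [h3]
  rw [← sum_mul]; ring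

lemma small_cells {V : Type} [Fintype V] (c : V → ℕ) (k : ℕ) (hc : ∀ v, c v < k) (B : ℝ) (hB : 0 ≤ B) :
    ∑ x, (if B ≤ (Fintype.card {v // c v = c x} : ℝ) then (0:ℝ) else 1) ≤ k * B := by
  have h1 : ∑ x, (if B ≤ (Fintype.card {v // c v = c x} : ℝ) then (0:ℝ) else 1) =
      ∑ l ∈ range k, ∑ x with c x = l, (if B ≤ (Fintype.card {v // c v = c x} : ℝ) then (0:ℝ) else 1) := by
    rw [sum_fiberwise_of_maps_to]
    intro x _; simpa using hc x
  rw [h1]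
  calc _ ≤ ∑ l ∈ range k, B := by
        refine sum_le_sum fun l _ => ?_
        have h2 : ∀ x ∈ univ.filter (fun x => c x = l),
            (if B ≤ (Fintype.card {v // c v = c x} : ℝ) then (0:ℝ) else 1) =
            (if B ≤ (#(univ.filter fun x => c x = l) : ℝ) then (0:ℝ) else 1) := by
          intro x hx
          have := (mem_filter.1 hx).2
          rw [Fintype.card_subtype, this]
        rw [sum_congr rfl h2, sum_const, nsmul_eq_mul]
        split_ifs with h
        · simpa using hB
        · push Not at h; linarith
    _ = _ := by simp

lemma sub_sum {V : Type} [Fintype V] (p : V → Prop) [DecidablePred p] (t : ℕ) (f : (Fin t → V) → ℝ)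
    (hf : ∀ x, 0 ≤ f x) :
    ∑ x : Fin t → {v // p v}, f (fun i => (x i : V)) ≤ ∑ x, f x := by
  classical
  have hinj : Function.Injective (fun (x : Fin t → {v // p v}) (i : Fin t) => (x i : V)) := by
    intro x y h
    funext i
    exact Subtype.ext (congrFun h i)
  rw [← sum_image (f := f) (s := univ) (g := fun (x : Fin t → {v // p v}) (i : Fin t) => (x i : V))
    (fun x _ y _ h => hinj h)]
  exact sum_le_univ_sum_of_nonneg hf

lemma bad_aux {V : Type} [Fintype V] (c : V → ℕ) (U U' : V → V → ℝ) (hm : Meas c U) (x0 y0 : V)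
    (l w η : ℝ) (hw : 0 < w) (hF : w ≤ (1 - l) * U x0 y0)
    (he : av c (fun x y => (U' x y - U x y) ^ 2) x0 y0 ≤ η * w ^ 2) [∀ x y, Decidable (l * U x0 y0 ≤ U' x y)] :
    ∑ x : {v // c v = c x0}, ∑ y : {v // c v = c y0},
      (if l * U x0 y0 ≤ U' x y then (0:ℝ) else 1) ≤
      η * (Fintype.card {v // c v = c x0} * Fintype.card {v // c v = c y0}) := by
  have h1 := av_cell c (fun x y => (U' x y - U x y) ^ 2) x0 y0
  have h2 : (∑ x : {v // c v = c x0}, ∑ y : {v // c v = c y0},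
      (if l * U x0 y0 ≤ U' x y then (0:ℝ) else 1)) * w ^ 2 ≤
      ∑ x : {v // c v = c x0}, ∑ y : {v // c v = c y0}, (U' x y - U x y) ^ 2 := by
    simp only [sum_mul]
    refine sum_le_sum fun x _ => sum_le_sum fun y _ => ?_
    split_ifs with h
    · rw [zero_mul]; positivity
    · push Not at h
      rw [hm x x0 y y0 x.2 y.2]
      nlinarith
  rw [h1] at h2
  refine le_of_mul_le_mul_right (h2.trans ?_) (by positivity : 0 < w ^ 2)
  calc _ ≤ (η * w ^ 2) * (Fintype.card {v // c v = c x0} * Fintype.card {v // c v = c y0} : ℝ) := by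
        gcongr
    _ = _ := by ring

lemma stage (γ l : ℝ) (hγ0 : 0 < γ) (hγ1 : γ < 1) (hl0 : 0 < l) (hl1 : l < 1) :
    ∃ η : ℝ, 0 < η ∧ ∀ k : ℕ, ∃ t : ℕ, 2 ≤ t ∧ ∀ (V : Type) [Fintype V] [Nonempty V]
    (U U' : V → V → ℝ) (_ : ∀ x y, 0 ≤ U x y ∧ U x y ≤ 1) (_ : ∀ x y, 0 ≤ U' x y ∧ U' x y ≤ 1)
    (c : V → ℕ) (_ : ∀ v, c v < k) (_ : Meas c U)
    (_ : (γ - γ * (1 - l) / 4) * (Fintype.card V : ℝ) ^ 3 ≤ HS 1 U)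
    (_ : ∑ x, ∑ y, (U' x y - U x y) ^ 2 ≤ η * (Fintype.card V : ℝ) ^ 2),
    (l ^ 6 * γ) ^ (t ^ 2) * (Fintype.card V : ℝ) ^ (3 * t) ≤ HS t U' := by
  classical
  obtain ⟨η0, hη0, hnear⟩ := near_lem l hl0 hl1
  set ω : ℝ := γ * (1 - l) with hω
  have hω0 : 0 < ω := mul_pos hγ0 (by linarith)
  set w : ℝ := (1 - l) * (l * γ) with hw
  have hw0 : 0 < w := mul_pos (by linarith) (by positivity)
  set η' : ℝ := η0 * w ^ 2 with hη'
  have hη'0 : 0 < η' := by positivity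
  refine ⟨η' * (ω / 12), by positivity, fun k => ?_⟩
  set b : ℝ := ω / (12 * (k + 1)) with hb
  have hb0 : 0 < b := by positivity
  obtain ⟨t1, ht1⟩ := exists_pow_lt_of_lt_one (by positivity : (0:ℝ) < b ^ 3) hl1
  obtain ⟨t, ht, hmain⟩ := hnear (max 2 t1)
  refine ⟨t, le_trans (le_max_left _ _) ht, ?_⟩
  have hlt : l ^ t ≤ b ^ 3 :=
    (pow_le_pow_of_le_one hl0.le hl1.le (le_trans (le_max_right _ _) ht)).trans ht1.le
  intro V _ _ U U' hU hU' c hc hm h3 hen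
  have hn : (0:ℝ) < Fintype.card V := by exact_mod_cast Fintype.card_pos
  set n : ℝ := (Fintype.card V : ℝ) with hnn
  obtain ⟨x0, y0, z0, hA, hxy, hyz, hxz, hsx, hsy, hsz⟩ := pick U
    (av c (fun x y => (U' x y - U x y) ^ 2))
    (fun x => if b * n ≤ (Fintype.card {v // c v = c x} : ℝ) then (0:ℝ) else 1) hU
    (fun x y => av_nonneg c _ (fun x y => sq_nonneg _) x y)
    (fun x => by split_ifs <;> norm_num) (l * γ) (η' * (ω / 12)) η' (k * b) (γ - ω / 4)
    (by positivity) hη'0 (by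
      have := av_inner c (fun x y => (U' x y - U x y) ^ 2) (fun _ _ => 1) (fun _ _ _ _ _ _ => rfl)
      simp only [mul_one] at this
      rw [this]; exact hen) (by
      have := small_cells c k hc (b * n) (by positivity)
      refine this.trans (le_of_eq ?_); ring) (by
      have e1 : η' * (ω / 12) / η' = ω / 12 := by field_simp
      have e2 : k * b ≤ ω / 12 := by
        rw [hb, ← mul_div_assoc, div_le_div_iff₀ (by positivity) (by norm_num)]
        nlinarith
      rw [e1]
      have : γ = l * γ + ω := by rw [hω]; ring
      nlinarith) h3
  have cell : ∀ x, (if b * n ≤ (Fintype.card {v // c v = c x} : ℝ) then (0:ℝ) else 1) < 1 →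
      b * n ≤ (Fintype.card {v // c v = c x} : ℝ) := by
    intro x hx
    by_contra hcon
    rw [if_neg hcon] at hx
    exact lt_irrefl _ hx
  have cx := cell _ hsx
  have cy := cell _ hsy
  have cz := cell _ hsz
  have u1 := hU x0 y0
  have u2 := hU y0 z0
  have u3 := hU x0 z0
  set F := U x0 y0 with hF
  set G := U y0 z0 with hG
  set H := U x0 z0 with hH
  have fg : F * G ≤ 1 := mul_le_one₀ u1.2 u2.1 u2.2
  have fg0 : 0 ≤ F * G := mul_nonneg u1.1 u2.1
  have fgh : F * G * H ≤ F * G := mul_le_of_le_one_right fg0 u3.2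
  have f1 : l * γ ≤ F := hA.trans (fgh.trans (mul_le_of_le_one_right u1.1 u2.2))
  have f2 : l * γ ≤ G := hA.trans (fgh.trans (mul_le_of_le_one_left u2.1 u1.2))
  have f3 : l * γ ≤ H := hA.trans (by
    calc F * G * H ≤ 1 * H := by
          gcongr
          exact u3.1
      _ = H := by ring)
  have hne : ∀ x0, Nonempty {v // c v = c x0} := fun x0 => ⟨⟨x0, rfl⟩⟩
  haveI := hne x0
  haveI := hne y0
  haveI := hne z0
  have wl : ∀ F, l * γ ≤ F → w ≤ (1 - l) * F := fun F hF =>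
    mul_le_mul_of_nonneg_left hF (by linarith)
  have hk := hmain {v // c v = c x0} {v // c v = c y0} {v // c v = c z0}
    (fun x y => l * F ≤ U' x y) (fun y z => l * G ≤ U' y z) (fun x z => l * H ≤ U' x z)
    (bad_aux c U U' hm x0 y0 l w η0 hw0 (wl _ f1) hxy)
    (bad_aux c U U' hm y0 z0 l w η0 hw0 (wl _ f2) hyz)
    (bad_aux c U U' hm x0 z0 l w η0 hw0 (wl _ f3) hxz)
  have hprod : ∀ {α β : Type} (M : α → β → ℝ) (a : ℝ) (_ : 0 ≤ a) (x : Fin t → α) (y : Fin t → β)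
      (_ : ∀ i j, a ≤ M (x i) (y j)), a ^ (t ^ 2) ≤ ∏ i, ∏ j, M (x i) (y j) := by
    intro α β M a ha x y h
    calc a ^ (t ^ 2) = ∏ _i : Fin t, ∏ _j : Fin t, a := by simp [← pow_mul, sq]
      _ ≤ _ := prod_le_prod (fun i _ => prod_nonneg fun j _ => ha) fun i _ =>
          prod_le_prod (fun j _ => ha) fun j _ => h i j
  set g : (Fin t → V) → (Fin t → V) → (Fin t → V) → ℝ := fun x y z =>
    ((∏ i, ∏ j, U' (x i) (y j)) * (∏ j, ∏ k, U' (y j) (z k)) * (∏ i, ∏ k, U' (x i) (z k))) with hg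
  have hp0 : ∀ x y : Fin t → V, 0 ≤ ∏ i, ∏ j, U' (x i) (y j) := fun x y =>
    prod_nonneg fun i _ => prod_nonneg fun j _ => (hU' _ _).1
  have hg0 : ∀ x y z, 0 ≤ g x y z := fun x y z =>
    mul_nonneg (mul_nonneg (hp0 _ _) (hp0 _ _)) (hp0 _ _)
  have hlow : ∑ x : Fin t → {v // c v = c x0}, ∑ y : Fin t → {v // c v = c y0},
      ∑ z : Fin t → {v // c v = c z0}, g (fun i => x i) (fun i => y i) (fun i => z i) ≤ HS t U' := by
    rw [HS_eq]
    calc _ ≤ ∑ x : Fin t → {v // c v = c x0}, ∑ y : Fin t → {v // c v = c y0},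
          ∑ z, g (fun i => x i) (fun i => y i) z :=
          sum_le_sum fun x _ => sum_le_sum fun y _ => sub_sum _ t _ (fun z => hg0 _ _ _)
      _ ≤ ∑ x : Fin t → {v // c v = c x0}, ∑ y, ∑ z, g (fun i => x i) y z :=
          sum_le_sum fun x _ => sub_sum _ t (fun y => ∑ z, g (fun i => x i) y z)
            (fun y => sum_nonneg fun z _ => hg0 _ _ _)
      _ ≤ ∑ x, ∑ y, ∑ z, g x y z :=
          sub_sum _ t (fun x => ∑ y, ∑ z, g x y z)
            (fun y => sum_nonneg fun z _ => sum_nonneg fun z _ => hg0 _ _ _)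
  refine le_trans ?_ hlow
  have hlF : 0 ≤ l * F := mul_nonneg hl0.le u1.1
  have hlG : 0 ≤ l * G := mul_nonneg hl0.le u2.1
  have hlH : 0 ≤ l * H := mul_nonneg hl0.le u3.1
  have hmid : (∑ x : Fin t → {v // c v = c x0}, ∑ y : Fin t → {v // c v = c y0},
      ∑ z : Fin t → {v // c v = c z0}, (if (∀ i j, l * F ≤ U' (x i) (y j)) ∧
        (∀ j k, l * G ≤ U' (y j) (z k)) ∧ (∀ i k, l * H ≤ U' (x i) (z k)) then (1:ℝ) else 0)) *
        (l ^ 4 * γ) ^ (t ^ 2) ≤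
      ∑ x : Fin t → {v // c v = c x0}, ∑ y : Fin t → {v // c v = c y0},
      ∑ z : Fin t → {v // c v = c z0}, g (fun i => x i) (fun i => y i) (fun i => z i) := by
    simp only [sum_mul]
    refine sum_le_sum fun x _ => sum_le_sum fun y _ => sum_le_sum fun z _ => ?_
    split_ifs with h
    · rw [one_mul]
      have q1 := hprod (fun x y => U' x y) (l * F) hlF (fun i => (x i : V)) (fun i => (y i : V)) h.1
      have q2 := hprod (fun x y => U' x y) (l * G) hlG (fun i => (y i : V)) (fun i => (z i : V)) h.2.1
      have q3 := hprod (fun x y => U' x y) (l * H) hlH (fun i => (x i : V)) (fun i => (z i : V)) h.2.2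
      calc (l ^ 4 * γ) ^ (t ^ 2) ≤ (l * F * (l * G) * (l * H)) ^ (t ^ 2) := by
            apply pow_le_pow_left₀ (by positivity)
            calc l ^ 4 * γ = l ^ 3 * (l * γ) := by ring
              _ ≤ l ^ 3 * (F * G * H) := by gcongr
              _ = _ := by ring
        _ = (l * F) ^ (t ^ 2) * (l * G) ^ (t ^ 2) * (l * H) ^ (t ^ 2) := by rw [mul_pow, mul_pow]
        _ ≤ _ := mul_le_mul (mul_le_mul q1 q2 (by positivity) (hp0 _ _)) q3 (by positivity)
            (mul_nonneg (hp0 _ _) (hp0 _ _))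
    · rw [zero_mul]; exact hg0 _ _ _
  refine le_trans ?_ hmid
  refine le_trans ?_ (mul_le_mul_of_nonneg_right hk (by positivity))
  have hcells : (b * n) * (b * n) * (b * n) ≤ (Fintype.card {v // c v = c x0} : ℝ) *
      Fintype.card {v // c v = c y0} * Fintype.card {v // c v = c z0} := by gcongr
  calc (l ^ 6 * γ) ^ (t ^ 2) * n ^ (3 * t)
      = l ^ (t ^ 2) * ((l ^ t * n ^ 3) ^ t) * (l ^ 4 * γ) ^ (t ^ 2) := by
        have e1 : l ^ 6 * γ = l * l * (l ^ 4 * γ) := by ring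
        rw [e1, mul_pow (l * l), mul_pow l l, mul_pow (l ^ t), ← pow_mul, ← pow_mul, ← sq]; ring
    _ ≤ l ^ (t ^ 2) * ((b ^ 3 * n ^ 3) ^ t) * (l ^ 4 * γ) ^ (t ^ 2) := by gcongr
    _ = l ^ (t ^ 2) * ((b * n) * (b * n) * (b * n)) ^ t * (l ^ 4 * γ) ^ (t ^ 2) := by
        congr 3; ring
    _ ≤ _ := by gcongr

lemma induct (γ l : ℝ) (hγ0 : 0 < γ) (hγ1 : γ < 1) (hl0 : 0 < l) (hl1 : l < 1) :
    ∃ η : ℝ, 0 < η ∧ ∀ j k : ℕ, ∃ T : ℕ, ∀ (V : Type) [Fintype V] [Nonempty V]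
    (W : V → V → ℝ) (_ : ∀ x y, 0 ≤ W x y ∧ W x y ≤ 1) (c : V → ℕ) (_ : ∀ v, c v < k)
    (_ : HS 1 W = γ * (Fintype.card V : ℝ) ^ 3)
    (_ : (γ - γ * (1 - l) / 4) * (Fintype.card V : ℝ) ^ 3 ≤ HS 1 (av c W))
    (_ : (1 - j * η) * (Fintype.card V : ℝ) ^ 2 < en c W),
    ∃ t, 2 ≤ t ∧ t ≤ T ∧ (l ^ 7 * γ) ^ (t ^ 2) * (Fintype.card V : ℝ) ^ (3 * t) ≤ HS t W := by
  obtain ⟨η, hη, hst⟩ := stage γ l hγ0 hγ1 hl0 hl1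
  refine ⟨η, hη, fun j => ?_⟩
  induction j with
  | zero =>
    intro k
    refine ⟨0, ?_⟩
    intro V _ _ W hW c hc _ _ he
    have := en_le c W (fun x y => (hW x y).1) (fun x y => (hW x y).2)
    simp at he; linarith
  | succ j ih =>
    intro k
    obtain ⟨t, ht, hst⟩ := hst k
    have ht0 : (0:ℝ) < t := by exact_mod_cast (by omega : 0 < t)
    have hω0 : 0 < γ * (1 - l) := mul_pos hγ0 (by linarith)
    have h1l : 0 < 1 - l := by linarith
    set ε : ℝ := min (γ * (1 - l) / 12) ((l ^ 6 * γ) ^ (t ^ 2) * (1 - l) / (3 * t ^ 2)) with hε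
    have hε0 : 0 < ε := lt_min (by positivity) (by positivity)
    have hε1 : ε ≤ γ * (1 - l) / 12 := min_le_left _ _
    have hε2 : 3 * t ^ 2 * ε ≤ (l ^ 6 * γ) ^ (t ^ 2) * (1 - l) := by
      have : ε ≤ (l ^ 6 * γ) ^ (t ^ 2) * (1 - l) / (3 * t ^ 2) := min_le_right _ _
      rw [le_div_iff₀ (by positivity)] at this; linarith
    obtain ⟨k', hfk⟩ := fk ε hε0 k
    obtain ⟨T, hT⟩ := ih k'
    refine ⟨max t T, ?_⟩
    intro V _ _ W hW c hc h3 h3' he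
    have hn : (0:ℝ) < Fintype.card V := by exact_mod_cast Fintype.card_pos
    obtain ⟨c', hc', href, hreg⟩ := hfk V W (fun x y => (hW x y).1) (fun x y => (hW x y).2) c hc
    have hav : ∀ c x y, 0 ≤ av c W x y ∧ av c W x y ≤ 1 := fun c x y =>
      ⟨av_nonneg c W (fun x y => (hW x y).1) x y, av_le_one c W (fun x y => (hW x y).2) x y⟩
    by_cases hen : en c' W - en c W ≤ η * (Fintype.card V : ℝ) ^ 2
    · refine ⟨t, ht, le_max_left _ _, ?_⟩
      have h1 := hst V (av c W) (av c' W) (hav c) (hav c') c hc (av_meas c W) h3'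
        (by rw [pythag c c' W href]; exact hen)
      have h2 := HS_count t W (av c' W) hW (hav c') ε hreg
      have h4 := (abs_le.1 h2).1
      have h5 : 3 * t ^ 2 * ε * (Fintype.card V : ℝ) ^ (3 * t) ≤
          (l ^ 6 * γ) ^ (t ^ 2) * (1 - l) * (Fintype.card V : ℝ) ^ (3 * t) := by gcongr
      have h6 : (l ^ 7 * γ) ^ (t ^ 2) ≤ l * (l ^ 6 * γ) ^ (t ^ 2) := by
        have e1 : l ^ 7 * γ = l * (l ^ 6 * γ) := by ring
        rw [e1, mul_pow]
        gcongr
        calc l ^ (t ^ 2) ≤ l ^ 1 := pow_le_pow_of_le_one hl0.le hl1.le (by nlinarith)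
          _ = l := pow_one l
      have h7 := mul_le_mul_of_nonneg_right h6 (by positivity : 0 ≤ (Fintype.card V : ℝ) ^ (3 * t))
      nlinarith
    · push Not at hen
      have h2 := HS_count 1 W (av c' W) hW (hav c') ε hreg
      have h4 := (abs_le.1 h2).2
      obtain ⟨t', ht', htT, hfin⟩ := hT V W hW c' hc' h3 (by
        have h5 : ε * (Fintype.card V : ℝ) ^ 3 ≤ γ * (1 - l) / 12 * (Fintype.card V : ℝ) ^ 3 := by gcongr
        norm_num at h4
        rw [h3] at h4
        nlinarith) (by push_cast at he; linarith)
      exact ⟨t', ht', htT.trans (le_max_right _ _), hfin⟩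

lemma weighted_main (γ l : ℝ) (hγ0 : 0 < γ) (hγ1 : γ < 1) (hl0 : 0 < l) (hl1 : l < 1) :
    ∃ T : ℕ, ∀ (V : Type) [Fintype V] [Nonempty V]
    (W : V → V → ℝ) (_ : ∀ x y, 0 ≤ W x y ∧ W x y ≤ 1)
    (_ : HS 1 W = γ * (Fintype.card V : ℝ) ^ 3),
    ∃ t, 2 ≤ t ∧ t ≤ T ∧ (l ^ 7 * γ) ^ (t ^ 2) * (Fintype.card V : ℝ) ^ (3 * t) ≤ HS t W := by
  obtain ⟨η, hη, hind⟩ := induct γ l hγ0 hγ1 hl0 hl1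
  obtain ⟨j, hj⟩ := exists_nat_gt (1 / η)
  have h1l : 0 < 1 - l := by linarith
  have hε0 : 0 < γ * (1 - l) / 12 := by positivity
  obtain ⟨k, hfk⟩ := fk (γ * (1 - l) / 12) hε0 1
  obtain ⟨T, hT⟩ := hind j k
  refine ⟨T, ?_⟩
  intro V _ _ W hW h3
  have hn : (0:ℝ) < Fintype.card V := by exact_mod_cast Fintype.card_pos
  obtain ⟨c, hc, -, hreg⟩ := hfk V W (fun x y => (hW x y).1) (fun x y => (hW x y).2)
    (fun _ => 0) (fun _ => by norm_num)
  have hav : ∀ x y, 0 ≤ av c W x y ∧ av c W x y ≤ 1 := fun x y =>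
      ⟨av_nonneg c W (fun x y => (hW x y).1) x y, av_le_one c W (fun x y => (hW x y).2) x y⟩
  have h4 := (abs_le.1 (HS_count 1 W (av c W) hW hav _ hreg)).2
  refine hT V W hW c hc h3 ?_ (lt_of_lt_of_le ?_ (en_nonneg c W))
  · norm_num at h4
    rw [h3] at h4
    nlinarith
  · rw [div_lt_iff₀ hη] at hj
    exact mul_neg_of_neg_of_pos (by linarith) (by positivity)


lemma hom_HS {α V : Type} [Fintype α] [Fintype V] (t : ℕ) (H : SimpleGraph α) (G : SimpleGraph V)
    [DecidableRel G.Adj]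
    (e : α ≃ Fin 3 × Fin t) (he : ∀ a b, H.Adj a b ↔ (e a).1 ≠ (e b).1) :
    (homCount H G : ℝ) = HS t (fun x y => if G.Adj x y then (1:ℝ) else 0) := by
  classical
  have key : ∀ φ : Fin 3 × Fin t → V,
      (∏ d, (if G.Adj (φ (sE t d)) (φ (tE t d)) then (1:ℝ) else 0)) =
        if (∀ d, G.Adj (φ (sE t d)) (φ (tE t d))) then (1:ℝ) else 0 := by
    intro φ
    split_ifs with h
    · exact prod_eq_one fun d _ => if_pos (h d)
    · push Not at h
      obtain ⟨d, hd⟩ := h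
      exact prod_eq_zero (mem_univ d) (if_neg hd)
  have hiff : ∀ φ : Fin 3 × Fin t → V, (∀ d, G.Adj (φ (sE t d)) (φ (tE t d))) ↔
      ∀ p q : Fin 3 × Fin t, p.1 ≠ q.1 → G.Adj (φ p) (φ q) := by
    intro φ
    constructor
    · intro h
      have h01 : ∀ i j, G.Adj (φ (0, i)) (φ (1, j)) := fun i j => h (0, i, j)
      have h12 : ∀ i j, G.Adj (φ (1, i)) (φ (2, j)) := fun i j => h (1, i, j)
      have h02 : ∀ i j, G.Adj (φ (0, i)) (φ (2, j)) := fun i j => h (2, i, j)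
      rintro ⟨p, i⟩ ⟨q, j⟩ hpq
      fin_cases p <;> fin_cases q
      · exact absurd rfl hpq
      · exact h01 i j
      · exact h02 i j
      · exact (h01 j i).symm
      · exact absurd rfl hpq
      · exact h12 i j
      · exact (h02 j i).symm
      · exact (h12 j i).symm
      · exact absurd rfl hpq
    · intro h d
      apply h
      obtain ⟨p, i, j⟩ := d
      fin_cases p <;> simp [sE, tE]
  let E : (H →g G) ≃ {φ : Fin 3 × Fin t → V // ∀ d, G.Adj (φ (sE t d)) (φ (tE t d))} :=
    { toFun := fun f => ⟨fun p => f (e.symm p), (hiff _).2 fun p q hpq =>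
        f.map_rel ((he _ _).2 (by simpa using hpq))⟩
      invFun := fun φ => ⟨fun a => φ.1 (e a), fun {a b} hab =>
        (hiff _).1 φ.2 _ _ ((he a b).1 hab)⟩
      left_inv := fun f => by ext a; simp
      right_inv := fun φ => by ext p; simp }
  unfold homCount HS
  rw [Nat.card_congr E, Nat.card_eq_fintype_card, Fintype.card_subtype]
  simp only [key]
  rw [sum_boole]

/-- vertices of `K_{t,t,t}` as a product -/
def kEquiv (t : ℕ) : (Σ i : Fin 3, Fin (![t, t, t] i)) ≃ Fin 3 × Fin t :=
  (Equiv.sigmaCongrRight fun i => finCongr (by fin_cases i <;> rfl)).trans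
    (Equiv.sigmaEquivProd (Fin 3) (Fin t))

/-- vertices of the triangle as a product -/
def oEquiv : Fin 3 ≃ Fin 3 × Fin 1 := (Equiv.prodUnique (Fin 3) (Fin 1)).symm


/-- For every `0 < γ, δ < 1` there are `N` and `T` such that any graph on `n ≥ N`
vertices with triangle density `γ` has, for some `2 ≤ t ≤ T`,
`K_{t,t,t}`-density at least `γ^((1+δ)t²)`. -/
theorem main_theorem (γ δ : ℝ) (hγ0 : 0 < γ) (hγ1 : γ < 1) (hδ0 : 0 < δ) (hδ1 : δ < 1) :
    ∃ N T : ℕ, ∀ (β : Type) [Fintype β] (G : SimpleGraph β),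
      N ≤ Fintype.card β →
      homDensity triangleGraph G = γ →
      ∃ t : ℕ, 2 ≤ t ∧ t ≤ T ∧
        γ ^ ((1 + δ) * (t : ℝ) ^ 2) ≤ homDensity (Kabc t t t) G := by
  classical
  obtain ⟨T, hT⟩ := weighted_main γ (γ ^ (δ / 7)) hγ0 hγ1 (Real.rpow_pos_of_pos hγ0 _)
    (Real.rpow_lt_one hγ0.le hγ1 (by positivity))
  refine ⟨1, T, fun β _ G hN hd => ?_⟩
  haveI : Nonempty β := Fintype.card_pos_iff.1 hN
  have hn : (0:ℝ) < Fintype.card β := by exact_mod_cast hN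
  have h1 : HS 1 (fun x y => if G.Adj x y then (1:ℝ) else 0) = γ * (Fintype.card β : ℝ) ^ 3 := by
    rw [← hom_HS 1 triangleGraph G oEquiv (fun a b => by simp [triangleGraph, oEquiv]), ← hd]
    unfold homDensity
    rw [Fintype.card_fin, div_mul_cancel₀ _ (by positivity)]
  obtain ⟨t, ht2, htT, ht⟩ := hT β (fun x y => if G.Adj x y then (1:ℝ) else 0)
    (fun x y => by split_ifs <;> norm_num) h1
  refine ⟨t, ht2, htT, ?_⟩
  unfold homDensity
  rw [hom_HS t (Kabc t t t) G (kEquiv t) (fun a b => Iff.rfl), Fintype.card_congr (kEquiv t),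
    Fintype.card_prod, Fintype.card_fin, Fintype.card_fin, le_div_iff₀ (by positivity)]
  refine le_trans (le_of_eq ?_) ht
  congr 1
  have h7 : (γ ^ (δ / 7)) ^ 7 * γ = γ ^ (1 + δ) := by
    rw [← Real.rpow_natCast (γ ^ (δ / 7)) 7, ← Real.rpow_mul hγ0.le, Real.rpow_add hγ0,
      Real.rpow_one, mul_comm]
    congr 2
    push_cast
    ring
  rw [h7, ← Real.rpow_natCast (γ ^ (1 + δ)) (t ^ 2), ← Real.rpow_mul hγ0.le]
  push_cast
  rfl
end

section
/- (Trevisan) For every C > 0 there exists γ₀ > 0 such that for every 0 < γ ≤ γ₀ there is N with the property: every finite simple graph G on n ≥ N vertices with triangle density d_{K_3}(G) ≥ γ satisfies d_{K_{1,1,2}}(G) ≥ C·γ². In other words, f_{K_{1,1,2}}(γ) = ω(γ²) as γ → 0. -/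
open SimpleGraph Finset

open Classical in
noncomputable def codeg {β : Type} [Fintype β] (G : SimpleGraph β) (p : β × β) : ℕ :=
  #{w : β | G.Adj p.1 w ∧ G.Adj p.2 w}

open Classical in
noncomputable def adjPairs {β : Type} [Fintype β] (G : SimpleGraph β) : Finset (β × β) :=
  {p : β × β | G.Adj p.1 p.2}

open Classical in
noncomputable def tris {β : Type} [Fintype β] (G : SimpleGraph β) : Finset (β × β × β) :=
  {p : β × β × β | G.Adj p.1 p.2.1 ∧ G.Adj p.1 p.2.2 ∧ G.Adj p.2.1 p.2.2}

open Classical in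
lemma fiber_bound {β γ : Type} [Fintype β] (G : SimpleGraph β) (f : γ → β × β) (g : γ → β)
    (hfg : Function.Injective fun x => (f x, g x)) (A : Finset γ) (S : Finset (β × β))
    (h1 : ∀ x ∈ A, f x ∈ S) (h2 : ∀ x ∈ A, G.Adj (f x).1 (g x) ∧ G.Adj (f x).2 (g x)) :
    #A ≤ ∑ p ∈ S, codeg G p := by
  rw [Finset.card_eq_sum_card_fiberwise (f := f) (t := S) (fun x hx => h1 x hx)]
  refine Finset.sum_le_sum fun p _ => ?_
  unfold codeg
  refine Finset.card_le_card_of_injOn g ?_ ?_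
  · intro x hx
    simp only [coe_filter, Set.mem_ofPred_eq] at hx
    have := h2 x hx.1
    rw [hx.2] at this
    simpa using this
  · intro x hx y hy hxy
    simp only [coe_filter, Set.mem_ofPred_eq] at hx hy
    apply hfg
    simp [hx.2, hy.2, hxy]

lemma hom_tri_le {β : Type} [Fintype β] (G : SimpleGraph β) :
    homCount triangleGraph G ≤ #(tris G) := by
  classical
  unfold homCount
  rw [← Nat.card_eq_finsetCard]
  refine Nat.card_le_card_of_injective
    (fun f : triangleGraph →g G => (⟨(f 0, f 1, f 2), ?_⟩ : tris G)) ?_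
  · simp only [tris, mem_filter, mem_univ, true_and]
    exact ⟨f.map_adj (by simp [triangleGraph]), f.map_adj (by simp [triangleGraph]),
      f.map_adj (by simp [triangleGraph])⟩
  · intro f g h
    simp only [Subtype.mk.injEq, Prod.mk.injEq] at h
    apply DFunLike.ext
    intro i
    fin_cases i
    · exact h.1
    · exact h.2.1
    · exact h.2.2

lemma tri_le_codeg {β : Type} [Fintype β] (G : SimpleGraph β) :
    #(tris G) ≤ ∑ p ∈ adjPairs G, codeg G p := by
  classical
  refine fiber_bound G (fun x => (x.1, x.2.1)) (fun x => x.2.2) ?_ _ _ ?_ ?_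
  · rintro ⟨a, b, c⟩ ⟨a', b', c'⟩ h
    simp at h ⊢; tauto
  · intro x hx; simp [tris, adjPairs] at hx ⊢; exact hx.1
  · intro x hx; simp [tris, adjPairs] at hx ⊢; exact hx.2

noncomputable def k112hom {β : Type} (G : SimpleGraph β) (u v w w' : β)
    (h : G.Adj u v) (h1 : G.Adj u w) (h2 : G.Adj v w) (h3 : G.Adj u w') (h4 : G.Adj v w') :
    Kabc 1 1 2 →g G where
  toFun x := if x.1 = 0 then u else if x.1 = 1 then v else if x.2.val = 0 then w else w'
  map_rel' := by
    rintro ⟨i, a⟩ ⟨j, b⟩ hij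
    have hne : i ≠ j := hij
    fin_cases i <;> fin_cases j <;> simp at hne ⊢ <;> (try split_ifs) <;>
      first | assumption | (apply SimpleGraph.Adj.symm; assumption)

open Classical in
lemma codeg_sq_le {β : Type} [Fintype β] (G : SimpleGraph β) :
    ∑ p ∈ adjPairs G, codeg G p ^ 2 ≤ homCount (Kabc 1 1 2) G := by
  have : ∑ p ∈ adjPairs G, codeg G p ^ 2 = #((adjPairs G).sigma fun p =>
      (({w : β | G.Adj p.1 w ∧ G.Adj p.2 w} : Finset β) ×ˢ
       ({w : β | G.Adj p.1 w ∧ G.Adj p.2 w} : Finset β))) := by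
    rw [Finset.card_sigma]
    refine Finset.sum_congr rfl fun p _ => ?_
    rw [Finset.card_product, codeg, sq]
  rw [this, ← Nat.card_eq_finsetCard, homCount]
  have key : ∀ x : ((adjPairs G).sigma fun p =>
      (({w : β | G.Adj p.1 w ∧ G.Adj p.2 w} : Finset β) ×ˢ
       ({w : β | G.Adj p.1 w ∧ G.Adj p.2 w} : Finset β))),
      G.Adj x.1.1.1 x.1.1.2 ∧ (G.Adj x.1.1.1 x.1.2.1 ∧ G.Adj x.1.1.2 x.1.2.1) ∧
        (G.Adj x.1.1.1 x.1.2.2 ∧ G.Adj x.1.1.2 x.1.2.2) := by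
    rintro ⟨x, hx⟩
    simpa [adjPairs] using hx
  refine Nat.card_le_card_of_injective (fun x => k112hom G x.1.1.1 x.1.1.2 x.1.2.1 x.1.2.2
    (key x).1 (key x).2.1.1 (key x).2.1.2 (key x).2.2.1 (key x).2.2.2) ?_
  rintro ⟨⟨⟨a, b⟩, c, d⟩, hx⟩ ⟨⟨⟨a', b'⟩, c', d'⟩, hy⟩ h
  have e1 := DFunLike.congr_fun h ⟨0, (0 : Fin 1)⟩
  have e2 := DFunLike.congr_fun h ⟨1, (0 : Fin 1)⟩
  have e3 := DFunLike.congr_fun h ⟨2, (0 : Fin 2)⟩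
  have e4 := DFunLike.congr_fun h ⟨2, (1 : Fin 2)⟩
  change a = a' at e1
  change b = b' at e2
  change c = c' at e3
  change d = d' at e4
  subst e1 e2 e3 e4
  rfl

open Classical in
lemma clique_le {β : Type} [Fintype β] (G : SimpleGraph β) :
    #(G.cliqueFinset 3) ≤ #(tris G) := by
  refine Finset.card_le_card_of_surjOn (fun x : β × β × β => ({x.1, x.2.1, x.2.2} : Finset β)) ?_
  intro s hs
  simp only [SetLike.mem_coe, mem_cliqueFinset_iff, is3Clique_iff] at hs
  obtain ⟨a, b, c, h1, h2, h3, rfl⟩ := hs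
  exact ⟨(a, b, c), by simp [tris, h1, h2, h3], rfl⟩

open Classical in
lemma card_adjPairs {β : Type} [Fintype β] (G : SimpleGraph β) :
    #(adjPairs G) = 2 * #G.edgeFinset := by
  rw [← sum_degrees_eq_twice_card_edges, adjPairs, ← Finset.univ_product_univ,
    Finset.card_filter, Finset.sum_product]
  refine Finset.sum_congr rfl fun v _ => ?_
  rw [← card_neighborFinset_eq_degree, neighborFinset_eq_filter, Finset.card_filter]

open Classical in
lemma tri_le_removed {β : Type} [Fintype β] (G G' : SimpleGraph β) (hf : G'.CliqueFree 3) :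
    #(tris G) ≤ 3 * ∑ p ∈ adjPairs G \ adjPairs G', codeg G p := by
  set S := adjPairs G \ adjPairs G' with hS
  have hmem : ∀ a b, (a, b) ∈ S ↔ G.Adj a b ∧ ¬ G'.Adj a b := by
    intro a b; simp [hS, adjPairs]
  have sub : tris G ⊆ ((tris G).filter fun x => (x.1, x.2.1) ∈ S) ∪
      (((tris G).filter fun x => (x.1, x.2.2) ∈ S) ∪
      ((tris G).filter fun x => (x.2.1, x.2.2) ∈ S)) := by
    rintro ⟨a, b, c⟩ hx
    have hx' := hx
    simp only [tris, mem_filter, mem_univ, true_and] at hx'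
    obtain ⟨h1, h2, h3⟩ := hx'
    simp only [mem_union, mem_filter, hx, true_and, hmem, h1, h2, h3]
    by_contra hcon
    push Not at hcon
    exact hf {a, b, c} (is3Clique_triple_iff.2 hcon)
  have b1 : #((tris G).filter fun x => (x.1, x.2.1) ∈ S) ≤ ∑ p ∈ S, codeg G p := by
    refine fiber_bound G (fun x => (x.1, x.2.1)) (fun x => x.2.2) ?_ _ _ ?_ ?_
    · rintro ⟨a, b, c⟩ ⟨a', b', c'⟩ h
      simp at h ⊢; tauto
    · intro x hx; exact (mem_filter.1 hx).2
    · intro x hx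
      have := (mem_filter.1 hx).1
      simp only [tris, mem_filter, mem_univ, true_and] at this
      exact this.2
  have b2 : #((tris G).filter fun x => (x.1, x.2.2) ∈ S) ≤ ∑ p ∈ S, codeg G p := by
    refine fiber_bound G (fun x => (x.1, x.2.2)) (fun x => x.2.1) ?_ _ _ ?_ ?_
    · rintro ⟨a, b, c⟩ ⟨a', b', c'⟩ h
      simp at h ⊢; tauto
    · intro x hx; exact (mem_filter.1 hx).2
    · intro x hx
      have := (mem_filter.1 hx).1
      simp only [tris, mem_filter, mem_univ, true_and] at this
      exact ⟨this.1, this.2.2.symm⟩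
  have b3 : #((tris G).filter fun x => (x.2.1, x.2.2) ∈ S) ≤ ∑ p ∈ S, codeg G p := by
    refine fiber_bound G (fun x => (x.2.1, x.2.2)) (fun x => x.1) ?_ _ _ ?_ ?_
    · rintro ⟨a, b, c⟩ ⟨a', b', c'⟩ h
      simp at h ⊢; tauto
    · intro x hx; exact (mem_filter.1 hx).2
    · intro x hx
      have := (mem_filter.1 hx).1
      simp only [tris, mem_filter, mem_univ, true_and] at this
      exact ⟨this.1.symm, this.2.1.symm⟩
  have := (Finset.card_le_card sub).trans ((card_union_le _ _).trans
    (Nat.add_le_add_left (card_union_le _ _) _))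
  omega

/-- (Trevisan) `f_{K_{1,1,2}}(γ) = ω(γ²)` as `γ → 0`: for every `C > 0` there is
`γ₀ > 0` such that for every `0 < γ ≤ γ₀` there is `N` so that every graph on
`n ≥ N` vertices with triangle density at least `γ` has `K_{1,1,2}`-density at
least `C·γ²`. -/
theorem trevisan_K112_lower (C : ℝ) (hC : 0 < C) :
    ∃ γ₀ : ℝ, 0 < γ₀ ∧ ∀ γ : ℝ, 0 < γ → γ ≤ γ₀ →
      ∃ N : ℕ, ∀ (β : Type) [Fintype β] (G : SimpleGraph β),
        N ≤ Fintype.card β →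
        γ ≤ homDensity triangleGraph G →
        C * γ ^ 2 ≤ homDensity (Kabc 1 1 2) G := by
  classical
  obtain ⟨ε, hε, hεC⟩ : ∃ ε : ℝ, 0 < ε ∧ 18 * ε * C = 1 :=
    ⟨1 / (18 * C), by positivity, by field_simp⟩
  have hb := triangleRemovalBound_pos hε
  set b := triangleRemovalBound ε with hbdef
  refine ⟨b / Real.sqrt C, by positivity, fun γ hγ hγ0 => ⟨1, fun β _ G hn ht => ?_⟩⟩
  have hCγ : C * γ ^ 2 ≤ b ^ 2 := by
    have h1 : Real.sqrt C * γ ≤ b := by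
      rw [le_div_iff₀ (by positivity)] at hγ0; linarith
    calc C * γ ^ 2 = (Real.sqrt C * γ) ^ 2 := by rw [mul_pow, Real.sq_sqrt hC.le]
      _ ≤ b ^ 2 := by gcongr
  have hn0 : (0 : ℝ) < Fintype.card β := by exact_mod_cast hn
  unfold homDensity at ht ⊢
  have c3 : Fintype.card (Fin 3) = 3 := by simp
  have c4 : Fintype.card (Σ i : Fin 3, Fin (![1, 1, 2] i)) = 4 := by decide
  rw [c3] at ht
  rw [c4]
  set n : ℝ := (Fintype.card β : ℝ) with hndef
  rw [le_div_iff₀ (by positivity)] at ht ⊢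
  have hT : γ * n ^ 3 ≤ #(tris G) := ht.trans (by exact_mod_cast hom_tri_le G)
  have hK : (∑ p ∈ adjPairs G, (codeg G p : ℝ) ^ 2) ≤ homCount (Kabc 1 1 2) G := by
    exact_mod_cast codeg_sq_le G
  refine le_trans ?_ hK
  set Q := ∑ p ∈ adjPairs G, (codeg G p : ℝ) ^ 2 with hQ
  have hQ0 : 0 ≤ Q := by positivity
  by_cases hcl : (#(G.cliqueFinset 3) : ℝ) < b * (Fintype.card β : ℝ) ^ 3
  · obtain ⟨G', hle, hI, hcard, hfree⟩ := triangle_removal hcl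
    have h1 : (#(tris G) : ℝ) ≤ 3 * ∑ p ∈ adjPairs G \ adjPairs G', (codeg G p : ℝ) := by
      exact_mod_cast tri_le_removed G G' hfree
    have hsub : adjPairs G' ⊆ adjPairs G := by
      intro p hp
      simp only [adjPairs, mem_filter, mem_univ, true_and] at hp ⊢
      exact hle hp
    have h2 : (#(adjPairs G \ adjPairs G') : ℝ) ≤ 2 * ε * n ^ 2 := by
      have e1 : (#(adjPairs G) : ℝ) = 2 * #G.edgeFinset := by
        rw [card_adjPairs]; push_cast; congr!
      have e2 : (#(adjPairs G') : ℝ) = 2 * #G'.edgeFinset := by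
        rw [card_adjPairs]; push_cast; congr!
      rw [Finset.cast_card_sdiff hsub, e1, e2]
      push_cast at hcard
      rw [hndef]
      linarith
    have h3 := sq_sum_le_card_mul_sum_sq (s := adjPairs G \ adjPairs G')
      (f := fun p => (codeg G p : ℝ))
    have h4 : ∑ p ∈ adjPairs G \ adjPairs G', (codeg G p : ℝ) ^ 2 ≤ Q :=
      Finset.sum_le_sum_of_subset_of_nonneg Finset.sdiff_subset fun _ _ _ => by positivity
    set R := ∑ p ∈ adjPairs G \ adjPairs G', (codeg G p : ℝ)
    have h5 : R ^ 2 ≤ 2 * ε * n ^ 2 * Q :=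
      h3.trans (mul_le_mul h2 h4 (by positivity) (by positivity))
    have h6 : (γ * n ^ 3) ^ 2 ≤ 9 * R ^ 2 := by
      calc (γ * n ^ 3) ^ 2 ≤ (3 * R) ^ 2 := 
          pow_le_pow_left₀ (by positivity) (by linarith) 2
        _ = _ := by ring
    have h7 : n ^ 2 * (γ ^ 2 * n ^ 4) ≤ n ^ 2 * (18 * ε * Q) := by nlinarith
    have h8 := le_of_mul_le_mul_left h7 (by positivity)
    calc C * γ ^ 2 * n ^ 4 = C * (γ ^ 2 * n ^ 4) := by ring
      _ ≤ C * (18 * ε * Q) := by gcongr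
      _ = (18 * ε * C) * Q := by ring
      _ = Q := by rw [hεC, one_mul]
  · push Not at hcl
    have h1 : (#(G.cliqueFinset 3) : ℝ) ≤ ∑ p ∈ adjPairs G, (codeg G p : ℝ) := by
      exact_mod_cast (clique_le G).trans (tri_le_codeg G)
    have h3 := sq_sum_le_card_mul_sum_sq (s := adjPairs G) (f := fun p => (codeg G p : ℝ))
    have h2 : (#(adjPairs G) : ℝ) ≤ n ^ 2 := by
      have : #(adjPairs G) ≤ Fintype.card β ^ 2 := by
        refine (Finset.card_le_univ _).trans ?_
        rw [Fintype.card_prod, sq]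
      rw [hndef]
      exact_mod_cast this
    set R := ∑ p ∈ adjPairs G, (codeg G p : ℝ)
    have h5 : (b * n ^ 3) ^ 2 ≤ n ^ 2 * Q := by
      calc (b * n ^ 3) ^ 2 ≤ R ^ 2 := 
          pow_le_pow_left₀ (by positivity) (hcl.trans h1) 2
        _ ≤ _ := h3.trans (by gcongr)
    have h7 : n ^ 2 * (b ^ 2 * n ^ 4) ≤ n ^ 2 * Q := by nlinarith
    have h8 := le_of_mul_le_mul_left h7 (by positivity)
    exact le_trans (by gcongr) h8
end

section
/- For every ε > 0 and every N there exist a real number γ with 0 < γ < ε and a finite simple graph G on n ≥ N vertices such that the triangle density of G equals γ while the K_{1,1,2}-density of G is at most γ^{2−ε}. Consequently f_{K_{1,1,2}}(γ) ≤ γ^{2−o(1)}, so the random graph does not minimize the K_{1,1,2}-density among graphs of a given triangle density. -/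
open SimpleGraph Finset

lemma edt_unique {n : ℕ} {G : SimpleGraph (Fin n)} (hG : G.EdgeDisjointTriangles)
    {a b c d : Fin n} (hab : G.Adj a b) (hac : G.Adj a c) (hbc : G.Adj b c)
    (had : G.Adj a d) (hbd : G.Adj b d) : c = d := by
  classical
  have h1 : ({a, b, c} : Finset (Fin n)) ∈ G.cliqueSet 3 := by
    simp [is3Clique_triple_iff, *]
  have h2 : ({a, b, d} : Finset (Fin n)) ∈ G.cliqueSet 3 := by
    simp [is3Clique_triple_iff, *]
  have h : ({a, b, c} : Finset (Fin n)) = {a, b, d} := by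
    refine hG.eq h1 h2 (Set.Nontrivial.not_subsingleton ⟨a, ?_, b, ?_, hab.ne⟩) <;> simp
  have hc : c ∈ ({a, b, d} : Finset (Fin n)) := by rw [← h]; simp
  simp only [Finset.mem_insert, Finset.mem_singleton] at hc
  rcases hc with rfl | rfl | rfl
  · exact absurd rfl hac.ne
  · exact absurd rfl hbc.ne
  · rfl

lemma tri_adj {n : ℕ} {G : SimpleGraph (Fin n)} (f : triangleGraph →g G) {i j : Fin 3}
    (h : i ≠ j) : G.Adj (f i) (f j) := f.map_rel (by simpa [triangleGraph] using h)

lemma tri_le {n : ℕ} {G : SimpleGraph (Fin n)} (hG : G.EdgeDisjointTriangles) :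
    homCount triangleGraph G ≤ n ^ 2 := by
  have : Nat.card (Fin n × Fin n) = n ^ 2 := by simp [sq]
  rw [← this]
  refine Nat.card_le_card_of_injective (fun f : triangleGraph →g G => (f 0, f 1)) ?_
  intro f g h
  simp only [Prod.mk.injEq] at h
  obtain ⟨h0, h1⟩ := h
  have h2 : f 2 = g 2 := by
    refine edt_unique hG (tri_adj f (i := 0) (j := 1) (by decide))
      (tri_adj f (by decide)) (tri_adj f (by decide)) ?_ ?_
    · rw [h0]; exact tri_adj g (by decide)
    · rw [h1]; exact tri_adj g (by decide)
  apply RelHom.ext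
  intro i
  fin_cases i
  · exact h0
  · exact h1
  · exact h2

def kv (i : Fin 3) : Σ i : Fin 3, Fin (![1, 1, 2] i) :=
  ⟨i, ⟨0, by fin_cases i <;> simp⟩⟩

def kw : Σ i : Fin 3, Fin (![1, 1, 2] i) := ⟨2, ⟨1, by simp⟩⟩

lemma kv_kw (x : Σ i : Fin 3, Fin (![1, 1, 2] i)) : (∃ i, x = kv i) ∨ x = kw := by
  revert x
  decide

lemma k_adj {n : ℕ} {G : SimpleGraph (Fin n)} (f : Kabc 1 1 2 →g G)
    {x y : Σ i : Fin 3, Fin (![1, 1, 2] i)}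
    (h : x.1 ≠ y.1) : G.Adj (f x) (f y) := f.map_rel (by simpa [Kabc] using h)

lemma k_eq {n : ℕ} {G : SimpleGraph (Fin n)} (hG : G.EdgeDisjointTriangles)
    (f : Kabc 1 1 2 →g G) : f kw = f (kv 2) :=
  edt_unique hG (k_adj f (x := kv 0) (y := kv 1) (by decide))
      (k_adj f (by decide)) (k_adj f (by decide)) (k_adj f (by decide)) (k_adj f (by decide))

lemma k_le {n : ℕ} {G : SimpleGraph (Fin n)} (hG : G.EdgeDisjointTriangles) :
    homCount (Kabc 1 1 2) G ≤ homCount triangleGraph G := by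
  have : Finite (triangleGraph →g G) := DFunLike.finite _
  refine Nat.card_le_card_of_injective (fun f : Kabc 1 1 2 →g G =>
    (⟨fun i => f (kv i), fun {i j} h => k_adj f (by simpa [triangleGraph, kv] using h)⟩ :
      triangleGraph →g G)) ?_
  intro f g h
  have h' : ∀ i, f (kv i) = g (kv i) := fun i => DFunLike.congr_fun h i
  apply RelHom.ext
  intro x
  rcases kv_kw x with ⟨i, rfl⟩ | rfl
  · exact h' i
  · rw [k_eq hG, k_eq hG, h']

lemma clique_le_s3 {n : ℕ} {G : SimpleGraph (Fin n)} [DecidableRel G.Adj] :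
    #(G.cliqueFinset 3) ≤ homCount triangleGraph G := by
  classical
  have : Finite (triangleGraph →g G) := DFunLike.finite _
  have hc : Nat.card (G.cliqueFinset 3) = #(G.cliqueFinset 3) := by
    rw [Nat.card_eq_fintype_card, Fintype.card_coe]
  rw [← hc]
  have key : ∀ s : G.cliqueFinset 3, ∃ f : triangleGraph →g G,
      Finset.univ.image f = (s : Finset (Fin n)) := by
    rintro ⟨s, hs⟩
    rw [mem_cliqueFinset_iff, is3Clique_iff] at hs
    obtain ⟨a, b, c, hab, hac, hbc, rfl⟩ := hs
    refine ⟨⟨![a, b, c], ?_⟩, ?_⟩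
    · intro i j h
      fin_cases i <;> fin_cases j <;> simp_all [triangleGraph, G.adj_comm]
    · ext x
      simp [Fin.exists_fin_succ, eq_comm]
  choose F hF using key
  refine Nat.card_le_card_of_injective F ?_
  intro s t h
  apply Subtype.ext
  rw [← hF s, ← hF t, h]

lemma rs_large (δ : ℝ) (hδ : 0 < δ) : ∀ᶠ n : ℕ in Filter.atTop,
    (n : ℝ) ^ (2 - δ) ≤ ruzsaSzemerediNumberNat n := by
  obtain ⟨C, hC⟩ := ruzsaSzemerediNumberNat_asymptotic_lower_bound.bound
  have hs : Filter.Tendsto (fun n : ℕ => √(Real.log n)) Filter.atTop Filter.atTop :=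
    Real.tendsto_sqrt_atTop.comp (Real.tendsto_log_atTop.comp tendsto_natCast_atTop_atTop)
  filter_upwards [hC, hs.eventually_ge_atTop (5 / δ), hs.eventually_ge_atTop C,
    Filter.eventually_ge_atTop 1] with n h1 h2 h3 h4
  have hn : (0 : ℝ) < n := by exact_mod_cast h4
  have hl : 0 ≤ Real.log n := Real.log_natCast_nonneg n
  set s := √(Real.log n) with hsdef
  have hss : s ^ 2 = Real.log n := Real.sq_sqrt hl
  have hs0 : 0 ≤ s := Real.sqrt_nonneg _
  rw [Real.norm_of_nonneg (by positivity), Real.norm_of_nonneg (by positivity)] at h1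
  have e1 : (n : ℝ) ^ 2 * Real.exp (-4 * s) = (n : ℝ) ^ (2 - δ) * Real.exp (δ * s ^ 2 - 4 * s) := by
    rw [Real.rpow_sub hn, Real.rpow_def_of_pos hn δ, ← hss, Real.rpow_two,
      div_mul_eq_mul_div, eq_div_iff (Real.exp_pos _).ne', mul_assoc, ← Real.exp_add]
    congr 2
    ring
  have h5 : 5 ≤ s * δ := (div_le_iff₀ hδ).1 h2
  have e2 : C ≤ Real.exp (δ * s ^ 2 - 4 * s) := by
    have : s + 1 ≤ Real.exp s := Real.add_one_le_exp s
    have : Real.exp s ≤ Real.exp (δ * s ^ 2 - 4 * s) := Real.exp_le_exp.2 (by nlinarith)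
    linarith
  rw [e1, mul_comm] at h1
  have h6 : C * (ruzsaSzemerediNumberNat n : ℝ) ≤
      Real.exp (δ * s ^ 2 - 4 * s) * ruzsaSzemerediNumberNat n := by gcongr
  exact le_of_mul_le_mul_left (h1.trans h6) (Real.exp_pos _)

/-- `f_{K_{1,1,2}}(γ) ≤ γ^{2−o(1)}`: for every `ε > 0` and every `N` there are
`0 < γ < ε` and a graph `G` on `n ≥ N` vertices with triangle density exactly `γ`
and `K_{1,1,2}`-density at most `γ^(2−ε)`. -/
theorem K112_upper (ε : ℝ) (hε : 0 < ε) (N : ℕ) :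
    ∃ γ : ℝ, 0 < γ ∧ γ < ε ∧
      ∃ (n : ℕ) (G : SimpleGraph (Fin n)),
        N ≤ n ∧
        homDensity triangleGraph G = γ ∧
        homDensity (Kabc 1 1 2) G ≤ γ ^ (2 - ε) := by
  set δ := min ε (1 / 2) with hδ
  have hδ0 : 0 < δ := lt_min hε (by norm_num)
  have hδε : δ ≤ ε := min_le_left _ _
  have hδ2 : δ ≤ 1 / 2 := min_le_right _ _
  obtain ⟨n, hrs, hN, h1, hnε⟩ := ((rs_large δ hδ0).and ((Filter.eventually_ge_atTop N).and
    ((Filter.eventually_ge_atTop 1).and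
      (tendsto_natCast_atTop_atTop.eventually_gt_atTop (1 / ε))))).exists
  obtain ⟨G, _, hcard, hG⟩ := ruzsaSzemerediNumber_spec (α := Fin n)
  have hn : (0 : ℝ) < n := by exact_mod_cast h1
  have hn1 : (1 : ℝ) ≤ n := by exact_mod_cast h1
  have hT2 : (homCount triangleGraph G : ℝ) ≤ (n : ℝ) ^ 2 := by exact_mod_cast tri_le hG.1
  have hK : (homCount (Kabc 1 1 2) G : ℝ) ≤ homCount triangleGraph G := by
    exact_mod_cast k_le hG.1
  have hT : (n : ℝ) ^ (2 - δ) ≤ homCount triangleGraph G := by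
    refine hrs.trans ?_
    rw [ruzsaSzemerediNumberNat, ← hcard]
    exact Nat.cast_le.2 (clique_le_s3 (G := G))
  have d3 : homDensity triangleGraph G = (homCount triangleGraph G : ℝ) / (n : ℝ) ^ 3 := by
    simp [homDensity]
  have d4 : homDensity (Kabc 1 1 2) G = (homCount (Kabc 1 1 2) G : ℝ) / (n : ℝ) ^ 4 := by
    have : Fintype.card (Σ i : Fin 3, Fin (![1, 1, 2] i)) = 4 := by decide
    rw [homDensity, this, Fintype.card_fin]
  set T : ℝ := (homCount triangleGraph G : ℝ)
  set γ := T / (n : ℝ) ^ 3 with hγ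
  have hγlow : (n : ℝ) ^ (-(1 + δ)) ≤ γ := by
    rw [hγ, le_div_iff₀ (by positivity), ← Real.rpow_natCast, ← Real.rpow_add hn]
    refine le_trans (le_of_eq ?_) hT
    congr 1
    push_cast
    ring
  have hγ0 : 0 < γ := lt_of_lt_of_le (by positivity) hγlow
  have hγup : γ ≤ 1 / n := by
    rw [hγ, div_le_div_iff₀ (by positivity) hn]
    nlinarith
  have hγ1 : γ ≤ 1 := hγup.trans (by rw [div_le_one hn]; exact hn1)
  refine ⟨γ, hγ0, ?_, n, G, hN, d3, ?_⟩
  · refine hγup.trans_lt ?_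
    rw [div_lt_iff₀ hn]
    rw [div_lt_iff₀ hε] at hnε
    linarith
  · rw [d4]
    have a1 : (homCount (Kabc 1 1 2) G : ℝ) / (n : ℝ) ^ 4 ≤ γ * (n : ℝ)⁻¹ := by
      have : γ * (n : ℝ)⁻¹ = T / (n : ℝ) ^ 4 := by
        rw [hγ]; field_simp
      rw [this]
      gcongr
    have a2 : (n : ℝ)⁻¹ ≤ γ ^ (1 - δ) := by
      calc (n : ℝ)⁻¹ = (n : ℝ) ^ (-1 : ℝ) := (Real.rpow_neg_one _).symm
        _ ≤ (n : ℝ) ^ (-(1 + δ) * (1 - δ)) :=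
          Real.rpow_le_rpow_of_exponent_le hn1 (by nlinarith)
        _ = ((n : ℝ) ^ (-(1 + δ))) ^ (1 - δ) := Real.rpow_mul hn.le _ _
        _ ≤ γ ^ (1 - δ) := Real.rpow_le_rpow (by positivity) hγlow (by linarith)
    calc _ ≤ γ * (n : ℝ)⁻¹ := a1
      _ ≤ γ * γ ^ (1 - δ) := by gcongr
      _ = γ ^ (2 - δ) := by
        rw [← Real.rpow_one_add' hγ0.le (by linarith)]
        congr 1; ring
      _ ≤ γ ^ (2 - ε) := Real.rpow_le_rpow_of_exponent_ge hγ0 hγ1 (by linarith)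
end

section
/- For every C > 0 there exists γ₀ > 0 such that for every 0 < γ ≤ γ₀ there is N with the property: every finite simple graph G on n ≥ N vertices with triangle density d_{K_3}(G) ≥ γ satisfies d_{K_{1,2,2}}(G) ≥ C·γ⁴. In other words, f_{K_{1,2,2}}(γ) = ω(γ⁴) as γ → 0. -/
open SimpleGraph Finset

open Classical in
/-- Adjacency indicator. -/
noncomputable def adjI {β : Type} (G : SimpleGraph β) (x y : β) : ℝ := if G.Adj x y then 1 else 0

theorem adjI_symm {β : Type} (G : SimpleGraph β) (x y : β) : adjI G x y = adjI G y x := by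
  classical
  unfold adjI
  by_cases h : G.Adj x y
  · rw [if_pos h, if_pos h.symm]
  · rw [if_neg h, if_neg fun h2 => h h2.symm]

theorem adjI_nonneg {β : Type} (G : SimpleGraph β) (x y : β) : 0 ≤ adjI G x y := by
  unfold adjI; split_ifs <;> norm_num

theorem adjI_sq {β : Type} (G : SimpleGraph β) (x y : β) : adjI G x y * adjI G x y = adjI G x y := by
  unfold adjI; split_ifs <;> norm_num

noncomputable def triW {β : Type} (G : SimpleGraph β) (x y z : β) : ℝ :=
  adjI G x y * adjI G x z * adjI G y z

open Classical in
theorem triW_ite {β : Type} (G : SimpleGraph β) (x y z : β) :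
    triW G x y z = if G.Adj x y ∧ G.Adj x z ∧ G.Adj y z then 1 else 0 := by
  simp only [triW, adjI]
  split_ifs <;> simp_all

theorem ite_and_mul (p q : Prop) [Decidable p] [Decidable q] [Decidable (p ∧ q)] :
    (if p ∧ q then (1 : ℝ) else 0) = (if p then 1 else 0) * (if q then 1 else 0) := by
  split_ifs <;> simp_all

theorem homCount_tri_le {β : Type} [Fintype β] (G : SimpleGraph β) :
    (homCount triangleGraph G : ℝ) ≤ ∑ x, ∑ y, ∑ z, triW G x y z := by
  classical
  have h1 : homCount triangleGraph G ≤
      Nat.card {p : β × β × β // G.Adj p.1 p.2.1 ∧ G.Adj p.1 p.2.2 ∧ G.Adj p.2.1 p.2.2} := by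
    refine Nat.card_le_card_of_injective
      (fun f : triangleGraph →g G => ⟨(f 0, f 1, f 2), f.map_rel ?_, f.map_rel ?_, f.map_rel ?_⟩) ?_
    · simp [triangleGraph]
    · simp [triangleGraph]
    · simp [triangleGraph]
    · intro f g h
      simp only [Subtype.mk.injEq, Prod.mk.injEq] at h
      ext i
      fin_cases i
      · exact h.1
      · exact h.2.1
      · exact h.2.2
  have h2 : ((Nat.card {p : β × β × β // G.Adj p.1 p.2.1 ∧ G.Adj p.1 p.2.2 ∧ G.Adj p.2.1 p.2.2} : ℕ) : ℝ)
      = ∑ x, ∑ y, ∑ z, triW G x y z := by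
    rw [Nat.card_eq_fintype_card, Fintype.card_subtype, Finset.card_filter]
    push_cast
    rw [Fintype.sum_prod_type]
    simp_rw [Fintype.sum_prod_type]
    refine Finset.sum_congr rfl fun x _ => Finset.sum_congr rfl fun y _ =>
      Finset.sum_congr rfl fun z _ => ?_
    simp only [triW, adjI]
    split_ifs <;> simp_all
  rw [← h2]
  exact_mod_cast h1

theorem cliques_le {β : Type} [Fintype β] [DecidableEq β] (G : SimpleGraph β) [DecidableRel G.Adj] :
    (#(G.cliqueFinset 3) : ℝ) ≤ ∑ x, ∑ y, ∑ z, triW G x y z := by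
  classical
  have h1 : G.cliqueFinset 3 ⊆ ((Finset.univ : Finset (β × β × β)).filter
      (fun p => G.Adj p.1 p.2.1 ∧ G.Adj p.1 p.2.2 ∧ G.Adj p.2.1 p.2.2)).image
        (fun p => ({p.1, p.2.1, p.2.2} : Finset β)) := by
    intro s hs
    rw [mem_cliqueFinset_iff, is3Clique_iff] at hs
    obtain ⟨a, b, c, hab, hac, hbc, rfl⟩ := hs
    rw [Finset.mem_image]
    exact ⟨(a, b, c), by simp [hab, hac, hbc], rfl⟩
  have h3 := (Finset.card_le_card h1).trans Finset.card_image_le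
  have h2 : ((#((Finset.univ : Finset (β × β × β)).filter
      (fun p => G.Adj p.1 p.2.1 ∧ G.Adj p.1 p.2.2 ∧ G.Adj p.2.1 p.2.2)) : ℕ) : ℝ)
      = ∑ x, ∑ y, ∑ z, triW G x y z := by
    rw [Finset.card_filter]
    push_cast
    rw [Fintype.sum_prod_type]
    simp_rw [Fintype.sum_prod_type]
    refine Finset.sum_congr rfl fun x _ => Finset.sum_congr rfl fun y _ =>
      Finset.sum_congr rfl fun z _ => ?_
    simp only [triW, adjI]
    split_ifs <;> simp_all
  rw [← h2]
  exact_mod_cast h3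

theorem homCount_K_ge {β : Type} [Fintype β] (G : SimpleGraph β) :
    ∑ v, ∑ a, ∑ a', (∑ b, triW G v a b * triW G v a' b) ^ 2 ≤ (homCount (Kabc 1 2 2) G : ℝ) := by
  classical
  let P : β × β × β × β × β → Prop := fun p =>
    (G.Adj p.1 p.2.1 ∧ G.Adj p.1 p.2.2.1 ∧ G.Adj p.1 p.2.2.2.1 ∧ G.Adj p.1 p.2.2.2.2) ∧
    (G.Adj p.2.1 p.2.2.2.1 ∧ G.Adj p.2.1 p.2.2.2.2 ∧ G.Adj p.2.2.1 p.2.2.2.1 ∧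
      G.Adj p.2.2.1 p.2.2.2.2)
  let F : β × β × β × β × β → (Σ i : Fin 3, Fin (![1, 2, 2] i)) → β := fun p x =>
    match x with
    | ⟨0, _⟩ => p.1
    | ⟨1, j⟩ => if j.val = 0 then p.2.1 else p.2.2.1
    | ⟨2, j⟩ => if j.val = 0 then p.2.2.2.1 else p.2.2.2.2
  have hF : ∀ p, P p → ∀ x y, (Kabc 1 2 2).Adj x y → G.Adj (F p x) (F p y) := by
    rintro ⟨v, a, a', b, b'⟩ ⟨⟨h1, h2, h3, h4⟩, h5, h6, h7, h8⟩ ⟨i, x⟩ ⟨j, y⟩ h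
    have hij : i ≠ j := by simpa [Kabc] using h
    dsimp only at h1 h2 h3 h4 h5 h6 h7 h8
    fin_cases i <;> fin_cases j <;> first | exact absurd rfl hij | skip
    all_goals
      dsimp only [F]
      split_ifs <;> first | assumption | (apply SimpleGraph.Adj.symm; assumption)
  have h1 : Nat.card {p : β × β × β × β × β // P p} ≤ homCount (Kabc 1 2 2) G := by
    refine Nat.card_le_card_of_injective
      (fun p : {p : β × β × β × β × β // P p} =>
        (⟨F p.1, fun {x y} h => hF p.1 p.2 x y h⟩ : Kabc 1 2 2 →g G)) ?_
    rintro ⟨⟨v, a, a', b, b'⟩, hp⟩ ⟨⟨w, c, c', d, d'⟩, hq⟩ h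
    have h' : ∀ x, F (v, a, a', b, b') x = F (w, c, c', d, d') x := fun x => DFunLike.congr_fun h x
    have e1 : v = w := h' ⟨0, (0 : Fin 1)⟩
    have e2 : a = c := h' ⟨1, (0 : Fin 2)⟩
    have e3 : a' = c' := h' ⟨1, (1 : Fin 2)⟩
    have e4 : b = d := h' ⟨2, (0 : Fin 2)⟩
    have e5 : b' = d' := h' ⟨2, (1 : Fin 2)⟩
    subst e1 e2 e3 e4 e5
    rfl
  have h2 : ((Nat.card {p : β × β × β × β × β // P p} : ℕ) : ℝ)
      = ∑ v, ∑ a, ∑ a', (∑ b, triW G v a b * triW G v a' b) ^ 2 := by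
    rw [Nat.card_eq_fintype_card, Fintype.card_subtype, Finset.card_filter]
    push_cast
    rw [Fintype.sum_prod_type]
    simp_rw [Fintype.sum_prod_type, sq, Finset.sum_mul_sum]
    refine Finset.sum_congr rfl fun x _ => Finset.sum_congr rfl fun y _ =>
      Finset.sum_congr rfl fun z _ => Finset.sum_congr rfl fun b _ =>
      Finset.sum_congr rfl fun b' _ => ?_
    rw [triW_ite, triW_ite, triW_ite, triW_ite, ← ite_and_mul, ← ite_and_mul, ← ite_and_mul]
    refine if_congr ?_ rfl rfl
    simp only [P]
    tauto
  rw [← h2]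
  exact_mod_cast h1

/-- sum of squared codegrees over edges -/
noncomputable def SS {β : Type} [Fintype β] (G : SimpleGraph β) : ℝ :=
  ∑ x, ∑ y, (∑ z, triW G x y z) ^ 2

theorem triW_swap {β : Type} (G : SimpleGraph β) (x y z : β) : triW G x y z = triW G x z y := by
  unfold triW; rw [adjI_symm G y z]; ring

theorem triW_swap' {β : Type} (G : SimpleGraph β) (x y z : β) : triW G x y z = triW G y x z := by
  unfold triW; rw [adjI_symm G y x]; ring

theorem SS_sq_le {β : Type} [Fintype β] (G : SimpleGraph β) :
    SS G ^ 2 ≤ (Fintype.card β : ℝ) ^ 3 * (homCount (Kabc 1 2 2) G : ℝ) := by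
  have h0 : SS G = ∑ p : β × β × β, ∑ b, triW G p.1 p.2.1 b * triW G p.1 p.2.2 b := by
    rw [Fintype.sum_prod_type]
    simp_rw [Fintype.sum_prod_type]
    unfold SS
    refine Finset.sum_congr rfl fun x _ => ?_
    simp_rw [sq, Finset.sum_mul_sum]
    rw [Finset.sum_comm]
    refine Finset.sum_congr rfl fun y _ => ?_
    rw [Finset.sum_comm]
    refine Finset.sum_congr rfl fun z _ => Finset.sum_congr rfl fun b _ => ?_
    rw [triW_swap G x b y, triW_swap G x b z]
  have h1 := sq_sum_le_card_mul_sum_sq (s := (Finset.univ : Finset (β × β × β)))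
    (f := fun p => ∑ b, triW G p.1 p.2.1 b * triW G p.1 p.2.2 b)
  rw [← h0, Fintype.sum_prod_type] at h1
  simp_rw [Fintype.sum_prod_type] at h1
  refine h1.trans ?_
  have : ((#(Finset.univ : Finset (β × β × β)) : ℕ) : ℝ) = (Fintype.card β : ℝ) ^ 3 := by
    rw [Finset.card_univ, Fintype.card_prod, Fintype.card_prod]; push_cast; ring
  rw [this]
  gcongr
  exact homCount_K_ge G

theorem weighted_sq_le {β : Type} [Fintype β] (G : SimpleGraph β) (D : β → β → ℝ) :
    (∑ x, ∑ y, D x y * ∑ z, triW G x y z) ^ 2 ≤ (∑ x, ∑ y, D x y ^ 2) * SS G := by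
  have h := Finset.sum_mul_sq_le_sq_mul_sq (Finset.univ : Finset (β × β))
    (fun p => D p.1 p.2) (fun p => ∑ z, triW G p.1 p.2 z)
  simp_rw [Fintype.sum_prod_type] at h
  exact h

theorem tri_removed {β : Type} [Fintype β] (G H : SimpleGraph β) (hle : H ≤ G)
    (hH : H.CliqueFree 3) :
    ∑ x, ∑ y, ∑ z, triW G x y z ≤
      3 * ∑ x, ∑ y, (adjI G x y - adjI H x y) * ∑ z, triW G x y z := by
  classical
  have key : ∀ x y z, triW G x y z ≤ (adjI G x y - adjI H x y) * triW G x y z +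
      (adjI G x z - adjI H x z) * triW G x z y + (adjI G y z - adjI H y z) * triW G y z x := by
    intro x y z
    have hn : ¬ (H.Adj x y ∧ H.Adj x z ∧ H.Adj y z) := by
      rintro ⟨h1, h2, h3⟩
      exact hH {x, y, z} (is3Clique_triple_iff.2 ⟨h1, h2, h3⟩)
    have a1 := @hle x y
    have a2 := @hle x z
    have a3 := @hle y z
    have e1 : triW G x z y = triW G x y z := triW_swap G x z y
    have e2 : triW G y z x = triW G x y z := by rw [triW_swap, triW_swap']
    rw [e1, e2]
    simp only [triW, adjI]
    by_cases g1 : G.Adj x y <;> by_cases g2 : G.Adj x z <;> by_cases g3 : G.Adj y z <;>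
      simp [g1, g2, g3]
    by_cases k1 : H.Adj x y <;> by_cases k2 : H.Adj x z <;> by_cases k3 : H.Adj y z <;>
      first | (norm_num [k1, k2, k3]; done) | exact absurd (And.intro k1 (And.intro k2 k3)) hn
  have hs := Finset.sum_le_sum fun x (_ : x ∈ Finset.univ) =>
    Finset.sum_le_sum fun y (_ : y ∈ Finset.univ) =>
    Finset.sum_le_sum fun z (_ : z ∈ Finset.univ) => key x y z
  refine hs.trans (le_of_eq ?_)
  simp_rw [Finset.sum_add_distrib]
  have q1 : ∑ x, ∑ y, ∑ z, (adjI G x z - adjI H x z) * triW G x z y =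
      ∑ x, ∑ y, ∑ z, (adjI G x y - adjI H x y) * triW G x y z :=
    Finset.sum_congr rfl fun x _ => Finset.sum_comm
  have q2 : ∑ x, ∑ y, ∑ z, (adjI G y z - adjI H y z) * triW G y z x =
      ∑ x, ∑ y, ∑ z, (adjI G x y - adjI H x y) * triW G x y z := by
    rw [Finset.sum_comm]
    exact Finset.sum_congr rfl fun x _ => Finset.sum_comm
  rw [q1, q2]
  simp_rw [Finset.mul_sum]
  rw [← Finset.sum_add_distrib, ← Finset.sum_add_distrib]
  simp_rw [← Finset.mul_sum]
  rw [Finset.mul_sum]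
  exact Finset.sum_congr rfl fun x _ => by ring

theorem adjI_sum {β : Type} [Fintype β] (G : SimpleGraph β) [DecidableRel G.Adj] :
    ∑ x, ∑ y, adjI G x y = 2 * (#G.edgeFinset : ℝ) := by
  classical
  have h := G.sum_degrees_eq_twice_card_edges
  have h' : ((∑ v, G.degree v : ℕ) : ℝ) = 2 * (#G.edgeFinset : ℝ) := by rw [h]; push_cast; ring
  rw [← h']
  push_cast
  refine Finset.sum_congr rfl fun x _ => ?_
  rw [← card_neighborFinset_eq_degree, neighborFinset_eq_filter, Finset.card_filter]
  push_cast
  refine Finset.sum_congr rfl fun y _ => ?_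
  unfold adjI
  congr

/-- `f_{K_{1,2,2}}(γ) = ω(γ⁴)` as `γ → 0`: for every `C > 0` there is `γ₀ > 0`
such that for every `0 < γ ≤ γ₀` there is `N` so that every graph on `n ≥ N`
vertices with triangle density at least `γ` has `K_{1,2,2}`-density at least
`C·γ⁴`. -/
theorem K122_lower (C : ℝ) (hC : 0 < C) :
    ∃ γ₀ : ℝ, 0 < γ₀ ∧ ∀ γ : ℝ, 0 < γ → γ ≤ γ₀ →
      ∃ N : ℕ, ∀ (β : Type) [Fintype β] (G : SimpleGraph β),
        N ≤ Fintype.card β →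
        γ ≤ homDensity triangleGraph G →
        C * γ ^ 4 ≤ homDensity (Kabc 1 2 2) G := by
  classical
  obtain ⟨s, hs, rfl⟩ : ∃ s : ℝ, 0 < s ∧ s ^ 4 = C :=
    ⟨√(√C), by positivity, by
      rw [show (4 : ℕ) = 2 * 2 from rfl, pow_mul, Real.sq_sqrt (by positivity),
        Real.sq_sqrt hC.le]⟩
  set ε : ℝ := 1 / (36 * s ^ 2) with hε
  have hε0 : 0 < ε := by positivity
  have hB : 0 < triangleRemovalBound ε := triangleRemovalBound_pos hε0
  refine ⟨triangleRemovalBound ε / s, by positivity, fun γ hγ hγ₀ => ⟨1, fun β _ G hn hd => ?_⟩⟩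
  rw [le_div_iff₀ hs] at hγ₀
  by_contra hcon
  push Not at hcon
  have hn' : (0 : ℝ) < Fintype.card β := by exact_mod_cast hn
  have c5 : Fintype.card (Σ i : Fin 3, Fin (![1, 2, 2] i)) = 5 := by
    simp [Fin.sum_univ_three]
  unfold homDensity at hd hcon
  rw [c5, div_lt_iff₀ (by positivity)] at hcon
  rw [Fintype.card_fin, le_div_iff₀ (by positivity)] at hd
  set n : ℝ := (Fintype.card β : ℝ) with hnn
  have hT := hd.trans (homCount_tri_le G)
  set T := ∑ x, ∑ y, ∑ z, triW G x y z with hTdef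
  have hS : SS G < s ^ 2 * γ ^ 2 * n ^ 4 := by
    refine lt_of_pow_lt_pow_left₀ 2 (by positivity) ?_
    calc SS G ^ 2 ≤ n ^ 3 * (homCount (Kabc 1 2 2) G : ℝ) := SS_sq_le G
      _ < n ^ 3 * (s ^ 4 * γ ^ 4 * n ^ 5) := by gcongr
      _ = _ := by ring
  have hT2 : T < s * γ * n ^ 3 := by
    refine lt_of_pow_lt_pow_left₀ 2 (by positivity) ?_
    have h := weighted_sq_le G (fun _ _ => 1)
    simp only [one_mul, one_pow, Finset.sum_const, Finset.card_univ, nsmul_eq_mul, mul_one] at h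
    calc T ^ 2 ≤ n * n * SS G := h
      _ < n * n * (s ^ 2 * γ ^ 2 * n ^ 4) := by gcongr
      _ = _ := by ring
  obtain ⟨H, hle, inst, hcard, hfree⟩ := triangle_removal (G := G) (ε := ε) (by
    calc (#(G.cliqueFinset 3) : ℝ) ≤ T := cliques_le G
      _ < s * γ * n ^ 3 := hT2
      _ ≤ triangleRemovalBound ε * n ^ 3 := by
        gcongr
        linarith)
  have hr := tri_removed G H hle hfree
  have hw := weighted_sq_le G (fun x y => adjI G x y - adjI H x y)
  have hD : ∑ x, ∑ y, (adjI G x y - adjI H x y) ^ 2 < 2 * ε * n ^ 2 := by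
    have : ∀ x y, (adjI G x y - adjI H x y) ^ 2 = adjI G x y - adjI H x y := by
      intro x y
      have := @hle x y
      unfold adjI
      split_ifs <;> simp_all
    simp_rw [this, Finset.sum_sub_distrib]
    rw [adjI_sum, adjI_sum]
    push_cast at hcard
    rw [← hnn] at hcard
    linarith
  set W := ∑ x, ∑ y, (adjI G x y - adjI H x y) * ∑ z, triW G x y z with hW
  have hS0 : 0 ≤ SS G := Finset.sum_nonneg fun x _ => Finset.sum_nonneg fun y _ => sq_nonneg _
  have f1 : W ^ 2 ≤ (2 * ε * n ^ 2) * (s ^ 2 * γ ^ 2 * n ^ 4) :=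
    hw.trans (by gcongr)
  have f2 : (2 * ε * n ^ 2) * (s ^ 2 * γ ^ 2 * n ^ 4) = (γ * n ^ 3) ^ 2 / 18 := by
    rw [hε]; field_simp; ring
  have f3 : γ * n ^ 3 ≤ 3 * W := hT.trans hr
  have f4 : 0 < γ * n ^ 3 := by positivity
  have f5 : (γ * n ^ 3) ^ 2 ≤ (3 * W) ^ 2 := by gcongr
  have f6 : 0 < (γ * n ^ 3) ^ 2 := by positivity
  rw [f2] at f1
  nlinarith
end

section
/- For every ε > 0 and every N there exist a real number γ with 0 < γ < ε and a finite simple graph G on n ≥ N vertices such that the triangle density of G equals γ while the K_{1,2,2}-density of G is at most γ^{3−ε}. Consequently f_{K_{1,2,2}}(γ) ≤ γ^{3−o(1)}, so the random graph does not minimize the K_{1,2,2}-density among graphs of a given triangle density. -/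
open SimpleGraph Finset

lemma aux_unique {V : Type*} {G : SimpleGraph V} (hG : G.EdgeDisjointTriangles)
    {x y z z' : V} (hxy : G.Adj x y) (hxz : G.Adj x z) (hyz : G.Adj y z)
    (hxz' : G.Adj x z') (hyz' : G.Adj y z') : z = z' := by
  classical
  by_contra hne
  have h1 : ({x, y, z} : Finset V) ∈ G.cliqueSet 3 := by
    simp [is3Clique_triple_iff, *]
  have h2 : ({x, y, z'} : Finset V) ∈ G.cliqueSet 3 := by
    simp [is3Clique_triple_iff, *]
  have h3 : ({x, y, z} : Finset V) ≠ {x, y, z'} := by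
    intro h
    have : z ∈ ({x, y, z'} : Finset V) := by rw [← h]; simp
    simp only [Finset.mem_insert, Finset.mem_singleton] at this
    rcases this with h | h | h
    · exact hxz.ne h.symm
    · exact hyz.ne h.symm
    · exact hne h
  have h4 := hG h1 h2 h3
  exact hxy.ne (h4 (by simp) (by simp))

lemma aux_K122_le {V : Type*} [Fintype V] {G : SimpleGraph V} (hG : G.EdgeDisjointTriangles) :
    homCount (Kabc 1 2 2) G ≤ homCount triangleGraph G := by
  classical
  unfold homCount
  have hfin : Finite (triangleGraph →g G) := DFunLike.finite _
  let emb : triangleGraph →g Kabc 1 2 2 :=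
    { toFun := fun i => ⟨i, ⟨0, by fin_cases i <;> simp⟩⟩
      map_rel' := by
        intro a b h
        simpa [Kabc, triangleGraph] using h }
  refine Nat.card_le_card_of_injective (fun f : Kabc 1 2 2 →g G => f.comp emb) ?_
  intro f g hfg
  have key : ∀ i, f (emb i) = g (emb i) := fun i => DFunLike.congr_fun hfg i
  have K : ∀ (f : Kabc 1 2 2 →g G) (p q : Σ i : Fin 3, Fin (![1, 2, 2] i)), p.1 ≠ q.1 →
      G.Adj (f p) (f q) := fun f p q h => f.map_rel (by simpa [Kabc] using h)
  have col : ∀ (f : Kabc 1 2 2 →g G) (p : Σ i : Fin 3, Fin (![1, 2, 2] i)), f p = f (emb p.1) := by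
    rintro f ⟨i, j⟩
    have h : ∃ a b : Fin 3, a ≠ b ∧ a ≠ i ∧ b ≠ i := by
      revert i; decide
    obtain ⟨a, b, hab, hai, hbi⟩ := h
    exact aux_unique hG (K f (emb a) (emb b) hab) (K f (emb a) _ hai) (K f (emb b) _ hbi)
      (K f (emb a) (emb i) hai) (K f (emb b) (emb i) hbi)
  apply DFunLike.ext
  intro p
  rw [col f p, col g p, key]

lemma aux_tri_le {V : Type*} [Fintype V] {G : SimpleGraph V} (hG : G.EdgeDisjointTriangles) :
    homCount triangleGraph G ≤ Fintype.card V ^ 2 := by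
  classical
  unfold homCount
  have : Fintype.card V ^ 2 = Nat.card (V × V) := by
    simp [Nat.card_eq_fintype_card, sq]
  rw [this]
  refine Nat.card_le_card_of_injective (fun f : triangleGraph →g G => (f 0, f 1)) ?_
  intro f g hfg
  simp only [Prod.mk.injEq] at hfg
  obtain ⟨h0, h1⟩ := hfg
  have K : ∀ (f : triangleGraph →g G) (p q : Fin 3), p ≠ q →
      G.Adj (f p) (f q) := fun f p q h => f.map_rel (by simpa [triangleGraph] using h)
  have h2 : f 2 = g 2 := by
    refine aux_unique hG (K f 0 1 (by decide)) (K f 0 2 (by decide)) (K f 1 2 (by decide)) ?_ ?_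
    · rw [h0]; exact K g 0 2 (by decide)
    · rw [h1]; exact K g 1 2 (by decide)
  apply DFunLike.ext
  intro i
  fin_cases i
  · exact h0
  · exact h1
  · exact h2

open TripartiteFromTriangles in
lemma aux_graph (m : ℕ) : ∃ G : SimpleGraph (Fin (9 * m)), G.EdgeDisjointTriangles ∧
    m * rothNumberNat m ≤ homCount triangleGraph G := by
  classical
  obtain ⟨A, hA, hcard, hfree⟩ := rothNumberNat_spec m
  let F := Fin (3 * m)
  let t : Finset (F × F × F) := Finset.univ.filter fun p =>
    p.1.val < m ∧ ∃ a ∈ A, p.2.1.val = p.1.val + a ∧ p.2.2.val = p.1.val + 2 * a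
  have ht : ∀ x y z : F, (x, y, z) ∈ t ↔
      x.val < m ∧ ∃ a ∈ A, y.val = x.val + a ∧ z.val = x.val + 2 * a := by
    intro x y z; simp [t]
  have i1 : ExplicitDisjoint t := by
    constructor
    · intro a b c a' h h'
      rw [ht] at h h'
      obtain ⟨_, u, _, _, _⟩ := h
      obtain ⟨_, v, _, _, _⟩ := h'
      apply Fin.ext; omega
    · intro a b c a' h h'
      rw [ht] at h h'
      obtain ⟨_, u, _, _, _⟩ := h
      obtain ⟨_, v, _, _, _⟩ := h'
      apply Fin.ext; omega
    · intro a b c a' h h'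
      rw [ht] at h h'
      obtain ⟨_, u, _, _, _⟩ := h
      obtain ⟨_, v, _, _, _⟩ := h'
      apply Fin.ext; omega
  have i2 : NoAccidental t := by
    constructor
    intro a a' b b' c c' h1 h2 h3
    rw [ht] at h1 h2 h3
    obtain ⟨_, u, hu, _, _⟩ := h1
    obtain ⟨_, v, hv, _, _⟩ := h2
    obtain ⟨_, w, hw, _, _⟩ := h3
    have := hfree hu hv hw (by omega)
    left
    apply Fin.ext; omega
  have hcV : Fintype.card (F ⊕ F ⊕ F) = 9 * m := by simp [F]; omega
  let e : Fin (9 * m) ≃ (F ⊕ F ⊕ F) := (Fintype.equivFinOfCardEq hcV).symm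
  refine ⟨(graph t).comap e, (locallyLinear_comap.2 (locallyLinear t)).1, ?_⟩
  have hct : m * rothNumberNat m ≤ Nat.card t := by
    have : m * rothNumberNat m = Nat.card (Fin m × A) := by
      simp [hcard]
    rw [this]
    have hlt : ∀ a : A, a.1 < m := fun a => by simpa using hA a.2
    refine Nat.card_le_card_of_injective (fun p : Fin m × A =>
      (⟨(⟨p.1.val, by omega⟩, ⟨p.1.val + p.2.1, by have := hlt p.2; omega⟩,
        ⟨p.1.val + 2 * p.2.1, by have := hlt p.2; omega⟩), (ht _ _ _).2
          ⟨p.1.2, p.2.1, p.2.2, rfl, rfl⟩⟩ : t)) ?_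
    rintro ⟨i, a⟩ ⟨j, b⟩ h
    simp only [Subtype.mk.injEq, Prod.mk.injEq] at h
    obtain ⟨h1, h2, h3⟩ := h
    replace h1 := congrArg Fin.val h1
    replace h2 := congrArg Fin.val h2
    dsimp only at h1 h2
    have : a.1 = b.1 := by omega
    exact Prod.ext (Fin.ext h1) (Subtype.ext this)
  refine hct.trans ?_
  unfold homCount
  have hfin : Finite (triangleGraph →g (graph t).comap e) := DFunLike.finite _
  let vtx : t → Fin 3 → F ⊕ F ⊕ F := fun p =>
    ![Sum3.in₀ p.1.1, Sum3.in₁ p.1.2.1, Sum3.in₂ p.1.2.2]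
  have hv : ∀ p i j, i ≠ j → (graph t).Adj (vtx p i) (vtx p j) := by
    rintro ⟨⟨a, b, c⟩, hp⟩ i j hij
    fin_cases i <;> fin_cases j <;> first | exact absurd rfl hij | (simp [vtx]; exact ⟨_, hp⟩)
  refine Nat.card_le_card_of_injective (fun p : t =>
    ({ toFun := fun i => e.symm (vtx p i)
       map_rel' := by
        intro i j h
        have : i ≠ j := by simpa [triangleGraph] using h
        simpa using hv p i j this } : triangleGraph →g (graph t).comap e)) ?_
  intro p q h
  have h' : ∀ i, vtx p i = vtx q i := fun i => e.symm.injective (DFunLike.congr_fun h i)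
  have h0 := h' 0
  have h1 := h' 1
  have h2 := h' 2
  simp [vtx, Sum3.in₀, Sum3.in₁, Sum3.in₂] at h0 h1 h2
  exact Subtype.ext (Prod.ext h0 (Prod.ext h1 h2))

/-- `f_{K_{1,2,2}}(γ) ≤ γ^{3−o(1)}`: for every `ε > 0` and every `N` there are
`0 < γ < ε` and a graph `G` on `n ≥ N` vertices with triangle density exactly `γ`
and `K_{1,2,2}`-density at most `γ^(3−ε)`. -/
theorem K122_upper (ε : ℝ) (hε : 0 < ε) (N : ℕ) :
    ∃ γ : ℝ, 0 < γ ∧ γ < ε ∧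
      ∃ (n : ℕ) (G : SimpleGraph (Fin n)),
        N ≤ n ∧
        homDensity triangleGraph G = γ ∧
        homDensity (Kabc 1 2 2) G ≤ γ ^ (3 - ε) := by
  obtain ⟨δ, hδ0, hδ1, hδε⟩ : ∃ δ : ℝ, 0 < δ ∧ δ ≤ 1 ∧ δ ≤ ε :=
    ⟨min ε 1, lt_min hε one_pos, min_le_right _ _, min_le_left _ _⟩
  obtain ⟨m, hm⟩ := exists_nat_ge (Real.exp ((2000 / δ) ^ 2) + N + 1 / ε)
  have hN0 : (0 : ℝ) ≤ N := Nat.cast_nonneg N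
  have hε' : 0 < 1 / ε := by positivity
  have hexp := Real.exp_pos ((2000 / δ) ^ 2)
  have hm0 : (0 : ℝ) < m := by linarith
  obtain ⟨G, hG, hT⟩ := aux_graph m
  have hK := aux_K122_le hG
  have hT2 := aux_tri_le hG
  rw [Fintype.card_fin] at hT2
  set T := homCount triangleGraph G with hTdef
  set L := Real.log m with hL
  have hmL : (m : ℝ) = Real.exp L := (Real.exp_log hm0).symm
  have hLs : (2000 / δ) ^ 2 ≤ L := by
    rw [hL, Real.le_log_iff_exp_le hm0]; linarith
  have hs : 2000 / δ ≤ √L := Real.le_sqrt_of_sq_le hLs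
  have hL0 : 0 ≤ L := le_trans (sq_nonneg _) hLs
  have hss : √L * √L = L := Real.mul_self_sqrt hL0
  have hδs : 2000 ≤ δ * √L := by
    rw [div_le_iff₀ hδ0] at hs; linarith
  have hs1 : 2000 ≤ √L := by nlinarith [Real.sqrt_nonneg L]
  have hmain : 8 * √L + 1456 ≤ δ * L := by
    have : δ * L = (δ * √L) * √L := by rw [mul_assoc, hss]
    nlinarith
  have hroth := Behrend.roth_lower_bound (N := m)
  rw [← hL] at hroth
  have hTr : (m : ℝ) * (m * Real.exp (-4 * √L)) ≤ T := by
    calc (m : ℝ) * (m * Real.exp (-4 * √L)) ≤ m * rothNumberNat m := by gcongr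
      _ ≤ T := by exact_mod_cast hT
  set n : ℝ := 9 * (m : ℝ) with hn
  have hn0 : 0 < n := by positivity
  have hT2' : (T : ℝ) ≤ n ^ 2 := by rw [hn]; exact_mod_cast hT2
  have hdT : homDensity triangleGraph G = T / n ^ 3 := by
    simp [homDensity, hTdef, hn]
  have hdK : homDensity (Kabc 1 2 2) G = (homCount (Kabc 1 2 2) G) / n ^ 5 := by
    have : Fintype.card (Σ i : Fin 3, Fin (![1, 2, 2] i)) = 5 := by decide
    unfold homDensity
    rw [this]
    simp [hn]
  set γ : ℝ := T / n ^ 3 with hγ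
  have hTpos : (0 : ℝ) < T := lt_of_lt_of_le (by positivity) hTr
  have hγ0 : 0 < γ := by positivity
  have hγn : γ ≤ 1 / n := by
    rw [hγ, div_le_div_iff₀ (by positivity) hn0]
    nlinarith
  have hmε : 1 / ε < n := by linarith
  have hγε : γ < ε := by
    refine hγn.trans_lt ?_
    rw [div_lt_iff₀ hn0]
    rw [div_lt_iff₀ hε] at hmε
    linarith
  have hm1 : 1 ≤ (m : ℝ) := by
    rw [hmL]; exact Real.one_le_exp hL0
  have hγ1 : γ ≤ 1 := by
    refine hγn.trans ?_
    rw [div_le_one hn0]; linarith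
  refine ⟨γ, hγ0, hγε, 9 * m, G, ?_, hdT, ?_⟩
  · have : (N : ℝ) ≤ m := by linarith
    have : N ≤ m := by exact_mod_cast this
    omega
  rw [hdK]
  have h1 : (homCount (Kabc 1 2 2) G : ℝ) / n ^ 5 ≤ γ * (1 / n ^ 2) := by
    have : γ * (1 / n ^ 2) = T / n ^ 5 := by
      rw [hγ]; field_simp
    rw [this]
    gcongr
  have h729 : (729 : ℝ) ≤ Real.exp 728 := by
    have := Real.add_one_le_exp (728 : ℝ); linarith
  have hγlow : Real.exp (-(4 * √L + L + 728)) ≤ γ := by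
    have e1 : (m : ℝ) * (m * Real.exp (-4 * √L)) / (Real.exp 728 * m ^ 3)
        = Real.exp (-(4 * √L + L + 728)) := by
      rw [hmL, ← Real.exp_nat_mul, ← Real.exp_add, ← Real.exp_add, ← Real.exp_add, ← Real.exp_sub]
      congr 1
      push_cast
      ring
    rw [← e1, hγ]
    have : n ^ 3 = 729 * (m : ℝ) ^ 3 := by rw [hn]; ring
    rw [this]
    gcongr
  have h2 : 1 / n ^ 2 ≤ γ ^ (2 - δ) := by
    calc 1 / n ^ 2 ≤ 1 / (m : ℝ) ^ 2 := by
          apply one_div_le_one_div_of_le (by positivity)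
          apply pow_le_pow_left₀ hm0.le; linarith
      _ = Real.exp (-(2 * L)) := by
          rw [hmL, ← Real.exp_nat_mul, Real.exp_neg, one_div]; norm_num
      _ ≤ Real.exp (-(4 * √L + L + 728) * (2 - δ)) := by
          apply Real.exp_le_exp.2
          nlinarith [Real.sqrt_nonneg L]
      _ = Real.exp (-(4 * √L + L + 728)) ^ (2 - δ) := by rw [Real.exp_mul]
      _ ≤ γ ^ (2 - δ) := Real.rpow_le_rpow (Real.exp_pos _).le hγlow (by linarith)
  calc (homCount (Kabc 1 2 2) G : ℝ) / n ^ 5 ≤ γ * (1 / n ^ 2) := h1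
    _ ≤ γ * γ ^ (2 - δ) := by gcongr
    _ = γ ^ (3 - δ) := by
        rw [← Real.rpow_one_add' hγ0.le (by linarith)]; congr 1; ring
    _ ≤ γ ^ (3 - ε) := Real.rpow_le_rpow_of_exponent_ge hγ0 hγ1 (by linarith)
end

section
/- (Erdős–Simonovits lower bound) For all positive integers a, b, c and every finite simple graph G on n ≥ 1 vertices, the K_{a,b,c}-density of G is at least the abc-th power of its triangle density: d_{K_{a,b,c}}(G) ≥ (d_{K_3}(G))^{abc}. -/
open SimpleGraph Finset

noncomputable def dens3 {X Y Z : Type} (R : X → Y → Z → Prop) : ℝ :=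
  (Nat.card {p : X × Y × Z // R p.1 p.2.1 p.2.2} : ℝ) /
    ((Nat.card X : ℝ) * Nat.card Y * Nat.card Z)

theorem dens3_nonneg {X Y Z : Type} (R : X → Y → Z → Prop) : 0 ≤ dens3 R := by
  unfold dens3; positivity

theorem dens3_rot {X Y Z : Type} (R : X → Y → Z → Prop) :
    dens3 R = dens3 (fun y z x => R x y z) := by
  unfold dens3
  have : Nat.card {p : X × Y × Z // R p.1 p.2.1 p.2.2} =
      Nat.card {p : Y × Z × X // R p.2.2 p.1 p.2.1} :=
    Nat.card_congr
      { toFun := fun p => ⟨(p.1.2.1, p.1.2.2, p.1.1), p.2⟩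
        invFun := fun p => ⟨(p.1.2.2, p.1.1, p.1.2.1), p.2⟩
        left_inv := fun p => rfl
        right_inv := fun p => rfl }
  rw [this]
  congr 1
  ring

open Classical in
theorem card_eq_sum {X W : Type} [Fintype X] [Fintype W] (R : X → W → Prop) :
    (Nat.card {p : X × W // R p.1 p.2} : ℝ) = ∑ w, ∑ x, if R x w then (1:ℝ) else 0 := by
  rw [Nat.card_eq_fintype_card, Fintype.card_subtype, Finset.card_filter]
  push_cast
  rw [Fintype.sum_prod_type, Finset.sum_comm]

theorem card_blow {X W : Type} [Fintype X] [Fintype W] (R : X → W → Prop) (a : ℕ) :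
    (Nat.card {p : X × W // R p.1 p.2} : ℝ) ^ (a + 1) ≤
    (Fintype.card W : ℝ) ^ a *
      Nat.card {p : (Fin (a + 1) → X) × W // ∀ i, R (p.1 i) p.2} := by
  classical
  rw [card_eq_sum, card_eq_sum (fun (x : Fin (a + 1) → X) w => ∀ i, R (x i) w)]
  have key : ∀ w : W, (∑ x : Fin (a + 1) → X, if ∀ i, R (x i) w then (1:ℝ) else 0) =
      (∑ x, if R x w then (1:ℝ) else 0) ^ (a + 1) := by
    intro w
    rw [Fintype.sum_pow]
    refine Finset.sum_congr rfl fun x _ => ?_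
    rw [Finset.prod_ite_zero]
    simp
  have key2 : (∑ w, ∑ x : Fin (a + 1) → X, if ∀ i, R (x i) w then (1:ℝ) else 0) =
      ∑ w, (∑ x, if R x w then (1:ℝ) else 0) ^ (a + 1) :=
    Finset.sum_congr rfl fun w _ => key w
  suffices goal' : (∑ w, ∑ x, if R x w then (1:ℝ) else 0) ^ (a + 1) ≤ (Fintype.card W : ℝ) ^ a *
      (∑ w, ∑ x : Fin (a + 1) → X, if ∀ i, R (x i) w then (1:ℝ) else 0) by
    convert goal'
  rw [key2]
  rcases isEmpty_or_nonempty W with hW | hW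
  · simp
  have hw : (0:ℝ) < Fintype.card W := by exact_mod_cast Fintype.card_pos
  have h := pow_sum_div_card_le_sum_pow (s := (Finset.univ : Finset W))
    (f := fun w => ∑ x, if R x w then (1:ℝ) else 0)
    (fun w _ => Finset.sum_nonneg fun x _ => by split_ifs <;> norm_num) a
  rw [div_le_iff₀ (by simpa using pow_pos hw a), Finset.card_univ, mul_comm] at h
  exact h

theorem dens3_blow {X Y Z : Type} [Fintype X] [Fintype Y] [Fintype Z]
    [Nonempty X] [Nonempty Y] [Nonempty Z]
    (R : X → Y → Z → Prop) (a : ℕ) (ha : 0 < a) :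
    dens3 R ^ a ≤ dens3 (fun (x : Fin a → X) y z => ∀ i, R (x i) y z) := by
  obtain ⟨a, rfl⟩ : ∃ k, a = k + 1 := ⟨a - 1, by omega⟩
  have h := card_blow (W := Y × Z) (fun x w => R x w.1 w.2) a
  unfold dens3
  simp only [Nat.card_eq_fintype_card (α := X), Nat.card_eq_fintype_card (α := Y),
    Nat.card_eq_fintype_card (α := Z), Nat.card_eq_fintype_card (α := Fin (a+1) → X)]
  have hx : (0:ℝ) < Fintype.card X := by exact_mod_cast Fintype.card_pos
  have hy : (0:ℝ) < Fintype.card Y := by exact_mod_cast Fintype.card_pos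
  have hz : (0:ℝ) < Fintype.card Z := by exact_mod_cast Fintype.card_pos
  rw [Fintype.card_prod] at h
  rw [div_pow, div_le_div_iff₀ (by positivity) (by
    rw [Fintype.card_fun]; push_cast; positivity)]
  rw [Fintype.card_fun, Fintype.card_fin]
  push_cast at h ⊢
  calc _ ≤ _ := mul_le_mul_of_nonneg_right h (by positivity)
    _ = _ := by ring

theorem tri_dens {β : Type} [Fintype β] (G : SimpleGraph β) :
    homDensity triangleGraph G = dens3 (fun x y z => G.Adj x y ∧ G.Adj y z ∧ G.Adj x z) := by
  unfold homDensity dens3 homCount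
  have : Nat.card (triangleGraph →g G) =
      Nat.card {p : β × β × β // G.Adj p.1 p.2.1 ∧ G.Adj p.2.1 p.2.2 ∧ G.Adj p.1 p.2.2} := by
    refine Nat.card_congr
      { toFun := fun φ => ⟨(φ 0, φ 1, φ 2), φ.map_rel (by simp [triangleGraph]),
          φ.map_rel (by simp [triangleGraph]), φ.map_rel (by simp [triangleGraph])⟩
        invFun := fun p => ⟨![p.1.1, p.1.2.1, p.1.2.2], ?_⟩
        left_inv := ?_
        right_inv := fun p => rfl }
    · obtain ⟨p, h1, h2, h3⟩ := p
      intro i j hij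
      fin_cases i <;> fin_cases j <;> simp_all [triangleGraph, G.adj_comm]
    · intro φ
      ext i
      fin_cases i <;> rfl
  rw [this, Nat.card_eq_fintype_card (α := β), Fintype.card_fin]
  congr 1
  ring

def glue {β : Type} {a b c : ℕ} (x : Fin a → β) (y : Fin b → β) (z : Fin c → β) :
    (Σ i : Fin 3, Fin (![a, b, c] i)) → β
  | ⟨0, i⟩ => x i
  | ⟨1, i⟩ => y i
  | ⟨2, i⟩ => z i

theorem K_dens {β : Type} [Fintype β] (G : SimpleGraph β) (a b c : ℕ)
    (ha : 0 < a) (hb : 0 < b) (hc : 0 < c) :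
    homDensity (Kabc a b c) G = dens3 (fun (x : Fin a → β) (y : Fin b → β) (z : Fin c → β) =>
      ∀ k j i, G.Adj (x i) (y j) ∧ G.Adj (y j) (z k) ∧ G.Adj (x i) (z k)) := by
  unfold homDensity dens3 homCount
  have : Nat.card (Kabc a b c →g G) =
      Nat.card {p : (Fin a → β) × (Fin b → β) × (Fin c → β) //
        ∀ k j i, G.Adj (p.1 i) (p.2.1 j) ∧ G.Adj (p.2.1 j) (p.2.2 k) ∧
          G.Adj (p.1 i) (p.2.2 k)} := by
    refine Nat.card_congr
      { toFun := fun φ => ⟨(fun i => φ ⟨0, i⟩, fun i => φ ⟨1, i⟩, fun i => φ ⟨2, i⟩),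
          fun k j i => ⟨φ.map_rel (by simp [Kabc]),
          φ.map_rel (by simp [Kabc]), φ.map_rel (by simp [Kabc])⟩⟩
        invFun := fun p => ⟨glue p.1.1 p.1.2.1 p.1.2.2, ?_⟩
        left_inv := ?_
        right_inv := fun p => rfl }
    · obtain ⟨⟨x, y, z⟩, h⟩ := p
      have h1 : ∀ i j, G.Adj (x i) (y j) := fun i j => (h ⟨0, hc⟩ j i).1
      have h2 : ∀ j k, G.Adj (y j) (z k) := fun j k => (h k j ⟨0, ha⟩).2.1
      have h3 : ∀ i k, G.Adj (x i) (z k) := fun i k => (h k ⟨0, hb⟩ i).2.2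
      rintro ⟨i, u⟩ ⟨j, v⟩ hij
      have hij' : i ≠ j := by simpa [Kabc] using hij
      clear hij
      fin_cases i <;> fin_cases j
      · exact absurd rfl hij'
      · exact h1 u v
      · exact h3 u v
      · exact (h1 v u).symm
      · exact absurd rfl hij'
      · exact h2 u v
      · exact (h3 v u).symm
      · exact (h2 v u).symm
      · exact absurd rfl hij'
    · intro φ
      ext ⟨i, u⟩
      fin_cases i <;> rfl
  rw [this]
  congr 1
  simp [Fin.sum_univ_three, Nat.card_eq_fintype_card, pow_add]

/-- (Erdős–Simonovits lower bound) For all positive `a, b, c` and every graph `G`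
on at least one vertex, `d_{K_{a,b,c}}(G) ≥ d_{K₃}(G)^(abc)`. -/
theorem erdos_simonovits_lower (a b c : ℕ) (ha : 0 < a) (hb : 0 < b) (hc : 0 < c)
    (β : Type) [Fintype β] (G : SimpleGraph β) (hn : 1 ≤ Fintype.card β) :
    homDensity triangleGraph G ^ (a * b * c) ≤ homDensity (Kabc a b c) G := by
  have : Nonempty β := Fintype.card_pos_iff.mp hn
  rw [tri_dens, K_dens G a b c ha hb hc, pow_mul, pow_mul]
  have h1 := dens3_blow (fun x y z : β => G.Adj x y ∧ G.Adj y z ∧ G.Adj x z) a ha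
  rw [dens3_rot (fun (x : Fin a → β) _ _ => _)] at h1
  have h2 := dens3_blow (fun (y z : β) (x : Fin a → β) =>
    ∀ i, G.Adj (x i) y ∧ G.Adj y z ∧ G.Adj (x i) z) b hb
  rw [dens3_rot (fun (x : Fin b → β) _ _ => _)] at h2
  have h3 := dens3_blow (fun (z : β) (x : Fin a → β) (y : Fin b → β) =>
    ∀ j i, G.Adj (x i) (y j) ∧ G.Adj (y j) z ∧ G.Adj (x i) z) c hc
  rw [dens3_rot (fun (x : Fin c → β) _ _ => _)] at h3
  refine le_trans ?_ h3
  refine pow_le_pow_left₀ (pow_nonneg (pow_nonneg (dens3_nonneg _) _) _) ?_ _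
  refine le_trans ?_ h2
  exact pow_le_pow_left₀ (pow_nonneg (dens3_nonneg _) _) h1 _
end

section
/- (Triangle counting upper bound) For every ζ > 0 there is an ε > 0 with the following property. If G is a finite simple graph and A, B, C are pairwise disjoint independent vertex sets of size m each, such that the three pairs (A,B), (B,C), (A,C) are all ε-regular with d(A,B) = α₁, d(A,C) = α₂ and d(B,C) = α₃, then the number of triples (a,b,c) ∈ A × B × C spanning a triangle of G is at most (α₁·α₂·α₃ + ζ)·m³. -/
open SimpleGraph Finset

/-- The pair of vertex sets `(A, B)` is `ε`-regular in `G`: any `A´ ⊆ A`, `B´ ⊆ B`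
with `|A´| ≥ ε|A|` and `|B´| ≥ ε|B|` satisfy `|d(A´,B´) − d(A,B)| ≤ ε`. -/
def IsRegularPair {β : Type*} (G : SimpleGraph β) [DecidableRel G.Adj]
    (ε : ℝ) (A B : Finset β) : Prop :=
  ∀ A2 ⊆ A, ∀ B2 ⊆ B, ε * A.card ≤ A2.card → ε * B.card ≤ B2.card →
    |(G.edgeDensity A2 B2 : ℝ) - (G.edgeDensity A B : ℝ)| ≤ ε

lemma tcu_edge {β : Type*} (G : SimpleGraph β) [DecidableRel G.Adj] {ε : ℝ} (hε : 0 < ε)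
    {B C : Finset β} {m : ℕ} (hB : B.card = m) (hC : C.card = m)
    (h : IsRegularPair G ε B C) (S T : Finset β) (hS : S ⊆ B) (hT : T ⊆ C) :
    ((G.interedges S T).card : ℝ) ≤
      (G.edgeDensity B C : ℝ) * S.card * T.card + ε * (m : ℝ) ^ 2 := by
  have hSm : (S.card : ℝ) ≤ m := by exact_mod_cast hB ▸ card_le_card hS
  have hTm : (T.card : ℝ) ≤ m := by exact_mod_cast hC ▸ card_le_card hT
  have hS0 : (0 : ℝ) ≤ S.card := by positivity
  have hT0 : (0 : ℝ) ≤ T.card := by positivity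
  have hm0 : (0 : ℝ) ≤ m := by positivity
  have hd0 : (0 : ℝ) ≤ (G.edgeDensity B C : ℝ) := by exact_mod_cast G.edgeDensity_nonneg B C
  have hle : ((G.interedges S T).card : ℝ) ≤ S.card * T.card := by
    exact_mod_cast G.card_interedges_le_mul S T
  have hp : 0 ≤ (G.edgeDensity B C : ℝ) * S.card * T.card := by positivity
  by_cases h1 : ε * m ≤ S.card
  · by_cases h2 : ε * m ≤ T.card
    · have h3 := h S hS T hT (by rwa [hB]) (by rwa [hC])
      have h4 := (abs_le.1 h3).2
      have h5 : ((G.interedges S T).card : ℝ) = (G.edgeDensity S T : ℝ) * (S.card * T.card) := by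
        rw [SimpleGraph.edgeDensity_def]
        push_cast
        by_cases h0 : (S.card : ℝ) * T.card = 0
        · rw [h0] at hle ⊢
          simp
          have : ((G.interedges S T).card : ℝ) = 0 := le_antisymm hle (by positivity)
          simpa using this
        · rw [div_mul_cancel₀ _ h0]
      have h6 : (S.card : ℝ) * T.card ≤ m * m := mul_le_mul hSm hTm hT0 hm0
      rw [h5]
      have h7 : (G.edgeDensity S T : ℝ) * (S.card * T.card) ≤
        ((G.edgeDensity B C : ℝ) + ε) * (S.card * T.card) := by
        gcongr; linarith
      nlinarith [mul_le_mul_of_nonneg_left h6 hε.le]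
    · push Not at h2
      have : (S.card : ℝ) * T.card ≤ m * (ε * m) := mul_le_mul hSm h2.le hT0 hm0
      nlinarith
  · push Not at h1
    have : (S.card : ℝ) * T.card ≤ (ε * m) * m := mul_le_mul h1.le hTm hT0 (by positivity)
    nlinarith

lemma tcu_bad {β : Type*} (G : SimpleGraph β) [DecidableRel G.Adj] {ε : ℝ} (hε : 0 < ε)
    (hε1 : ε ≤ 1) {A B : Finset β} {m : ℕ} (hA : A.card = m) (hB : B.card = m)
    (h : IsRegularPair G ε A B) (P : β → Prop) [DecidablePred P]
    (hP : ∀ x, P x → ((G.edgeDensity A B : ℝ) + ε) * m < ((B.filter (G.Adj x)).card : ℝ)) :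
    ((A.filter P).card : ℝ) ≤ ε * m := by
  by_contra! hlt
  set X := A.filter P with hX
  have hm0 : (0 : ℝ) ≤ m := by positivity
  have h3 := h X (filter_subset _ _) B Subset.rfl (by rw [hA]; exact hlt.le)
    (by nlinarith [show (B.card : ℝ) = m by rw [hB]])
  have h4 := (abs_le.1 h3).2
  have hXpos : (0 : ℝ) < X.card := lt_of_le_of_lt (by positivity) hlt
  have hXm : (X.card : ℝ) ≤ m := by exact_mod_cast hA ▸ card_le_card (filter_subset P A)
  have hmpos : (0 : ℝ) < m := lt_of_lt_of_le hXpos hXm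
  have hcard : ((G.interedges X B).card : ℝ) = ∑ x ∈ X, ((B.filter (G.Adj x)).card : ℝ) := by
    rw [SimpleGraph.interedges_def, card_filter, sum_product]
    push_cast [card_filter]
    rfl
  have hsum : ∑ x ∈ X, ((G.edgeDensity A B : ℝ) + ε) * m <
      ∑ x ∈ X, ((B.filter (G.Adj x)).card : ℝ) := by
    apply sum_lt_sum_of_nonempty
    · exact card_pos.1 (by exact_mod_cast hXpos)
    · intro x hx
      exact hP x (mem_filter.1 hx).2
  rw [← hcard, sum_const, nsmul_eq_mul] at hsum
  have h5 : (G.edgeDensity X B : ℝ) * (X.card * m) = (G.interedges X B).card := by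
    rw [SimpleGraph.edgeDensity_def]
    push_cast
    rw [hB]
    field_simp
  have : (G.edgeDensity X B : ℝ) * (X.card * m) ≤
      ((G.edgeDensity A B : ℝ) + ε) * (X.card * m) := by
    gcongr; linarith
  nlinarith

/-- (Triangle counting upper bound) For every `ζ > 0` there is `ε > 0` such that if
`A, B, C` are pairwise disjoint independent sets of size `m` which are pairwise
`ε`-regular with densities `α₁ = d(A,B)`, `α₂ = d(A,C)`, `α₃ = d(B,C)`, then the
number of triples in `A × B × C` spanning a triangle is at most `(α₁α₂α₃ + ζ)m³`. -/
theorem triangle_count_upper (ζ : ℝ) (hζ : 0 < ζ) :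
    ∃ ε : ℝ, 0 < ε ∧
      ∀ (β : Type) [Fintype β] (G : SimpleGraph β) [DecidableRel G.Adj]
        (A B C : Finset β) (m : ℕ) (α₁ α₂ α₃ : ℝ),
        Disjoint A B → Disjoint A C → Disjoint B C →
        (∀ x ∈ A, ∀ y ∈ A, ¬ G.Adj x y) →
        (∀ x ∈ B, ∀ y ∈ B, ¬ G.Adj x y) →
        (∀ x ∈ C, ∀ y ∈ C, ¬ G.Adj x y) →
        A.card = m → B.card = m → C.card = m →
        IsRegularPair G ε A B → IsRegularPair G ε B C → IsRegularPair G ε A C →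
        (G.edgeDensity A B : ℝ) = α₁ →
        (G.edgeDensity A C : ℝ) = α₂ →
        (G.edgeDensity B C : ℝ) = α₃ →
        (((A ×ˢ B ×ˢ C).filter fun p =>
            G.Adj p.1 p.2.1 ∧ G.Adj p.1 p.2.2 ∧ G.Adj p.2.1 p.2.2).card : ℝ)
          ≤ (α₁ * α₂ * α₃ + ζ) * (m : ℝ) ^ 3 := by
  classical
  refine ⟨min 1 (ζ / 6), by positivity, ?_⟩
  have hε : 0 < min 1 (ζ / 6) := by positivity
  have hε1 : min 1 (ζ / 6) ≤ 1 := min_le_left _ _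
  have hεζ : min 1 (ζ / 6) ≤ ζ / 6 := min_le_right _ _
  generalize min 1 (ζ / 6) = ε at hε hε1 hεζ ⊢
  intro β _ G _ A B C m α₁ α₂ α₃ _ _ _ _ _ _ hA hB hC hAB hBC hAC h1 h2 h3
  have bd : ∀ S T : Finset β, (0 : ℝ) ≤ G.edgeDensity S T ∧ (G.edgeDensity S T : ℝ) ≤ 1 :=
    fun S T => ⟨by exact_mod_cast G.edgeDensity_nonneg S T,
      by exact_mod_cast G.edgeDensity_le_one S T⟩
  have b1 := bd A B
  have b2 := bd A C
  have b3 := bd B C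
  rw [h1] at b1
  rw [h2] at b2
  rw [h3] at b3
  have hm0 : (0 : ℝ) ≤ m := by positivity
  let P : β → Prop := fun x => (α₁ + ε) * m < ((B.filter (G.Adj x)).card : ℝ)
  let Q : β → Prop := fun x => (α₂ + ε) * m < ((C.filter (G.Adj x)).card : ℝ)
  have hP : ((A.filter P).card : ℝ) ≤ ε * m :=
    tcu_bad G hε hε1 hA hB hAB P (fun x hx => by rw [h1]; exact hx)
  have hQ : ((A.filter Q).card : ℝ) ≤ ε * m :=
    tcu_bad G hε hε1 hA hC hAC Q (fun x hx => by rw [h2]; exact hx)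
  have hcard : (((A ×ˢ B ×ˢ C).filter fun p =>
            G.Adj p.1 p.2.1 ∧ G.Adj p.1 p.2.2 ∧ G.Adj p.2.1 p.2.2).card : ℝ) =
      ∑ x ∈ A, ((G.interedges (B.filter (G.Adj x)) (C.filter (G.Adj x))).card : ℝ) := by
    rw [card_filter, sum_product, Nat.cast_sum]
    refine sum_congr rfl fun x _ => ?_
    rw [← card_filter]
    congr 2
    ext ⟨y, z⟩
    simp only [mem_filter, mem_product, SimpleGraph.mk_mem_interedges_iff]
    tauto
  rw [hcard]
  have key : ∀ x ∈ A, ((G.interedges (B.filter (G.Adj x)) (C.filter (G.Adj x))).card : ℝ) ≤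
      (α₁ * α₂ * α₃ + 4 * ε) * (m : ℝ) ^ 2 + (m : ℝ) ^ 2 * (if P x then 1 else 0)
        + (m : ℝ) ^ 2 * (if Q x then 1 else 0) := by
    intro x _
    have hbm : ((B.filter (G.Adj x)).card : ℝ) ≤ m := by
      exact_mod_cast hB ▸ card_le_card (filter_subset (G.Adj x) B)
    have hcm : ((C.filter (G.Adj x)).card : ℝ) ≤ m := by
      exact_mod_cast hC ▸ card_le_card (filter_subset (G.Adj x) C)
    have hb0 : (0 : ℝ) ≤ (B.filter (G.Adj x)).card := by positivity
    have hc0 : (0 : ℝ) ≤ (C.filter (G.Adj x)).card := by positivity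
    have he := tcu_edge G hε hB hC hBC _ _ (filter_subset (G.Adj x) B) (filter_subset (G.Adj x) C)
    rw [h3] at he
    have htriv : ((G.interedges (B.filter (G.Adj x)) (C.filter (G.Adj x))).card : ℝ) ≤ m ^ 2 := by
      have : ((G.interedges (B.filter (G.Adj x)) (C.filter (G.Adj x))).card : ℝ) ≤
          (B.filter (G.Adj x)).card * (C.filter (G.Adj x)).card := by
        exact_mod_cast G.card_interedges_le_mul _ _
      nlinarith [mul_le_mul hbm hcm hc0 hm0]
    have hpos : 0 ≤ (α₁ * α₂ * α₃ + 4 * ε) * (m : ℝ) ^ 2 := by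
      have := b1.1
      have := b2.1
      have := b3.1
      positivity
    have hm2 : (0 : ℝ) ≤ (m : ℝ) ^ 2 := by positivity
    by_cases hp : P x
    · by_cases hq : Q x
      · simp only [hp, hq, if_true]; linarith
      · simp only [hp, hq, if_true, if_false]; linarith
    · by_cases hq : Q x
      · simp only [hp, hq, if_true, if_false]; linarith
      · simp only [hp, hq, if_false]
        have hp' : ((B.filter (G.Adj x)).card : ℝ) ≤ (α₁ + ε) * m := not_lt.1 hp
        have hq' : ((C.filter (G.Adj x)).card : ℝ) ≤ (α₂ + ε) * m := not_lt.1 hq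
        have hmul := mul_le_mul hp' hq' hc0 (hb0.trans hp')
        have hmul3 := mul_le_mul_of_nonneg_left hmul b3.1
        have hco : α₃ * ((α₁ + ε) * (α₂ + ε)) ≤ α₁ * α₂ * α₃ + 3 * ε := by
          have e1 : ε * (α₁ + α₂ + ε) ≤ ε * 3 :=
            mul_le_mul_of_nonneg_left (by linarith [b1.2, b2.2]) hε.le
          have e0 : 0 ≤ ε * (α₁ + α₂ + ε) := mul_nonneg hε.le (by linarith [b1.1, b2.1])
          have e2 : α₃ * (ε * (α₁ + α₂ + ε)) ≤ 1 * (ε * (α₁ + α₂ + ε)) :=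
            mul_le_mul_of_nonneg_right b3.2 e0
          linarith
        have := mul_le_mul_of_nonneg_right hco hm2
        linarith
  refine (sum_le_sum key).trans ?_
  rw [sum_add_distrib, sum_add_distrib, ← mul_sum, ← mul_sum, ← mul_sum, sum_boole, sum_boole, sum_const,
    nsmul_eq_mul, hA]
  have hm2 : (0 : ℝ) ≤ (m : ℝ) ^ 2 := by positivity
  have k1 := mul_le_mul_of_nonneg_left hP hm2
  have k2 := mul_le_mul_of_nonneg_left hQ hm2
  have k3 : ε * (m : ℝ) ^ 3 ≤ ζ / 6 * (m : ℝ) ^ 3 :=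
    mul_le_mul_of_nonneg_right hεζ (by positivity)
  linarith
end

section
/- (Bollobás–Erdős–Simonovits) There is an absolute constant c > 1 such that for every positive integer t, every finite simple graph G on n ≥ c^t vertices with at least (13/24)·(n choose 2) edges contains a copy of K_{t,t,t} (i.e., K_{t,t,t} embeds into G as a subgraph). -/
open SimpleGraph Finset

open Classical in
theorem bes_pigeon {α β : Type*} (R : α → β → Prop) (I : Finset α) (Y : Finset β) (k t : ℕ)
    (hk : 0 < k) (ht : 0 < t) (hI : #I = 2 * k * t)
    (hdeg : ∀ i ∈ I, #Y ≤ k * #{y ∈ Y | R i y})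
    (hY : 2 * k * (2 ^ (2 * k * t) * t) ≤ #Y) :
    ∃ T ⊆ I, ∃ W ⊆ Y, #T = t ∧ #W = t ∧ ∀ i ∈ T, ∀ w ∈ W, R i w := by
  have hdc : ∑ i ∈ I, #{y ∈ Y | R i y} = ∑ y ∈ Y, #{i ∈ I | R i y} :=
    Finset.sum_card_bipartiteAbove_eq_sum_card_bipartiteBelow R
  set g : Finset β := {y ∈ Y | t ≤ #{i ∈ I | R i y}} with hg
  have h1 : #I * #Y ≤ k * ∑ y ∈ Y, #{i ∈ I | R i y} := by
    rw [← hdc, Finset.mul_sum, ← smul_eq_mul]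
    exact Finset.card_nsmul_le_sum _ _ _ hdeg
  have h2 : ∑ y ∈ Y, #{i ∈ I | R i y} ≤ #g * #I + #Y * t := by
    rw [← Finset.sum_filter_add_sum_filter_not Y (fun y => t ≤ #{i ∈ I | R i y})]
    apply add_le_add
    · rw [← smul_eq_mul]
      exact Finset.sum_le_card_nsmul _ _ _ (fun y _ => Finset.card_filter_le _ _)
    · calc _ ≤ #{y ∈ Y | ¬ t ≤ #{i ∈ I | R i y}} • t := by
            apply Finset.sum_le_card_nsmul
            intro y hy
            have := (Finset.mem_filter.1 hy).2
            omega
        _ ≤ #Y * t := by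
            rw [smul_eq_mul]
            exact Nat.mul_le_mul_right _ (Finset.card_filter_le _ _)
  have h3 : #Y ≤ 2 * k * #g := by
    have h4 : 2 * k * t * #Y ≤ k * (#g * (2 * k * t) + #Y * t) := by
      rw [← hI]; exact h1.trans (Nat.mul_le_mul_left _ h2)
    have h5 : (k * t) * #Y ≤ (k * t) * (2 * k * #g) := by nlinarith
    exact Nat.le_of_mul_le_mul_left h5 (by positivity)
  have h6 : 2 ^ (2 * k * t) * t ≤ #g :=
    Nat.le_of_mul_le_mul_left (hY.trans h3) (by positivity)
  obtain ⟨N, hN, hNc⟩ := Finset.exists_le_card_fiber_of_mul_le_card_of_maps_to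
    (s := g) (t := I.powerset) (f := fun y => ({i ∈ I | R i y} : Finset α)) (n := t)
    (fun y _ => Finset.mem_powerset.2 (Finset.filter_subset _ _))
    ⟨∅, by simp⟩ (by rw [Finset.card_powerset, hI]; exact h6)
  obtain ⟨W, hW, hWc⟩ := Finset.exists_subset_card_eq hNc
  have hNt : t ≤ #N := by
    obtain ⟨w, hw⟩ := Finset.card_pos.1 (hWc ▸ ht)
    have := Finset.mem_filter.1 (hW hw)
    rw [← this.2]
    exact (Finset.mem_filter.1 this.1).2
  obtain ⟨T, hT, hTc⟩ := Finset.exists_subset_card_eq hNt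
  refine ⟨T, hT.trans (Finset.mem_powerset.1 hN), W, ?_, hTc, hWc, ?_⟩
  · intro w hw
    exact (Finset.mem_filter.1 (Finset.mem_filter.1 (hW hw)).1).1
  · intro i hi w hw
    have h7 := (Finset.mem_filter.1 (hW hw)).2
    have h8 := hT hi
    rw [← h7] at h8
    exact (Finset.mem_filter.1 h8).2

open Classical in
/-- Many ordered edges with large codegree. -/
theorem bes_codeg {β : Type*} [Fintype β] (G : SimpleGraph β) (hn : 26 ≤ Fintype.card β)
    (he : (13 / 24 : ℝ) * ((Fintype.card β).choose 2) ≤ (G.edgeSet.ncard : ℝ)) :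
    ((Fintype.card β : ℝ)) ^ 2 / 100 ≤ ∑ u : β, (#{v : β | G.Adj u v ∧
      Fintype.card β ≤ 100 * #{w : β | G.Adj u w ∧ G.Adj v w}} : ℝ) := by
  set n := Fintype.card β with hnn
  have hn' : (26 : ℝ) ≤ n := by exact_mod_cast hn
  have hsum : (∑ u : β, (G.degree u : ℝ)) = 2 * (G.edgeSet.ncard : ℝ) := by
    have := G.sum_degrees_eq_twice_card_edges
    rw [← coe_edgeFinset, Set.ncard_coe_finset]
    exact_mod_cast this
  set S := ∑ u : β, (G.degree u : ℝ) with hS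
  have hSn : (25 / 48 : ℝ) * n ^ 2 ≤ S := by
    rw [hsum]
    rw [Nat.cast_choose_two] at he
    nlinarith
  have hCS : S ^ 2 ≤ n * ∑ u : β, (G.degree u : ℝ) ^ 2 := by
    have := sq_sum_le_card_mul_sum_sq (s := (Finset.univ : Finset β))
      (f := fun u => (G.degree u : ℝ))
    simpa [hnn] using this
  set Q := ∑ u : β, (G.degree u : ℝ) ^ 2 with hQ
  -- codegree
  set c : β → β → ℝ := fun u v => (#{w : β | G.Adj u w ∧ G.Adj v w} : ℝ) with hc
  have hcod : ∀ u v, (G.degree u : ℝ) + G.degree v - n ≤ c u v := by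
    intro u v
    have h1 := Finset.card_union_add_card_inter (G.neighborFinset u) (G.neighborFinset v)
    have h2 : #(G.neighborFinset u ∪ G.neighborFinset v) ≤ n := Finset.card_le_univ _
    have h3 : G.neighborFinset u ∩ G.neighborFinset v =
        ({w : β | G.Adj u w ∧ G.Adj v w} : Finset β) := by
      ext w; simp
    rw [h3, G.card_neighborFinset_eq_degree, G.card_neighborFinset_eq_degree] at h1
    have : G.degree u + G.degree v ≤ n + #{w : β | G.Adj u w ∧ G.Adj v w} := by omega
    have : (G.degree u : ℝ) + G.degree v ≤ n + c u v := by
      simp only [hc]; exact_mod_cast this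
    linarith
  have hcn : ∀ u v, c u v ≤ n := by
    intro u v
    have : #{w : β | G.Adj u w ∧ G.Adj v w} ≤ n := Finset.card_le_univ _
    simp only [hc]
    exact_mod_cast this
  have hdeg : ∀ u, ∑ v : β, (if G.Adj u v then (1 : ℝ) else 0) = G.degree u := by
    intro u
    rw [Finset.sum_boole, ← G.card_neighborFinset_eq_degree]
    congr 2
    ext w; simp
  have hdeg' : ∀ u, ∑ v : β, (if G.Adj v u then (1 : ℝ) else 0) = G.degree u := by
    intro u
    rw [← hdeg u]
    simp only [G.adj_comm]
  have hlow : 2 * Q - n * S ≤ ∑ u : β, ∑ v : β, (if G.Adj u v then c u v else 0) := by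
    calc 2 * Q - n * S = ∑ u : β, ∑ v : β, (if G.Adj u v then (1 : ℝ) else 0) *
          ((G.degree u : ℝ) + G.degree v - n) := by
          have e1 : ∑ u : β, ∑ v : β, (if G.Adj u v then (1 : ℝ) else 0) * (G.degree u : ℝ) = Q := by
            rw [hQ]
            refine Finset.sum_congr rfl fun u _ => ?_
            rw [← Finset.sum_mul, hdeg, sq]
          have e2 : ∑ u : β, ∑ v : β, (if G.Adj u v then (1 : ℝ) else 0) * (G.degree v : ℝ) = Q := by
            rw [hQ, Finset.sum_comm]
            refine Finset.sum_congr rfl fun u _ => ?_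
            rw [← Finset.sum_mul, hdeg', sq]
          have e3 : ∑ u : β, ∑ v : β, (if G.Adj u v then (1 : ℝ) else 0) * (n : ℝ) = n * S := by
            rw [hS, Finset.mul_sum]
            refine Finset.sum_congr rfl fun u _ => ?_
            rw [← Finset.sum_mul, hdeg, mul_comm]
          simp only [mul_add, mul_sub, Finset.sum_add_distrib, Finset.sum_sub_distrib, e1, e2, e3]
          ring
      _ ≤ _ := by
          refine Finset.sum_le_sum fun u _ => Finset.sum_le_sum fun v _ => ?_
          split_ifs
          · simpa using hcod u v
          · simp
  have hup : ∑ u : β, ∑ v : β, (if G.Adj u v then c u v else 0) ≤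
      n * (∑ u : β, (#{v : β | G.Adj u v ∧
      n ≤ 100 * #{w : β | G.Adj u w ∧ G.Adj v w}} : ℝ)) + n ^ 3 / 100 := by
    calc _ ≤ ∑ u : β, ∑ v : β, ((n : ℝ) * (if G.Adj u v ∧
          n ≤ 100 * #{w : β | G.Adj u w ∧ G.Adj v w} then (1 : ℝ) else 0) + (n : ℝ) / 100) := by
          refine Finset.sum_le_sum fun u _ => Finset.sum_le_sum fun v _ => ?_
          by_cases h1 : G.Adj u v
          · by_cases h2 : n ≤ 100 * #{w : β | G.Adj u w ∧ G.Adj v w}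
            · simp only [h1, h2, if_true, and_self]
              have := hcn u v
              linarith
            · simp only [h1, h2, if_true, and_false, if_false]
              have : 100 * c u v ≤ n := by
                have : 100 * #{w : β | G.Adj u w ∧ G.Adj v w} ≤ n := by omega
                simp only [hc]
                exact_mod_cast this
              linarith
          · simp only [h1, if_false, false_and]
            linarith
      _ = _ := by
          simp only [Finset.sum_add_distrib, ← Finset.mul_sum, Finset.sum_boole, Finset.sum_const,
            Finset.card_univ, nsmul_eq_mul, ← hnn]
          ring
  set P := ∑ u : β, (#{v : β | G.Adj u v ∧
      n ≤ 100 * #{w : β | G.Adj u w ∧ G.Adj v w}} : ℝ) with hP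
  have hnpos : (0 : ℝ) < n := by linarith
  have hA : 2 * Q - n * S ≤ n * P + n ^ 3 / 100 := hlow.trans hup
  have hB : S * (2 * S - n ^ 2) ≤ n * (n * P + n ^ 3 / 100) := by nlinarith
  have hC : (25 / 48 * n ^ 2) * (n ^ 2 / 24 : ℝ) ≤ S * (2 * S - n ^ 2) := by
    apply mul_le_mul hSn (by linarith) (by positivity) 
    exact le_trans (by positivity) hSn
  have hD : (n : ℝ) ^ 2 * (n ^ 2 / 100) ≤ n ^ 2 * P := by
    have : (0 : ℝ) ≤ n ^ 4 := by positivity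
    nlinarith
  exact le_of_mul_le_mul_left hD (by positivity)

theorem bes_pow (t : ℕ) : t < 2 ^ t := Nat.lt_two_pow_self

open Classical in
theorem bes_core {β : Type*} [Fintype β] (G : SimpleGraph β) (t : ℕ) (ht : 0 < t)
    (hn : 2 ^ (100000 * t) ≤ Fintype.card β)
    (he : (13 / 24 : ℝ) * ((Fintype.card β).choose 2) ≤ (G.edgeSet.ncard : ℝ)) :
    ∃ g : Fin 3 → Fin t → β, (∀ i, Function.Injective (g i)) ∧
      ∀ i j, i ≠ j → ∀ a b, G.Adj (g i a) (g j b) := by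
  set n := Fintype.card β with hnn
  have hA : 2 ^ 18 * (2 ^ (80000 * t) * t) ≤ n := by
    calc 2 ^ 18 * (2 ^ (80000 * t) * t) ≤ 2 ^ 18 * (2 ^ (80000 * t) * 2 ^ t) := by
          gcongr; exact (bes_pow t).le
      _ = 2 ^ (18 + (80000 * t + t)) := by rw [pow_add 2 18, pow_add 2 (80000 * t)]
      _ ≤ 2 ^ (100000 * t) := Nat.pow_le_pow_right (by norm_num) (by omega)
      _ ≤ n := hn
  have hB : 200 * (2 * 200 * (200 * t)) ≤ n := by
    have h1 : 80000 * t < 2 ^ (80000 * t) := bes_pow _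
    have h2 : 2 ^ (80000 * t) ≤ 2 ^ (80000 * t) * t := Nat.le_mul_of_pos_right _ ht
    omega
  have hC : 2 * 100 * (2 ^ (2 * 100 * t) * t) ≤ n := by
    have h2 : 2 ^ (2 * 100 * t) * t ≤ 2 ^ (80000 * t) * t :=
      Nat.mul_le_mul_right _ (Nat.pow_le_pow_right (by norm_num) (by omega))
    omega
  have hD : 2 * 200 * (2 ^ (2 * 200 * (200 * t)) * (200 * t)) ≤ n := by
    have h3 : 2 * 200 * (200 * t) = 80000 * t := by ring
    rw [h3]
    have h4 : 2 ^ (80000 * t) * (200 * t) = 200 * (2 ^ (80000 * t) * t) := by ring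
    rw [h4]
    omega
  have hP := bes_codeg G (by omega) he
  rw [← hnn] at hP
  set R : β → β → Prop := fun u v => G.Adj u v ∧
      n ≤ 100 * #{w : β | G.Adj u w ∧ G.Adj v w} with hR
  set U : Finset β := {u : β | n ≤ 200 * #{v : β | R u v}} with hU
  have hUc : n ≤ 200 * #U := by
    have h1 : ∑ u : β, (#{v : β | R u v} : ℝ) ≤ n * #U + n * n / 200 := by
      calc _ ≤ ∑ u : β, ((n : ℝ) * (if n ≤ 200 * #{v : β | R u v} then (1 : ℝ) else 0)
            + (n : ℝ) / 200) := by
            refine Finset.sum_le_sum fun u _ => ?_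
            by_cases h2 : n ≤ 200 * #{v : β | R u v}
            · simp only [h2, if_true]
              have : (#{v : β | R u v} : ℝ) ≤ n := by exact_mod_cast Finset.card_le_univ _
              have : (0 : ℝ) ≤ n := by positivity
              linarith
            · simp only [h2, if_false]
              have : (200 : ℝ) * #{v : β | R u v} ≤ n := by
                exact_mod_cast (not_le.1 h2).le
              linarith
        _ = _ := by
            simp only [Finset.sum_add_distrib, ← Finset.mul_sum, Finset.sum_boole, Finset.sum_const,
              Finset.card_univ, nsmul_eq_mul, ← hnn, hU]
            ring
    have h2 : (n : ℝ) ^ 2 / 100 ≤ n * #U + n * n / 200 := hP.trans h1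
    have hnpos : (0 : ℝ) < n := by
      have : 0 < n := by omega
      exact_mod_cast this
    have h3 : (n : ℝ) * n ≤ n * (200 * #U) := by nlinarith
    exact_mod_cast le_of_mul_le_mul_left h3 hnpos
  obtain ⟨I, hI, hIc⟩ := Finset.exists_subset_card_eq
    (show 2 * 200 * (200 * t) ≤ #U by omega)
  obtain ⟨A, hAI, B, -, hAc, hBc, hAB⟩ := bes_pigeon R I Finset.univ 200 (200 * t)
    (by norm_num) (by omega) hIc
    (fun i hi => by
      rw [Finset.card_univ]
      convert (Finset.mem_filter.1 (hI hi)).2) hD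
  set eA := (A.equivFinOfCardEq hAc).symm
  set eB := (B.equivFinOfCardEq hBc).symm
  obtain ⟨T, -, W, -, hTc, hWc, hTW⟩ := bes_pigeon
    (fun (i : Fin (200 * t)) (w : β) => G.Adj (eA i) w ∧ G.Adj (eB i) w) Finset.univ Finset.univ
    100 t (by norm_num) ht (by simp)
    (fun i _ => by
      rw [Finset.card_univ]
      convert (hAB _ (eA i).2 _ (eB i).2).2) hC
  set eT := (T.equivFinOfCardEq hTc).symm
  set eW := (W.equivFinOfCardEq hWc).symm
  have inj1 : Function.Injective (fun a : Fin t => (eA (eT a) : β)) := by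
    intro a b h
    exact eT.injective (Subtype.ext (eA.injective (Subtype.ext h)))
  have inj2 : Function.Injective (fun a : Fin t => (eB (eT a) : β)) := by
    intro a b h
    exact eT.injective (Subtype.ext (eB.injective (Subtype.ext h)))
  have inj3 : Function.Injective (fun a : Fin t => (eW a : β)) := by
    intro a b h
    exact eW.injective (Subtype.ext h)
  have a12 : ∀ a b : Fin t, G.Adj (eA (eT a) : β) (eB (eT b)) := fun a b =>
    (hAB _ (eA _).2 _ (eB _).2).1
  have a13 : ∀ a b : Fin t, G.Adj (eA (eT a) : β) (eW b) := fun a b =>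
    (hTW _ (eT a).2 _ (eW b).2).1
  have a23 : ∀ a b : Fin t, G.Adj (eB (eT a) : β) (eW b) := fun a b =>
    (hTW _ (eT a).2 _ (eW b).2).2
  refine ⟨![fun a => (eA (eT a) : β), fun a => (eB (eT a) : β), fun a => (eW a : β)], ?_, ?_⟩
  · intro i
    fin_cases i
    · exact inj1
    · exact inj2
    · exact inj3
  · intro i j hij a b
    fin_cases i <;> fin_cases j
    · exact absurd rfl hij
    · exact a12 a b
    · exact a13 a b
    · exact (a12 b a).symm
    · exact absurd rfl hij
    · exact a23 a b
    · exact (a13 b a).symm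
    · exact (a23 b a).symm
    · exact absurd rfl hij

/-- (Bollobás–Erdős–Simonovits) There is an absolute constant `c > 1` such that
every graph on `n ≥ c^t` vertices with at least `(13/24)·(n choose 2)` edges
contains a copy of `K_{t,t,t}`. -/
theorem bollobas_erdos_simonovits :
    ∃ c : ℝ, 1 < c ∧ ∀ t : ℕ, 0 < t →
      ∀ (β : Type) [Fintype β] (G : SimpleGraph β),
        c ^ t ≤ (Fintype.card β : ℝ) →
        (13 / 24 : ℝ) * ((Fintype.card β).choose 2) ≤ (G.edgeSet.ncard : ℝ) →
        ∃ f : (Σ i : Fin 3, Fin (![t, t, t] i)) → β,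
          Function.Injective f ∧
          ∀ v w, (Kabc t t t).Adj v w → G.Adj (f v) (f w) := by
  obtain ⟨k, hk⟩ : ∃ k : ℕ, k = 100000 := ⟨_, rfl⟩
  refine ⟨2 ^ k, one_lt_pow₀ (by norm_num) (by omega), ?_⟩
  intro t ht β _ G hn he
  rw [← pow_mul] at hn
  have hn' : 2 ^ (k * t) ≤ Fintype.card β := by exact_mod_cast hn
  rw [hk] at hn'
  obtain ⟨g, hg1, hg2⟩ := bes_core G t ht hn' he
  have hcast : ∀ i : Fin 3, ![t, t, t] i = t := by
    intro i; fin_cases i <;> rfl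
  have hadj : ∀ v w : (Σ i : Fin 3, Fin (![t, t, t] i)), v.1 ≠ w.1 →
      G.Adj (g v.1 (Fin.cast (hcast v.1) v.2)) (g w.1 (Fin.cast (hcast w.1) w.2)) :=
    fun v w h => hg2 _ _ h _ _
  refine ⟨fun v => g v.1 (Fin.cast (hcast v.1) v.2), ?_, ?_⟩
  · intro v w h
    by_cases hvw : v.1 = w.1
    · obtain ⟨i, a⟩ := v
      obtain ⟨j, b⟩ := w
      obtain rfl : i = j := hvw
      have : a = b := Fin.cast_injective _ (hg1 i h)
      rw [this]
    · exact absurd h (hadj v w hvw).ne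
  · intro v w h
    exact hadj v w h
end
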